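/- There is a constant C > 0 such that for every integer k ≥ 1 the following holds: for every set V ⊆ ℝ² of exactly 2 distinct points, every v ∈ V, and every finite family of pairwise non-homotopic v-loops in which each loop has fewer than k self-intersections, the family has at most exp(C·√k) members. -/

import Mathlib

/-- An `x`-loop with respect to the obstacle set `V`: a continuous function on `[0,1]`
with both endpoints at `x`, avoiding `V` on the open interval `(0,1)`. -/
def IsLoop (V : Set (ℝ × ℝ)) (x : ℝ × ℝ) (f : ℝ → ℝ × ℝ) : Prop :=
  ContinuousOn f (Set.Icc 0 1) ∧ f 0 = x ∧ f 1 = x ∧ ∀ t ∈ Set.Ioo (0:ℝ) 1, f t ∉ V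

/-- Two `x`-loops are homotopic (relative to the obstacle set `V`). -/
def LoopHomotopic (V : Set (ℝ × ℝ)) (x : ℝ × ℝ) (f g : ℝ → ℝ × ℝ) : Prop :=
  ∃ H : ℝ → ℝ → ℝ × ℝ,
    ContinuousOn (fun p : ℝ × ℝ => H p.1 p.2) (Set.Icc 0 1 ×ˢ Set.Icc 0 1) ∧
    (∀ t ∈ Set.Icc (0:ℝ) 1, H 0 t = f t ∧ H 1 t = g t) ∧
    (∀ s ∈ Set.Icc (0:ℝ) 1, H s 0 = x ∧ H s 1 = x) ∧
    (∀ s ∈ Set.Ioo (0:ℝ) 1, ∀ t ∈ Set.Ioo (0:ℝ) 1, H s t ∉ V)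

/-- The set of self-intersections of a loop: unordered pairs `{t,u} ⊆ (0,1)`, `t ≠ u`,
`f t = f u`, encoded as ordered pairs with `t < u`. -/
def SelfIntersections (f : ℝ → ℝ × ℝ) : Set (ℝ × ℝ) :=
  {p | p.1 ∈ Set.Ioo (0:ℝ) 1 ∧ p.2 ∈ Set.Ioo (0:ℝ) 1 ∧ p.1 < p.2 ∧ f p.1 = f p.2}

/-- The set of intersections of two loops: ordered pairs `(t,u) ∈ (0,1)²` with
`f t = g u`. -/
def Intersections (f g : ℝ → ℝ × ℝ) : Set (ℝ × ℝ) :=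
  {p | p.1 ∈ Set.Ioo (0:ℝ) 1 ∧ p.2 ∈ Set.Ioo (0:ℝ) 1 ∧ f p.1 = g p.2}

/-- Loop `f` has fewer than `k` self-intersections. -/
def FewerSelfInterThan (k : ℕ) (f : ℝ → ℝ × ℝ) : Prop :=
  (SelfIntersections f).Finite ∧ (SelfIntersections f).ncard < k

/-- Loops `f` and `g` have fewer than `k` intersections. -/
def FewerInterThan (k : ℕ) (f g : ℝ → ℝ × ℝ) : Prop :=
  (Intersections f g).Finite ∧ (Intersections f g).ncard < k

open scoped MatrixGroups UpperHalfPlane Topology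
open Matrix

theorem SL2_mul_apply (g h : SL(2, ℤ)) :
    (g * h) 0 0 = g 0 0 * h 0 0 + g 0 1 * h 1 0 ∧ (g * h) 0 1 = g 0 0 * h 0 1 + g 0 1 * h 1 1 ∧
    (g * h) 1 0 = g 1 0 * h 0 0 + g 1 1 * h 1 0 ∧ (g * h) 1 1 = g 1 0 * h 0 1 + g 1 1 * h 1 1 := by
  simp [mul_apply, Fin.sum_univ_two]

/-- The Sanov subgroup of `SL(2, ℤ)`. -/
def sanov : Subgroup SL(2, ℤ) where
  carrier := {g | g 0 0 % 4 = 1 ∧ g 0 1 % 2 = 0 ∧ g 1 0 % 2 = 0}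
  one_mem' := by simp
  mul_mem' := by
    rintro g h ⟨ha, hb, hc⟩ ⟨ha', hb', hc'⟩
    obtain ⟨a, ha⟩ : ∃ a, g 0 0 = 4 * a + 1 := ⟨g 0 0 / 4, by omega⟩
    obtain ⟨a', ha'⟩ : ∃ a, h 0 0 = 4 * a + 1 := ⟨h 0 0 / 4, by omega⟩
    obtain ⟨b, hb⟩ : ∃ a, g 0 1 = 2 * a := ⟨g 0 1 / 2, by omega⟩
    obtain ⟨b', hb'⟩ : ∃ a, h 0 1 = 2 * a := ⟨h 0 1 / 2, by omega⟩
    obtain ⟨c, hc⟩ : ∃ a, g 1 0 = 2 * a := ⟨g 1 0 / 2, by omega⟩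
    obtain ⟨c', hc'⟩ : ∃ a, h 1 0 = 2 * a := ⟨h 1 0 / 2, by omega⟩
    obtain ⟨h1, h2, h3, -⟩ := SL2_mul_apply g h
    rw [ha, ha', hb, hb', hc, hc'] at *
    refine ⟨h1 ▸ ?_, h2 ▸ ?_, h3 ▸ ?_⟩ <;> ring_nf <;> omega
  inv_mem' := by
    rintro g ⟨ha, hb, hc⟩
    have hd := g.det_coe
    rw [det_fin_two] at hd
    obtain ⟨a, ha⟩ : ∃ a, g 0 0 = 4 * a + 1 := ⟨g 0 0 / 4, by omega⟩
    obtain ⟨b, hb⟩ : ∃ a, g 0 1 = 2 * a := ⟨g 0 1 / 2, by omega⟩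
    obtain ⟨c, hc⟩ : ∃ a, g 1 0 = 2 * a := ⟨g 1 0 / 2, by omega⟩
    have hd' : g 1 1 = 1 + 4 * (b * c - a * g 1 1) := by
      rw [ha, hb, hc] at hd; linarith
    change g⁻¹ 0 0 % 4 = 1 ∧ g⁻¹ 0 1 % 2 = 0 ∧ g⁻¹ 1 0 % 2 = 0
    simp [SpecialLinearGroup.SL2_inv_expl]
    omega

theorem mem_sanov {g : SL(2, ℤ)} :
    g ∈ sanov ↔ g 0 0 % 4 = 1 ∧ g 0 1 % 2 = 0 ∧ g 1 0 % 2 = 0 := Iff.rfl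

theorem sanov_lower_right {g : SL(2, ℤ)} (hg : g ∈ sanov) : g 1 1 % 4 = 1 := by
  simpa [SpecialLinearGroup.SL2_inv_expl] using (mem_sanov.1 (inv_mem hg)).1

theorem SL2_det (g : SL(2, ℤ)) : g 0 0 * g 1 1 - g 0 1 * g 1 0 = 1 := by
  have := g.det_coe
  rwa [det_fin_two] at this

theorem coe_SL2Z_smul (g : SL(2, ℤ)) (u : ℍ) :
    ((g • u : ℍ) : ℂ) = ((g 0 0 : ℂ) * u + g 0 1) / ((g 1 0 : ℂ) * u + g 1 1) := by
  simpa using UpperHalfPlane.coe_specialLinearGroup_apply g u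

theorem SL2Z_denom_ne_zero (g : SL(2, ℤ)) (u : ℍ) : (g 1 0 : ℂ) * u + g 1 1 ≠ 0 := by
  simpa [ModularGroup.denom_apply] using UpperHalfPlane.denom_ne_zero (g : GL (Fin 2) ℝ) u

theorem im_SL2Z_smul (g : SL(2, ℤ)) (u : ℍ) :
    (g • u).im = u.im / Complex.normSq ((g 1 0 : ℂ) * u + g 1 1) := by
  rw [ModularGroup.im_smul_eq_div_normSq]
  simp [ModularGroup.denom_apply]

theorem sanov_free {g : SL(2, ℤ)} (hg : g ∈ sanov) {u : ℍ} (h : g • u = u) : g = 1 := by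
  have h1 := coe_SL2Z_smul g u
  rw [h, eq_div_iff (SL2Z_denom_ne_zero g u)] at h1
  have hre := congrArg Complex.re h1
  have him := congrArg Complex.im h1
  simp at hre him
  have hy := u.im_pos
  have hdet := SL2_det g
  obtain ⟨ha, hb, hc⟩ := mem_sanov.1 hg
  have hd := sanov_lower_right hg
  have e1 : (2 * g 1 0 * u.re + g 1 1 - g 0 0) = 0 := by
    apply mul_right_cancel₀ hy.ne'; linarith
  have e2 : (g 1 0 : ℝ) * (u.re ^ 2 - u.im ^ 2) + (g 1 1 - g 0 0) * u.re - g 0 1 = 0 := by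
    linarith
  have hdet' : (g 0 0 * g 1 1 - g 0 1 * g 1 0 : ℝ) = 1 := by exact_mod_cast hdet
  have e3 : ((g 0 0 + g 1 1 : ℝ)) ^ 2 = 4 - 4 * (g 1 0) ^ 2 * u.im ^ 2 := by
    have : (g 1 1 - g 0 0 : ℝ) = - 2 * g 1 0 * u.re := by linarith
    rw [this] at e2
    have e4 : (g 0 1 : ℝ) = - g 1 0 * (u.re ^ 2 + u.im ^ 2) := by linarith
    rw [e4] at hdet'
    have : (g 1 1 : ℝ) = g 0 0 - 2 * g 1 0 * u.re := by linarith
    rw [this] at hdet' ⊢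
    linarith
  by_cases hc0 : g 1 0 = 0
  · have e5 : g 0 0 = g 1 1 := by
      rw [hc0] at e1; push_cast at e1
      exact_mod_cast (by linarith : (g 0 0 : ℝ) = g 1 1)
    have e6 : g 0 1 = 0 := by
      rw [hc0, e5] at e2; push_cast at e2
      exact_mod_cast (by linarith : (g 0 1 : ℝ) = 0)
    rw [← e5, hc0] at hdet
    have : g 0 0 = 1 := by
      have : (g 0 0 - 1) * (g 0 0 + 1) = 0 := by linarith
      rcases mul_eq_zero.1 this with h | h <;> omega
    ext i j
    fin_cases i <;> fin_cases j <;> simp_all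
  · have : ((g 0 0 + g 1 1 : ℝ)) ^ 2 < 2 ^ 2 := by
      have : 0 < (g 1 0 : ℝ) ^ 2 * u.im ^ 2 := by positivity
      linarith
    have := abs_lt_of_sq_lt_sq' this (by norm_num)
    have h1 : -2 < g 0 0 + g 1 1 := by exact_mod_cast this.1
    have h2 : g 0 0 + g 1 1 < 2 := by exact_mod_cast this.2
    omega

instance : IsCancelSMul sanov ℍ :=
  isCancelSMul_iff_eq_one_of_smul_eq.mpr fun g _ h => Subtype.ext (sanov_free g.2 h)

instance : ProperlyDiscontinuousSMul sanov ℍ where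
  finite_disjoint_inter_image {K L} hK hL := by
    have := ProperlyDiscontinuousSMul.finite_disjoint_inter_image (Γ := 𝒮ℒ) hK hL
    let f : sanov → 𝒮ℒ := fun g => ⟨(Matrix.SpecialLinearGroup.mapGL ℝ) g.1, ⟨g.1, rfl⟩⟩
    have hinj : Function.Injective f := fun g h hgh =>
      Subtype.ext (Matrix.SpecialLinearGroup.mapGL_injective (congrArg Subtype.val hgh))
    exact Set.Finite.preimage (f := f) hinj.injOn this

theorem sanov_exists_max_im (u : ℍ) :
    ∃ g ∈ sanov, ∀ g' ∈ sanov, (g' • u).im ≤ (g • u).im := by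
  let s : Set (Fin 2 → ℤ) := {p | ∃ g ∈ sanov, (g : SL(2, ℤ)) 1 = p}
  obtain ⟨p, ⟨g, hg, rfl⟩, hp⟩ := Filter.Tendsto.exists_within_forall_le (s := s)
    ⟨_, 1, one_mem _, rfl⟩
    (ModularGroup.tendsto_normSq_coprime_pair u)
  refine ⟨g, hg, fun g' hg' => ?_⟩
  rw [im_SL2Z_smul, im_SL2Z_smul, div_le_div_iff_of_pos_left u.im_pos
    (Complex.normSq_pos.2 (SL2Z_denom_ne_zero _ _)) (Complex.normSq_pos.2 (SL2Z_denom_ne_zero _ _))]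
  exact hp (g' 1) ⟨g', hg', rfl⟩

theorem SL2Z_smul_re_im (g : SL(2, ℤ)) (u : ℍ) :
    (g • u).re * (g 1 0 * u.re + g 1 1) - (g • u).im * (g 1 0 * u.im) = g 0 0 * u.re + g 0 1 ∧
    (g • u).re * (g 1 0 * u.im) + (g • u).im * (g 1 0 * u.re + g 1 1) = g 0 0 * u.im := by
  have h := coe_SL2Z_smul g u
  rw [eq_div_iff (SL2Z_denom_ne_zero g u)] at h
  generalize g • u = w at h
  have hre := congrArg Complex.re h
  have him := congrArg Complex.im h
  simp at hre him
  exact ⟨hre, him⟩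

theorem SL2Z_smul_im_mul (g : SL(2, ℤ)) (u : ℍ) :
    (g • u).im * ((g 1 0 * u.re + g 1 1) ^ 2 + (g 1 0 * u.im) ^ 2) = u.im := by
  have hdet : (g 0 0 * g 1 1 - g 0 1 * g 1 0 : ℝ) = 1 := by exact_mod_cast SL2_det g
  obtain ⟨h1, h2⟩ := SL2Z_smul_re_im g u
  linear_combination (g 1 0 * u.re + g 1 1) * h2 - (g 1 0 * u.im) * h1 + u.im * hdet

theorem SL2Z_smul_im_mul_inv (g : SL(2, ℤ)) (u : ℍ) :
    u.im * ((-g 1 0 * (g • u).re + g 0 0) ^ 2 + (-g 1 0 * (g • u).im) ^ 2) = (g • u).im := by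
  have h := SL2Z_smul_im_mul g⁻¹ (g • u)
  rw [inv_smul_smul] at h
  generalize g • u = w at h ⊢
  simpa [SpecialLinearGroup.SL2_inv_expl] using h

theorem exists_SL2_entries {a b c d : ℤ} (h : a * d - b * c = 1) :
    ∃ g : SL(2, ℤ), g 0 0 = a ∧ g 0 1 = b ∧ g 1 0 = c ∧ g 1 1 = d :=
  ⟨⟨!![a, b; c, d], by rw [det_fin_two]; simpa using h⟩, rfl, rfl, rfl, rfl⟩

/-- A closed fundamental domain for the Sanov subgroup. -/
def sanovDomain : Set ℍ := {u | |u.re| ≤ 1 ∧ |u.re| ≤ u.re ^ 2 + u.im ^ 2}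

theorem mem_sanovDomain {u : ℍ} :
    u ∈ sanovDomain ↔ |u.re| ≤ 1 ∧ |u.re| ≤ u.re ^ 2 + u.im ^ 2 := Iff.rfl

theorem one_le_denom_and_eq {x y : ℝ} (hx : |x| ≤ 1) (hxy : |x| ≤ x ^ 2 + y ^ 2) (hy : 0 < y)
    {c d : ℤ} (hc : c % 2 = 0) (hd : d % 4 = 1) :
    1 ≤ (c * x + d) ^ 2 + (c * y) ^ 2 ∧
      ((c * x + d) ^ 2 + (c * y) ^ 2 = 1 → c ≠ 0 →
        x ^ 2 + y ^ 2 = |x| ∧ d = 1 ∧ (c * x : ℝ) = - 2 * |x| ∧ |c| = 2) := by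
  have h1 : 1 ≤ (|c| - |d|) ^ 2 := by
    have : |c| - |d| ≠ 0 := by
      rcases abs_cases c with h | h <;> rcases abs_cases d with h' | h' <;> omega
    have := Int.one_le_abs this
    rw [← sq_abs]; nlinarith
  have h2 : 1 ≤ d ^ 2 := by
    have : d ≠ 0 := by omega
    have := Int.one_le_abs this
    rw [← sq_abs]; nlinarith
  have h1' : (1 : ℝ) ≤ (|(c : ℝ)| - |(d : ℝ)|) ^ 2 := by exact_mod_cast h1
  have h2' : (1 : ℝ) ≤ (d : ℝ) ^ 2 := by exact_mod_cast h2
  have e : (c * x + d) ^ 2 + (c * y) ^ 2 = (c : ℝ) ^ 2 * (x ^ 2 + y ^ 2 - |x|) +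
      |x| * ((|(c : ℝ)| - |(d : ℝ)|) ^ 2 - 1) + (1 - |x|) * ((d : ℝ) ^ 2 - 1) + 1 +
      2 * (|(c : ℝ) * d * x| + c * d * x) := by
    rw [abs_mul, abs_mul]
    have := sq_abs (c : ℝ)
    have := sq_abs (d : ℝ)
    linear_combination -|x| * sq_abs (c : ℝ) - |x| * sq_abs (d : ℝ)
  have t1 : 0 ≤ (c : ℝ) ^ 2 * (x ^ 2 + y ^ 2 - |x|) :=
    mul_nonneg (sq_nonneg _) (by linarith)
  have t2 : 0 ≤ |x| * ((|(c : ℝ)| - |(d : ℝ)|) ^ 2 - 1) :=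
    mul_nonneg (abs_nonneg _) (by linarith)
  have t3 : 0 ≤ (1 - |x|) * ((d : ℝ) ^ 2 - 1) :=
    mul_nonneg (by linarith) (by linarith)
  have t4 : 0 ≤ |(c : ℝ) * d * x| + c * d * x := by linarith [neg_abs_le ((c : ℝ) * d * x)]
  refine ⟨by linarith, fun h hc0 => ?_⟩
  have hcR : (c : ℝ) ≠ 0 := by exact_mod_cast hc0
  have u1 : (c : ℝ) ^ 2 * (x ^ 2 + y ^ 2 - |x|) = 0 := by linarith
  have u2 : |x| * ((|(c : ℝ)| - |(d : ℝ)|) ^ 2 - 1) = 0 := by linarith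
  have u3 : (1 - |x|) * ((d : ℝ) ^ 2 - 1) = 0 := by linarith
  have u4 : |(c : ℝ) * d * x| + c * d * x = 0 := by linarith
  have v1 : x ^ 2 + y ^ 2 = |x| := by
    have := (mul_eq_zero.1 u1).resolve_left (by positivity)
    linarith
  have x0 : |x| ≠ 0 := by
    intro h0; rw [h0] at v1; nlinarith [sq_nonneg x]
  have x1 : 1 - |x| ≠ 0 := by
    intro h0
    have : |x| = 1 := by linarith
    rw [← sq_abs, this] at v1; nlinarith
  have d1 : d = 1 := by
    have := (mul_eq_zero.1 u3).resolve_left x1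
    have : d ^ 2 = 1 := by exact_mod_cast (by linarith : (d : ℝ) ^ 2 = 1)
    rcases (sq_eq_sq_iff_eq_or_eq_neg.1 (this.trans (one_pow 2).symm)) with h | h <;> omega
  have c2 : |c| = 2 := by
    have := (mul_eq_zero.1 u2).resolve_left x0
    have : (|c| - |d|) ^ 2 = 1 := by
      exact_mod_cast (by linarith : (|(c : ℝ)| - |(d : ℝ)|) ^ 2 = 1)
    rw [d1] at this
    have := (sq_eq_sq_iff_eq_or_eq_neg.1 (this.trans (one_pow 2).symm))
    have := abs_pos.2 hc0
    simp at *
    omega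
  refine ⟨v1, d1, ?_, c2⟩
  subst d1
  have c2' : |(c : ℝ)| = 2 := by exact_mod_cast c2
  simp only [Int.cast_one, mul_one, abs_mul, c2'] at u4
  linarith

theorem sanovDomain_smul_cases {g : SL(2, ℤ)} (hg : g ∈ sanov) {u : ℍ} (hu : u ∈ sanovDomain)
    (hgu : g • u ∈ sanovDomain) : g • u = u ∨
      ((g • u).re = - u.re ∧ (g • u).im = u.im ∧ (|u.re| = 1 ∨ u.re ^ 2 + u.im ^ 2 = |u.re|)) := by
  obtain ⟨hx, hxy⟩ := hu
  obtain ⟨hx', hxy'⟩ := hgu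
  obtain ⟨ha, hb, hc⟩ := mem_sanov.1 hg
  have hd := sanov_lower_right hg
  have hdet := SL2_det g
  obtain ⟨k1, k2⟩ := one_le_denom_and_eq hx hxy u.im_pos hc hd
  obtain ⟨l1, l2⟩ := one_le_denom_and_eq (c := - g 1 0) (d := g 0 0) hx' hxy' (g • u).im_pos
    (by omega) ha
  have e1 := SL2Z_smul_im_mul g u
  have e2 := SL2Z_smul_im_mul_inv g u
  obtain ⟨s1, s2⟩ := SL2Z_smul_re_im g u
  have p1 := u.im_pos
  have p2 := (g • u).im_pos
  have heq : g • u = u ↔ (g • u).re = u.re ∧ (g • u).im = u.im :=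
    ⟨fun h => by rw [h]; exact ⟨rfl, rfl⟩, fun h => UpperHalfPlane.ext_re_im h.1 h.2⟩
  rw [heq]
  generalize g • u = w at *
  push_cast at l1 l2
  set D1 := ((g 1 0) * u.re + (g 1 1) : ℝ) ^ 2 + (g 1 0 * u.im) ^ 2 with hD1
  set D2 := (-(g 1 0) * w.re + (g 0 0) : ℝ) ^ 2 + (-g 1 0 * w.im) ^ 2 with hD2
  have m1 : w.im ≤ u.im := by nlinarith
  have m2 : u.im ≤ w.im := by
    have : u.im * D2 = w.im := e2
    nlinarith
  have him : w.im = u.im := le_antisymm m1 m2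
  have D1e : D1 = 1 := by
    rw [him] at e1; exact mul_left_cancel₀ p1.ne' (by linarith)
  have D2e : D2 = 1 := by
    have : u.im * D2 = w.im := e2
    rw [him] at this; exact mul_left_cancel₀ p1.ne' (by linarith)
  by_cases hc0 : g 1 0 = 0
  · have ha1 : g 0 0 = 1 ∧ g 1 1 = 1 := by
      rw [hc0] at hdet
      have : g 0 0 * g 1 1 = 1 := by linarith
      rcases Int.mul_eq_one_iff_eq_one_or_neg_one.1 this with h | h <;> omega
    have hre : w.re = u.re + g 0 1 := by
      simpa [hc0, ha1.1, ha1.2] using s1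
    rw [hre] at hx' ⊢
    have b1 : -2 ≤ g 0 1 := by
      have := abs_le.1 hx; have := abs_le.1 hx'
      exact_mod_cast (by linarith : (-2 : ℝ) ≤ g 0 1)
    have b2 : g 0 1 ≤ 2 := by
      have := abs_le.1 hx; have := abs_le.1 hx'
      exact_mod_cast (by linarith : (g 0 1 : ℝ) ≤ 2)
    have : g 0 1 = 0 ∨ g 0 1 = 2 ∨ g 0 1 = -2 := by omega
    rcases this with h | h | h
    · left
      simp [h, him]
    · right
      rw [h] at hx' ⊢; push_cast at hx' ⊢
      have := abs_le.1 hx; have := abs_le.1 hx'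
      have : u.re = -1 := by linarith
      exact ⟨by rw [this]; norm_num, him, Or.inl (by rw [this]; norm_num)⟩
    · right
      rw [h] at hx' ⊢; push_cast at hx' ⊢
      have := abs_le.1 hx; have := abs_le.1 hx'
      have : u.re = 1 := by linarith
      exact ⟨by rw [this]; norm_num, him, Or.inl (by rw [this]; norm_num)⟩
  · obtain ⟨q1, q2, q3, q4⟩ := k2 D1e hc0
    obtain ⟨r1, r2, r3, r4⟩ := l2 D2e (neg_ne_zero.2 hc0)
    right
    refine ⟨?_, him, Or.inr q1⟩
    have hb0 : g 0 1 = 0 := by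
      rw [q2, r2] at hdet
      have : g 0 1 * g 1 0 = 0 := by linarith
      exact (mul_eq_zero.1 this).resolve_right hc0
    rw [q2, r2, him] at s2
    push_cast at s2
    have hcR : (g 1 0 : ℝ) ≠ 0 := by exact_mod_cast hc0
    have : (g 1 0 : ℝ) * u.im * (w.re + u.re) = 0 := by linarith
    have := (mul_eq_zero.1 this).resolve_left (by positivity)
    linarith

theorem exists_sanov_translate (n : ℤ) : ∃ g ∈ sanov, ∀ u : ℍ, (g • u).re = u.re + 2 * n ∧
    (g • u).im = u.im := by
  obtain ⟨g, ha, hb, hc, hd⟩ := exists_SL2_entries (a := 1) (b := 2 * n) (c := 0) (d := 1) (by ring)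
  refine ⟨g, by rw [mem_sanov]; omega, fun u => ?_⟩
  have h := SL2Z_smul_re_im g u
  rw [ha, hb, hc, hd] at h
  simpa using h

theorem exists_sanov_inversion (e : ℤ) : ∃ g ∈ sanov, ∀ u : ℍ,
    (g • u).re * ((2 * e * u.re + 1) ^ 2 + (2 * e * u.im) ^ 2) =
      u.re + 2 * e * (u.re ^ 2 + u.im ^ 2) ∧
    (g • u).im * ((2 * e * u.re + 1) ^ 2 + (2 * e * u.im) ^ 2) = u.im := by
  obtain ⟨g, ha, hb, hc, hd⟩ := exists_SL2_entries (a := 1) (b := 0) (c := 2 * e) (d := 1) (by ring)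
  refine ⟨g, by rw [mem_sanov]; omega, fun u => ?_⟩
  obtain ⟨h1, h2⟩ := SL2Z_smul_re_im g u
  have h3 := SL2Z_smul_im_mul g u
  rw [ha, hb, hc, hd] at h1
  rw [ha, hc, hd] at h2
  rw [hc, hd] at h3
  push_cast at h1 h2 h3
  refine ⟨?_, h3⟩
  linear_combination (2 * e * u.re + 1) * h1 + (2 * e * u.im) * h2

theorem exists_sanov_smul_mem_domain (u : ℍ) : ∃ g ∈ sanov, g • u ∈ sanovDomain := by
  obtain ⟨g, hg, hmax⟩ := sanov_exists_max_im u
  obtain ⟨t, ht, htu⟩ := exists_sanov_translate (- round ((g • u).re / 2))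
  obtain ⟨h1, h2⟩ := htu (g • u)
  have hx : |(t • g • u).re| ≤ 1 := by
    have := abs_sub_round ((g • u).re / 2)
    rw [h1]; push_cast
    rw [abs_le] at this ⊢
    constructor <;> linarith
  refine ⟨t * g, mul_mem ht hg, ?_⟩
  rw [mul_smul]
  refine ⟨hx, ?_⟩
  by_contra! hlt
  obtain ⟨e, he⟩ : ∃ e : ℤ, (e : ℝ) * (t • g • u).re = - |(t • g • u).re| ∧ (e : ℝ) ^ 2 = 1 := by
    rcases abs_cases (t • g • u).re with h | h
    · exact ⟨-1, by rw [h.1]; simp⟩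
    · exact ⟨1, by rw [h.1]; simp⟩
  obtain ⟨s, hs, hsu⟩ := exists_sanov_inversion e
  have h3 := (hsu (t • g • u)).2
  have h4 := hmax (s * (t * g)) (mul_mem hs (mul_mem ht hg))
  rw [mul_smul, mul_smul, ← h2] at h4
  generalize t • g • u = w at *
  have p1 := w.im_pos
  have p2 := (s • w).im_pos
  generalize s • w = w' at *
  have : (2 * e * w.re + 1) ^ 2 + (2 * e * w.im) ^ 2 < 1 := by
    have : (2 * e * w.re + 1) ^ 2 + (2 * e * w.im) ^ 2 =
        4 * (w.re ^ 2 + w.im ^ 2 - |w.re|) + 1 := by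
      linear_combination 4 * he.1 + 4 * (w.re ^ 2 + w.im ^ 2) * he.2
    linarith
  nlinarith

/-- An open neighbourhood of `sanovDomain` covered by five translates of it. -/
def sanovCollar : Set ℍ := {u | |u.re| < 2 ∧
  0 < (1 - |u.re|) * (2 - |u.re|) + u.im ^ 2 ∧
  0 < 1 - 3 * |u.re| + 2 * (u.re ^ 2 + u.im ^ 2) ∧
  0 < 1 - 5 * |u.re| + 6 * (u.re ^ 2 + u.im ^ 2) ∧ |u.re| < 3 * (u.re ^ 2 + u.im ^ 2)}

theorem isOpen_sanovCollar : IsOpen sanovCollar := by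
  have hre := UpperHalfPlane.continuous_re
  have him := UpperHalfPlane.continuous_im
  have h1 : IsOpen {u : ℍ | |u.re| < 2} := isOpen_lt (by fun_prop) (by fun_prop)
  have h2 : IsOpen {u : ℍ | 0 < (1 - |u.re|) * (2 - |u.re|) + u.im ^ 2} :=
    isOpen_lt (by fun_prop) (by fun_prop)
  have h3 : IsOpen {u : ℍ | 0 < 1 - 3 * |u.re| + 2 * (u.re ^ 2 + u.im ^ 2)} :=
    isOpen_lt (by fun_prop) (by fun_prop)
  have h4 : IsOpen {u : ℍ | 0 < 1 - 5 * |u.re| + 6 * (u.re ^ 2 + u.im ^ 2)} :=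
    isOpen_lt (by fun_prop) (by fun_prop)
  have h5 : IsOpen {u : ℍ | |u.re| < 3 * (u.re ^ 2 + u.im ^ 2)} :=
    isOpen_lt (by fun_prop) (by fun_prop)
  exact h1.inter (h2.inter (h3.inter (h4.inter h5)))

theorem isClosed_sanovDomain : IsClosed sanovDomain := by
  have hre := UpperHalfPlane.continuous_re
  have him := UpperHalfPlane.continuous_im
  have h1 : IsClosed {u : ℍ | |u.re| ≤ 1} := isClosed_le (by fun_prop) (by fun_prop)
  have h2 : IsClosed {u : ℍ | |u.re| ≤ u.re ^ 2 + u.im ^ 2} :=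
    isClosed_le (by fun_prop) (by fun_prop)
  exact h1.inter h2

theorem sanovDomain_subset_collar : sanovDomain ⊆ sanovCollar := by
  rintro u ⟨hx, hxy⟩
  have hy := u.im_pos
  have := abs_nonneg u.re
  have hm : 0 < u.re ^ 2 + u.im ^ 2 := by positivity
  refine ⟨by linarith, ?_, ?_, by linarith, by linarith⟩
  · have : 0 ≤ (1 - |u.re|) * (2 - |u.re|) := mul_nonneg (by linarith) (by linarith)
    positivity
  · have := sq_abs u.re
    rcases hx.lt_or_eq with h | h
    · linarith
    · rw [h] at this; nlinarith

theorem exists_finite_sanov_cover : ∃ S : Finset SL(2, ℤ), (∀ g ∈ S, g ∈ sanov) ∧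
    ∀ u ∈ sanovCollar, ∃ g ∈ S, g • u ∈ sanovDomain := by
  obtain ⟨t, ht, htu⟩ := exists_sanov_translate 1
  obtain ⟨t', ht', htu'⟩ := exists_sanov_translate (-1)
  obtain ⟨s, hs, hsu⟩ := exists_sanov_inversion 1
  obtain ⟨s', hs', hsu'⟩ := exists_sanov_inversion (-1)
  refine ⟨{1, t, t', s, s'}, by simp [*, one_mem], ?_⟩
  rintro u ⟨c1, c2, c3, c4, c5⟩
  have hy := u.im_pos
  have hm : 0 < u.re ^ 2 + u.im ^ 2 := by positivity
  by_cases hF : u ∈ sanovDomain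
  · exact ⟨1, by simp, by rwa [one_smul]⟩
  obtain ⟨h1, h2⟩ := htu u
  obtain ⟨h1', h2'⟩ := htu' u
  obtain ⟨h3, h4⟩ := hsu u
  obtain ⟨h3', h4'⟩ := hsu' u
  have key : ∀ w : ℍ, ∀ N : ℝ, 0 < N → N = 1 - 4 * |u.re| + 4 * (u.re ^ 2 + u.im ^ 2) →
      (|w.re| * N = abs (2 * (u.re ^ 2 + u.im ^ 2) - |u.re|)) → w.im * N = u.im →
      (w.re ^ 2 + w.im ^ 2) * N = u.re ^ 2 + u.im ^ 2 →
      (u.re ^ 2 + u.im ^ 2) < |u.re| →  w ∈ sanovDomain := by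
    intro w N hN hNe e1 e2 e4 hlt
    refine ⟨?_, ?_⟩
    · apply le_of_mul_le_mul_right _ hN
      rw [e1, abs_le]
      constructor <;> linarith
    · apply le_of_mul_le_mul_right _ hN
      rw [e1, e4, abs_le]
      constructor <;> linarith
  rcases le_total 0 u.re with hx | hx
  · rw [abs_of_nonneg hx] at *
    by_cases hx1 : u.re ≤ 1
    · refine ⟨s', by simp, ?_⟩
      have hlt : u.re ^ 2 + u.im ^ 2 < u.re := by
        by_contra! h
        exact hF ⟨by rwa [abs_of_nonneg hx], by rwa [abs_of_nonneg hx]⟩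
      have hN : 0 < (2 * (-1 : ℤ) * u.re + 1) ^ 2 + (2 * (-1 : ℤ) * u.im) ^ 2 := by
        push_cast; positivity
      refine key _ _ hN (by push_cast; ring) ?_ h4' ?_ hlt
      · rw [← abs_of_pos hN, ← abs_mul, h3', ← abs_neg]
        push_cast; ring_nf
      · apply mul_right_cancel₀ hN.ne'
        push_cast at *
        generalize s' • u = w at *
        linear_combination (w.re * ((2 * -1 * u.re + 1) ^ 2 + (2 * -1 * u.im) ^ 2) +
            (u.re + 2 * -1 * (u.re ^ 2 + u.im ^ 2))) * h3' +
          (w.im * ((2 * -1 * u.re + 1) ^ 2 + (2 * -1 * u.im) ^ 2) + u.im) * h4'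
    · refine ⟨t', by simp, ?_⟩
      rw [mem_sanovDomain, h1', h2']
      push_cast
      rw [abs_of_neg (by linarith)]
      constructor <;> nlinarith
  · rw [abs_of_nonpos hx] at *
    by_cases hx1 : -1 ≤ u.re
    · refine ⟨s, by simp, ?_⟩
      have hlt : u.re ^ 2 + u.im ^ 2 < - u.re := by
        by_contra! h
        exact hF ⟨by rw [abs_of_nonpos hx]; linarith, by rwa [abs_of_nonpos hx]⟩
      have hN : 0 < (2 * (1 : ℤ) * u.re + 1) ^ 2 + (2 * (1 : ℤ) * u.im) ^ 2 := by
        push_cast; positivity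
      refine key _ _ hN (by push_cast; ring) ?_ h4 ?_ hlt
      · rw [← abs_of_pos hN, ← abs_mul, h3]
        push_cast; ring_nf
      · apply mul_right_cancel₀ hN.ne'
        push_cast at *
        generalize s • u = w at *
        linear_combination (w.re * ((2 * 1 * u.re + 1) ^ 2 + (2 * 1 * u.im) ^ 2) +
            (u.re + 2 * 1 * (u.re ^ 2 + u.im ^ 2))) * h3 +
          (w.im * ((2 * 1 * u.re + 1) ^ 2 + (2 * 1 * u.im) ^ 2) + u.im) * h4
    · refine ⟨t, by simp, ?_⟩
      rw [mem_sanovDomain, h1, h2]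
      push_cast
      rw [abs_of_pos (by linarith)]
      constructor <;> nlinarith

theorem exists_sanov_reflect {u w : ℍ} (hu : |u.re| = 1 ∨ u.re ^ 2 + u.im ^ 2 = |u.re| ∨ u.re = 0)
    (hre : w.re = - u.re) (him : w.im = u.im) : ∃ g ∈ sanov, g • u = w := by
  have ht : ∀ e : ℤ, u.re = e → ∃ g ∈ sanov, g • u = w := by
    intro e he
    obtain ⟨t, ht, htu⟩ := exists_sanov_translate (-e)
    refine ⟨t, ht, UpperHalfPlane.ext_re_im ?_ ?_⟩
    · rw [(htu u).1, hre, he]; push_cast; ring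
    · rw [(htu u).2, him]
  rcases hu with h | h | h
  · rcases eq_or_eq_neg_of_abs_eq h with h | h
    · exact ht 1 (by simp [h])
    · exact ht (-1) (by simp [h])
  · obtain ⟨e, he⟩ : ∃ e : ℤ, (e : ℝ) * |u.re| = - u.re ∧ (e : ℝ) * u.re = - |u.re|
        ∧ (e : ℝ) ^ 2 = 1 := by
      rcases abs_cases u.re with h | h
      · exact ⟨-1, by rw [h.1]; simp⟩
      · exact ⟨1, by rw [h.1]; simp⟩
    obtain ⟨s, hs, hsu⟩ := exists_sanov_inversion e
    obtain ⟨h1, h2⟩ := hsu u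
    have : (2 * e * u.re + 1) ^ 2 + (2 * e * u.im) ^ 2 = 1 := by
      linear_combination 4 * he.2.1 + 4 * (u.re ^ 2 + u.im ^ 2) * he.2.2 + 4 * h
    rw [this] at h1 h2
    refine ⟨s, hs, UpperHalfPlane.ext_re_im ?_ ?_⟩
    · rw [hre]; linear_combination h1 + 2 * e * h + 2 * he.1
    · rw [him]; linarith
  · exact ht 0 (by simp [h])

/-- The plane with the two points `1` and `-1` removed. -/
abbrev TwicePunctured : Type := {z : ℂ // z ≠ 1 ∧ z ≠ -1}

/-- The odd function equal to `√(x - x²)` on `[0, 1]`. -/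
noncomputable def oddArc (x : ℝ) : ℝ := √(x - x ^ 2) - √(-x - x ^ 2)

theorem oddArc_of_nonneg {x : ℝ} (hx : 0 ≤ x) : oddArc x = √(x - x ^ 2) := by
  rw [oddArc, Real.sqrt_eq_zero_of_nonpos (x := -x - x ^ 2) (by nlinarith), sub_zero]

theorem oddArc_neg (x : ℝ) : oddArc (-x) = - oddArc x := by
  simp [oddArc]

theorem oddArc_sq {x : ℝ} (hx : |x| ≤ 1) : oddArc x ^ 2 = |x| - x ^ 2 := by
  have h : ∀ y : ℝ, 0 ≤ y → y ≤ 1 → oddArc y ^ 2 = y - y ^ 2 := fun y h0 h1 => by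
    rw [oddArc_of_nonneg h0, Real.sq_sqrt (by nlinarith)]
  rcases abs_cases x with ⟨h1, h2⟩ | ⟨h1, h2⟩
  · rw [h1, h x h2 (by linarith)]
  · rw [h1, ← neg_neg x, oddArc_neg, neg_sq, h (-x) (by linarith) (by linarith)]; ring

/-- The half-sum of the distances to the two foci of the image point. -/
noncomputable def ellipseA (u : ℍ) : ℝ := 1 + u.im - √(|u.re| - u.re ^ 2)

/-- The restriction of the covering map to the fundamental domain. -/
noncomputable def domainMap (u : ℍ) : ℂ :=
  ⟨ellipseA u * (2 * |u.re| - 1), 2 * √(ellipseA u ^ 2 - 1) * oddArc u.re⟩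

theorem continuous_domainMap : Continuous domainMap := by
  have h1 : Continuous fun u : ℍ => ellipseA u * (2 * |u.re| - 1) := by
    unfold ellipseA; fun_prop
  have h2 : Continuous fun u : ℍ => 2 * √(ellipseA u ^ 2 - 1) * oddArc u.re := by
    unfold ellipseA oddArc; fun_prop
  exact Complex.equivRealProdCLM.symm.continuous.comp (h1.prodMk h2)

theorem one_le_ellipseA {u : ℍ} (hu : u ∈ sanovDomain) : 1 ≤ ellipseA u := by
  have : √(|u.re| - u.re ^ 2) ≤ u.im := by
    rw [Real.sqrt_le_left u.im_pos.le]
    linarith [hu.2]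
  unfold ellipseA; linarith

theorem domainMap_ne {u : ℍ} (hu : u ∈ sanovDomain) : domainMap u ≠ 1 ∧ domainMap u ≠ -1 := by
  have ha := one_le_ellipseA hu
  have hq := oddArc_sq hu.1
  have hx := hu.1
  have key : ellipseA u * |2 * |u.re| - 1| = 1 →
      √(ellipseA u ^ 2 - 1) * oddArc u.re = 0 → False := by
    intro h1 h2
    have hc : |2 * |u.re| - 1| ≤ 1 := by
      rw [abs_le]; constructor <;> linarith [abs_nonneg u.re]
    have ha1 : ellipseA u = 1 := by
      rcases mul_eq_zero.1 h2 with h | h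
      · rw [Real.sqrt_eq_zero (by nlinarith)] at h; nlinarith
      · rw [h] at hq
        have : |u.re| * (1 - |u.re|) = 0 := by
          rw [← sq_abs u.re] at hq; linarith
        rcases mul_eq_zero.1 this with h | h
        · rw [h] at h1; simpa using h1
        · have : |u.re| = 1 := by linarith
          rw [this] at h1; norm_num at h1; simpa using h1
    rw [ha1, one_mul] at h1
    have : |u.re| * (1 - |u.re|) = 0 := by
      have := congrArg (· ^ 2) h1
      simp only [sq_abs] at this
      linarith
    have h0 : |u.re| - u.re ^ 2 = 0 := by rw [← sq_abs u.re]; linarith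
    unfold ellipseA at ha1
    rw [h0] at ha1
    simp at ha1
    exact u.im_ne_zero ha1
  constructor <;> intro h <;>
  · have h1 := congrArg Complex.re h
    have h2 := congrArg Complex.im h
    simp only [domainMap] at h1 h2
    refine key ?_ ?_
    · rw [← abs_of_pos (by linarith : 0 < ellipseA u), ← abs_mul, h1]; simp
    · simp at h2 ⊢; tauto

theorem domainMap_eq_of_smul {g : SL(2, ℤ)} (hg : g ∈ sanov) {u : ℍ} (hu : u ∈ sanovDomain)
    (hgu : g • u ∈ sanovDomain) : domainMap (g • u) = domainMap u := by
  rcases sanovDomain_smul_cases hg hu hgu with h | ⟨h1, h2, h3⟩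
  · rw [h]
  · have hA : ellipseA (g • u) = ellipseA u := by
      unfold ellipseA; rw [h1, h2]; simp
    have h0 : √(ellipseA u ^ 2 - 1) * oddArc u.re = 0 := by
      rcases h3 with h | h
      · have := oddArc_sq hu.1
        rw [← sq_abs u.re, h] at this
        rw [pow_eq_zero_iff two_ne_zero |>.1 (this.trans (by norm_num))]
        simp
      · have : ellipseA u = 1 := by
          unfold ellipseA
          rw [← h, add_sub_cancel_left, Real.sqrt_sq u.im_pos.le]; simp
        rw [this]; simp
    unfold domainMap
    rw [hA, h1, abs_neg, oddArc_neg]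
    congr 1
    linear_combination (-4) * h0

theorem norm_domainMap_add {u : ℍ} (hu : u ∈ sanovDomain) :
    ‖domainMap u + 1‖ = ellipseA u + (2 * |u.re| - 1) ∧
    ‖domainMap u - 1‖ = ellipseA u - (2 * |u.re| - 1) := by
  have ha := one_le_ellipseA hu
  have hx := hu.1
  have h0 := abs_nonneg u.re
  have hs : √(ellipseA u ^ 2 - 1) ^ 2 = ellipseA u ^ 2 - 1 := Real.sq_sqrt (by nlinarith)
  have hq := oddArc_sq hx
  have e : (2 * √(ellipseA u ^ 2 - 1) * oddArc u.re) ^ 2 =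
      (ellipseA u ^ 2 - 1) * (1 - (2 * |u.re| - 1) ^ 2) := by
    have : |u.re| ^ 2 = u.re ^ 2 := sq_abs _
    linear_combination 4 * oddArc u.re ^ 2 * hs + 4 * (ellipseA u ^ 2 - 1) * hq +
      4 * (ellipseA u ^ 2 - 1) * this
  constructor <;>
  · rw [Complex.norm_eq_sqrt_sq_add_sq, Real.sqrt_eq_iff_eq_sq (by positivity) (by linarith)]
    simp [domainMap]
    linear_combination e

theorem exists_sanov_of_domainMap_eq {u w : ℍ} (hu : u ∈ sanovDomain) (hw : w ∈ sanovDomain)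
    (h : domainMap u = domainMap w) : ∃ g ∈ sanov, g • u = w := by
  obtain ⟨a1, a2⟩ := norm_domainMap_add hu
  obtain ⟨b1, b2⟩ := norm_domainMap_add hw
  rw [← h] at b1 b2
  have hA : ellipseA u = ellipseA w := by linarith
  have hx : |u.re| = |w.re| := by linarith
  have hy : w.im = u.im := by
    unfold ellipseA at hA
    rw [← sq_abs u.re, hx, sq_abs] at hA; linarith
  rcases abs_eq_abs.1 hx with h' | h'
  · exact ⟨1, one_mem _, by rw [one_smul]; exact UpperHalfPlane.ext_re_im h' hy.symm⟩
  · have h2 := congrArg Complex.im h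
    simp only [domainMap] at h2
    rw [← hA, h', oddArc_neg] at h2
    have h3 : √(ellipseA u ^ 2 - 1) * oddArc w.re = 0 := by linarith
    refine exists_sanov_reflect ?_ (by rw [h', neg_neg]) hy
    rcases mul_eq_zero.1 h3 with h4 | h4
    · have ha := one_le_ellipseA hu
      rw [Real.sqrt_eq_zero (by nlinarith)] at h4
      have : ellipseA u = 1 := by nlinarith
      unfold ellipseA at this
      have h5 : √(|u.re| - u.re ^ 2) = u.im := by linarith
      rw [Real.sqrt_eq_iff_eq_sq (by rw [← sq_abs]; nlinarith [hu.1, abs_nonneg u.re])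
        u.im_pos.le] at h5
      right; left; linarith
    · have h5 := oddArc_sq hw.1
      rw [h4, ← hx, ← sq_abs w.re, ← hx] at h5
      have : |u.re| * (1 - |u.re|) = 0 := by linarith
      rcases mul_eq_zero.1 this with h6 | h6
      · right; right; exact abs_eq_zero.1 h6
      · left; linarith

/-- An element of the Sanov group moving `u` into the fundamental domain. -/
noncomputable def sanovReducer (u : ℍ) : SL(2, ℤ) := (exists_sanov_smul_mem_domain u).choose

theorem sanovReducer_spec (u : ℍ) : sanovReducer u ∈ sanov ∧ sanovReducer u • u ∈ sanovDomain :=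
  (exists_sanov_smul_mem_domain u).choose_spec

/-- The universal covering map of the twice punctured plane. -/
noncomputable def sanovCover (u : ℍ) : TwicePunctured :=
  ⟨domainMap (sanovReducer u • u), domainMap_ne (sanovReducer_spec u).2⟩

theorem sanovCover_eq {g : SL(2, ℤ)} (hg : g ∈ sanov) {u : ℍ} (hgu : g • u ∈ sanovDomain) :
    (sanovCover u : ℂ) = domainMap (g • u) := by
  obtain ⟨h1, h2⟩ := sanovReducer_spec u
  have h3 : sanovReducer u • u = (sanovReducer u * g⁻¹) • g • u := by
    rw [mul_smul, inv_smul_smul]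
  change domainMap _ = _
  rw [h3] at h2 ⊢
  exact domainMap_eq_of_smul (mul_mem h1 (inv_mem hg)) hgu h2

theorem sanovCover_smul {g : SL(2, ℤ)} (hg : g ∈ sanov) (u : ℍ) :
    sanovCover (g • u) = sanovCover u := by
  obtain ⟨h1, h2⟩ := sanovReducer_spec (g • u)
  apply Subtype.ext
  rw [sanovCover_eq h1 h2, sanovCover_eq (mul_mem h1 hg) (by rwa [mul_smul]), mul_smul]

theorem sanovCover_eq_iff {u w : ℍ} :
    sanovCover u = sanovCover w ↔ ∃ g ∈ sanov, g • u = w := by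
  refine ⟨fun h => ?_, fun ⟨g, hg, h⟩ => by rw [← h, sanovCover_smul hg]⟩
  obtain ⟨h1, h2⟩ := sanovReducer_spec u
  obtain ⟨h3, h4⟩ := sanovReducer_spec w
  obtain ⟨g, hg, h5⟩ := exists_sanov_of_domainMap_eq h2 h4 (congrArg Subtype.val h)
  refine ⟨(sanovReducer w)⁻¹ * g * sanovReducer u, mul_mem (mul_mem (inv_mem h3) hg) h1, ?_⟩
  rw [mul_smul, mul_smul, h5, inv_smul_smul]

instance : ContinuousConstSMul SL(2, ℤ) ℍ :=
  ⟨fun g => continuous_const_smul (SpecialLinearGroup.mapGL ℝ g)⟩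

theorem continuous_sanovCover : Continuous sanovCover := by
  have hF : ∀ u ∈ sanovDomain, ContinuousAt sanovCover u := by
    intro u hu
    obtain ⟨S, hS, hcov⟩ := exists_finite_sanov_cover
    have h1 : ContinuousOn (fun w => (sanovCover w : ℂ))
        (⋃ g : S, {w : ℍ | g.1 • w ∈ sanovDomain}) := by
      refine LocallyFinite.continuousOn_iUnion (locallyFinite_of_finite _)
        (fun g => ?_) (fun g => ?_)
      · exact isClosed_sanovDomain.preimage (continuous_const_smul g.1)
      · refine ContinuousOn.congr (f := fun w => domainMap (g.1 • w)) ?_ ?_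
        · exact (continuous_domainMap.comp (continuous_const_smul g.1)).continuousOn
        · exact fun w hw => sanovCover_eq (hS _ g.2) hw
    refine Topology.IsInducing.subtypeVal.continuousAt_iff.2 ?_
    refine h1.continuousAt (Filter.mem_of_superset
      (isOpen_sanovCollar.mem_nhds (sanovDomain_subset_collar hu)) fun w hw => ?_)
    obtain ⟨g, hg, h⟩ := hcov w hw
    exact Set.mem_iUnion.2 ⟨⟨g, hg⟩, h⟩
  rw [continuous_iff_continuousAt]
  intro u
  obtain ⟨h1, h2⟩ := sanovReducer_spec u
  have h3 : sanovCover = fun w => sanovCover (sanovReducer u • w) := by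
    funext w; rw [sanovCover_smul h1]
  rw [h3]
  exact ContinuousAt.comp (f := fun w => sanovReducer u • w) (hF _ h2)
    (continuous_const_smul _).continuousAt

/-- Half the sum of the distances to the foci `1` and `-1`. -/
noncomputable def focalSum (z : ℂ) : ℝ := (‖z + 1‖ + ‖z - 1‖) / 2

/-- Half the difference of the distances to the foci `1` and `-1`. -/
noncomputable def focalDiff (z : ℂ) : ℝ := (‖z + 1‖ - ‖z - 1‖) / 2

theorem focal_relations (z : ℂ) : focalSum z * focalDiff z = z.re ∧
    (focalSum z ^ 2 - 1) * (1 - focalDiff z ^ 2) = z.im ^ 2 ∧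
    1 ≤ focalSum z ∧ |focalDiff z| ≤ 1 := by
  have h1 : ‖z + 1‖ ^ 2 = (z.re + 1) ^ 2 + z.im ^ 2 := by
    rw [← Complex.normSq_eq_norm_sq, Complex.normSq_apply]; simp; ring
  have h2 : ‖z - 1‖ ^ 2 = (z.re - 1) ^ 2 + z.im ^ 2 := by
    rw [← Complex.normSq_eq_norm_sq, Complex.normSq_apply]; simp; ring
  have h3 : ‖(2 : ℂ)‖ ≤ ‖z + 1‖ + ‖z - 1‖ := by
    have : (2 : ℂ) = (z + 1) - (z - 1) := by ring
    rw [this]; exact norm_sub_le _ _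
  have h4 : |‖z + 1‖ - ‖z - 1‖| ≤ 2 := by
    have := abs_norm_sub_norm_le (z + 1) (z - 1)
    have e : z + 1 - (z - 1) = 2 := by ring
    rw [e] at this; simpa using this
  unfold focalSum focalDiff
  have e1 : (‖z + 1‖ + ‖z - 1‖) / 2 * ((‖z + 1‖ - ‖z - 1‖) / 2) = z.re := by
    linear_combination (h1 - h2) / 4
  refine ⟨e1, ?_, ?_, ?_⟩
  · have e2 : ((‖z + 1‖ + ‖z - 1‖) / 2) ^ 2 + ((‖z + 1‖ - ‖z - 1‖) / 2) ^ 2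
        = z.re ^ 2 + z.im ^ 2 + 1 := by
      linear_combination (h1 + h2) / 2
    have e3 := congrArg (· ^ 2) e1
    linear_combination e2 - e3
  · simp at h3; linarith
  · rw [abs_div]; simp; linarith

theorem focal_im_pos (z : TwicePunctured) :
    0 < focalSum z - 1 + √((1 + focalDiff z) / 2 - ((1 + focalDiff z) / 2) ^ 2) := by
  obtain ⟨h1, h2, h3, h4⟩ := focal_relations z
  rcases h3.lt_or_eq with h | h
  · have := Real.sqrt_nonneg ((1 + focalDiff z) / 2 - ((1 + focalDiff z) / 2) ^ 2)
    linarith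
  · have hc : |focalDiff z| ≠ 1 := by
      intro hc
      rw [← h, one_mul] at h1
      rw [← h] at h2
      have hi : (z : ℂ).im = 0 := by
        have : (z : ℂ).im ^ 2 = 0 := by rw [← h2]; ring
        exact pow_eq_zero_iff two_ne_zero |>.1 this
      rw [h1] at hc
      rcases eq_or_eq_neg_of_abs_eq hc with h5 | h5
      · exact z.2.1 (Complex.ext (by simp [h5]) (by simp [hi]))
      · exact z.2.2 (Complex.ext (by simp [h5]) (by simp [hi]))
    have : 0 < √((1 + focalDiff z) / 2 - ((1 + focalDiff z) / 2) ^ 2) := by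
      apply Real.sqrt_pos.2
      have : |focalDiff z| < 1 := lt_of_le_of_ne h4 hc
      have := sq_lt_one_iff_abs_lt_one (focalDiff z) |>.2 this
      linarith
    linarith

/-- The section of the covering map over the closed upper half (`e = 1`), resp. the closed
lower half (`e = -1`), of the twice punctured plane. -/
noncomputable def coverSection (e : ℝ) (z : TwicePunctured) : ℍ :=
  ⟨⟨e * ((1 + focalDiff z) / 2),
    focalSum z - 1 + √((1 + focalDiff z) / 2 - ((1 + focalDiff z) / 2) ^ 2)⟩, focal_im_pos z⟩

theorem coverSection_re (e : ℝ) (z : TwicePunctured) :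
    (coverSection e z).re = e * ((1 + focalDiff z) / 2) := rfl

theorem coverSection_im (e : ℝ) (z : TwicePunctured) :
    (coverSection e z).im =
      focalSum z - 1 + √((1 + focalDiff z) / 2 - ((1 + focalDiff z) / 2) ^ 2) := rfl

theorem continuous_coverSection (e : ℝ) : Continuous (coverSection e) := by
  rw [UpperHalfPlane.isEmbedding_coe.continuous_iff]
  have h1 : Continuous fun z : TwicePunctured => e * ((1 + focalDiff z) / 2) := by
    unfold focalDiff; fun_prop
  have h2 : Continuous fun z : TwicePunctured =>
      focalSum z - 1 + √((1 + focalDiff z) / 2 - ((1 + focalDiff z) / 2) ^ 2) := by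
    unfold focalDiff focalSum; fun_prop
  exact Complex.equivRealProdCLM.symm.continuous.comp (h1.prodMk h2)

theorem abs_coverSection_re {e : ℝ} (he : |e| = 1) (z : TwicePunctured) :
    |(coverSection e z).re| = (1 + focalDiff z) / 2 := by
  obtain ⟨h1, h2, h3, h4⟩ := focal_relations z
  rw [coverSection_re, abs_mul, he, one_mul, abs_of_nonneg]
  linarith [(abs_le.1 h4).1]

theorem coverSection_mem {e : ℝ} (he : |e| = 1) (z : TwicePunctured) :
    coverSection e z ∈ sanovDomain := by
  obtain ⟨h1, h2, h3, h4⟩ := focal_relations z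
  have h5 := abs_le.1 h4
  rw [mem_sanovDomain, ← sq_abs (coverSection e z).re, abs_coverSection_re he]
  refine ⟨by linarith, ?_⟩
  have hs := Real.sq_sqrt (x := (1 + focalDiff z) / 2 - ((1 + focalDiff z) / 2) ^ 2) (by nlinarith)
  have hs0 := Real.sqrt_nonneg ((1 + focalDiff z) / 2 - ((1 + focalDiff z) / 2) ^ 2)
  rw [coverSection_im]
  nlinarith

theorem ellipseA_coverSection {e : ℝ} (he : |e| = 1) (z : TwicePunctured) :
    ellipseA (coverSection e z) = focalSum z := by
  rw [ellipseA, ← sq_abs (coverSection e z).re, abs_coverSection_re he, coverSection_im]; ring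

theorem sanovCover_coverSection {e : ℝ} (he : |e| = 1) {z : TwicePunctured}
    (hz : e * |(z : ℂ).im| = (z : ℂ).im) : sanovCover (coverSection e z) = z := by
  obtain ⟨h1, h2, h3, h4⟩ := focal_relations z
  have h5 := abs_le.1 h4
  apply Subtype.ext
  rw [sanovCover_eq (one_mem _) (by rw [one_smul]; exact coverSection_mem he z), one_smul,
    domainMap, ellipseA_coverSection he, abs_coverSection_re he]
  have hodd : oddArc (coverSection e z).re = e * √((1 - focalDiff z ^ 2) / 4) := by
    have h6 : (1 - focalDiff z ^ 2) / 4 = (1 + focalDiff z) / 2 - ((1 + focalDiff z) / 2) ^ 2 := by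
      ring
    rw [coverSection_re, h6]
    rcases eq_or_eq_neg_of_abs_eq he with h | h
    · rw [h, one_mul, one_mul, oddArc_of_nonneg (by linarith)]
    · rw [h, neg_one_mul, neg_one_mul, oddArc_neg, oddArc_of_nonneg (by linarith)]
  apply Complex.ext
  · simp only; linarith
  · simp only
    rw [hodd]
    have h7 : √(focalSum z ^ 2 - 1) * (2 * √((1 - focalDiff z ^ 2) / 4)) = |(z : ℂ).im| := by
      rw [Real.sqrt_div' _ (by norm_num : (0:ℝ) ≤ 4), show √(4 : ℝ) = 2 by
        rw [show (4 : ℝ) = 2 ^ 2 by norm_num, Real.sqrt_sq (by norm_num)]]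
      rw [mul_div_cancel₀ _ two_ne_zero, ← Real.sqrt_mul (by nlinarith), h2, Real.sqrt_sq_eq_abs]
    rw [← hz]
    linear_combination e * h7

theorem exists_local_section (z₀ : TwicePunctured) : ∃ σ : TwicePunctured → ℍ,
    ContinuousAt σ z₀ ∧ ∀ᶠ z in 𝓝 z₀, sanovCover (σ z) = z := by
  have hp : ∀ z : TwicePunctured, 0 ≤ (z : ℂ).im → sanovCover (coverSection 1 z) = z := fun z hz =>
    sanovCover_coverSection (by simp) (by rw [abs_of_nonneg hz, one_mul])
  have hn : ∀ z : TwicePunctured, (z : ℂ).im ≤ 0 → sanovCover (coverSection (-1) z) = z :=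
    fun z hz => sanovCover_coverSection (by simp) (by rw [abs_of_nonpos hz]; ring)
  have him : Continuous fun z : TwicePunctured => (z : ℂ).im := by fun_prop
  rcases lt_trichotomy 0 (z₀ : ℂ).im with h | h | h
  · exact ⟨_, (continuous_coverSection 1).continuousAt,
      (him.continuousAt.eventually (lt_mem_nhds h)).mono fun z hz => hp z hz.le⟩
  · have hr : ∃ g ∈ sanov, g • coverSection (-1) z₀ = coverSection 1 z₀ := by
      refine exists_sanov_reflect ?_ (by rw [coverSection_re, coverSection_re]; ring)
        (by rw [coverSection_im, coverSection_im])
      obtain ⟨h1, h2, h3, h4⟩ := focal_relations z₀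
      have ha : |(coverSection (-1) z₀).re| = (1 + focalDiff z₀) / 2 :=
        abs_coverSection_re (by simp) z₀
      rw [← h, zero_pow two_ne_zero] at h2
      rcases mul_eq_zero.1 h2 with h5 | h5
      · have h6 : focalSum z₀ = 1 := by nlinarith
        right; left
        have h5 := abs_le.1 h4
        rw [← sq_abs (coverSection (-1) z₀).re, ha, coverSection_im, h6, sub_self, zero_add,
          Real.sq_sqrt (by nlinarith)]
        ring
      · have : (1 - focalDiff z₀) * (1 + focalDiff z₀) = 0 := by linarith
        rcases mul_eq_zero.1 this with h6 | h6
        · left; rw [ha]; linarith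
        · right; right; rw [coverSection_re, h6]; simp
    obtain ⟨g, hg, hgz⟩ := hr
    classical
    refine ⟨fun z => if 0 ≤ (z : ℂ).im then coverSection 1 z else g • coverSection (-1) z, ?_, ?_⟩
    · have h1 : Filter.Tendsto (coverSection 1) (𝓝 z₀) (𝓝 (coverSection 1 z₀)) :=
        (continuous_coverSection 1).continuousAt
      have h2 : Filter.Tendsto (fun z => g • coverSection (-1) z) (𝓝 z₀)
          (𝓝 (coverSection 1 z₀)) := by
        rw [← hgz]
        exact ((continuous_coverSection (-1)).const_smul g).continuousAt
      have h3 : (if 0 ≤ (z₀ : ℂ).im then coverSection 1 z₀ else g • coverSection (-1) z₀) =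
          coverSection 1 z₀ := if_pos h.le
      rw [← h3] at h1 h2
      exact Filter.Tendsto.if' h1 h2
    · refine Filter.Eventually.of_forall fun z => ?_
      by_cases hz : 0 ≤ (z : ℂ).im
      · simp only [if_pos hz]; exact hp z hz
      · simp only [if_neg hz]; rw [sanovCover_smul hg]; exact hn z (not_le.1 hz).le
  · exact ⟨_, (continuous_coverSection (-1)).continuousAt,
      (him.continuousAt.eventually (gt_mem_nhds h)).mono fun z hz => hn z hz.le⟩

theorem isQuotientMap_sanovCover : Topology.IsQuotientMap sanovCover := by
  rw [Topology.isQuotientMap_iff]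
  refine ⟨.of_isOpen_preimage_iff_isOpen fun s =>
    ⟨fun h => ?_, fun h => IsOpen.preimage continuous_sanovCover h⟩, fun z => ?_⟩
  rotate_left
  · obtain ⟨σ, -, h⟩ := exists_local_section z
    exact ⟨_, h.self_of_nhds⟩
  · rw [isOpen_iff_mem_nhds]
    intro z hz
    obtain ⟨σ, hc, hσ⟩ := exists_local_section z
    have h1 : σ ⁻¹' (sanovCover ⁻¹' s) ∈ 𝓝 z :=
      hc.preimage_mem_nhds (h.mem_nhds (by rw [Set.mem_preimage, hσ.self_of_nhds]; exact hz))
    filter_upwards [h1, hσ] with w hw1 hw2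
    rw [Set.mem_preimage, Set.mem_preimage, hw2] at hw1
    exact hw1

theorem isCoveringMap_sanovCover : IsCoveringMap sanovCover := by
  have : ContinuousConstSMul sanov ℍ := ⟨fun g => continuous_const_smul g.1⟩
  refine (isQuotientMap_sanovCover.isQuotientCoveringMap_of_properlyDiscontinuousSMul
    (G := sanov) ?_).isCoveringMap
  intro u w
  rw [sanovCover_eq_iff, MulAction.mem_orbit_symm]
  exact ⟨fun ⟨g, hg, h⟩ => ⟨⟨g, hg⟩, h⟩, fun ⟨g, h⟩ => ⟨g.1, g.2, h⟩⟩

theorem exists_im_gt_of_norm {u : ℍ} : ∃ g ∈ sanov, ‖(sanovCover u : ℂ)‖ - 1 ≤ (g • u).im := by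
  obtain ⟨h1, h2⟩ := sanovReducer_spec u
  refine ⟨_, h1, ?_⟩
  rw [sanovCover_eq h1 h2]
  obtain ⟨h3, h4⟩ := norm_domainMap_add h2
  have h5 : ‖domainMap (sanovReducer u • u)‖ ≤ ellipseA (sanovReducer u • u) := by
    have : ‖(2 : ℂ) * domainMap (sanovReducer u • u)‖ ≤ 2 * ellipseA (sanovReducer u • u) := by
      rw [show (2 : ℂ) * domainMap (sanovReducer u • u) = (domainMap (sanovReducer u • u) + 1) +
        (domainMap (sanovReducer u • u) - 1) by ring]
      refine (norm_add_le _ _).trans ?_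
      linarith
    rw [norm_mul] at this
    simpa using this
  unfold ellipseA at h5
  linarith [Real.sqrt_nonneg (|(sanovReducer u • u).re| - (sanovReducer u • u).re ^ 2)]

theorem im_le_norm_sanovCover {u : ℍ} (hu : 1 ≤ u.im) : u.im - 1 ≤ ‖(sanovCover u : ℂ)‖ := by
  obtain ⟨t, ht, htu⟩ := exists_sanov_translate (- round (u.re / 2))
  obtain ⟨h1, h2⟩ := htu u
  have hx : |(t • u).re| ≤ 1 := by
    have := abs_sub_round (u.re / 2)
    rw [h1]; push_cast
    rw [abs_le] at this ⊢
    constructor <;> linarith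
  rw [← sanovCover_smul ht, ← h2]
  rw [← h2] at hu
  have hm : t • u ∈ sanovDomain := ⟨hx, by nlinarith [sq_nonneg (t • u).re]⟩
  rw [sanovCover_eq (one_mem _) (by rwa [one_smul]), one_smul]
  obtain ⟨h3, h4⟩ := norm_domainMap_add hm
  have h5 : ellipseA (t • u) - 1 ≤ ‖domainMap (t • u)‖ := by
    have h6 := norm_add_le (domainMap (t • u)) 1
    have h7 := norm_sub_le (domainMap (t • u)) 1
    rw [norm_one] at h6 h7
    linarith
  have : √(|(t • u).re| - (t • u).re ^ 2) ≤ 1 := by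
    refine Real.sqrt_le_one.2 ?_
    nlinarith [sq_nonneg (t • u).re]
  unfold ellipseA at h5
  linarith

theorem exists_continuous_log {X : Type*} [TopologicalSpace X] [SimplyConnectedSpace X]
    [LocallyPathConnectedSpace X] {D : X → ℂ} (hD : Continuous D) (h0 : ∀ x, D x ≠ 0) :
    ∃ L : X → ℂ, Continuous L ∧ ∀ x, Complex.exp (L x) = D x := by
  obtain ⟨x₀⟩ := (inferInstance : Nonempty X)
  obtain ⟨F, ⟨-, hF⟩, -⟩ := Complex.isCoveringMap_exp.existsUnique_continuousMap_lifts
    ⟨fun x => ⟨D x, h0 x⟩, by fun_prop⟩ x₀ (Complex.log (D x₀))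
    (Subtype.ext (Complex.exp_log (h0 x₀)))
  exact ⟨F, F.continuous, fun x => congrArg Subtype.val (congrFun hF x)⟩

/-- A nowhere vanishing complex function cannot be real of opposite signs at two points which are
joined both by a connected set where its imaginary part is nonnegative and by one where it is
nonpositive. -/
theorem false_of_im_nonneg_of_im_nonpos {X : Type*} [TopologicalSpace X] [SimplyConnectedSpace X]
    [LocallyPathConnectedSpace X] {D : X → ℂ} (hD : Continuous D) (h0 : ∀ x, D x ≠ 0)
    {S T : Set X} (hS : IsPreconnected S) (hT : IsPreconnected T)
    (hDS : ∀ x ∈ S, 0 ≤ (D x).im) (hDT : ∀ x ∈ T, (D x).im ≤ 0)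
    {x y : X} (hxS : x ∈ S) (hxT : x ∈ T) (hyS : y ∈ S) (hyT : y ∈ T)
    (hx : 0 < (D x).re) (hy : (D y).re < 0) : False := by
  obtain ⟨L, hL, hLD⟩ := exists_continuous_log hD h0
  have hθ : Continuous fun x => (L x).im := by fun_prop
  have him : ∀ x, (D x).im = Real.exp (L x).re * Real.sin (L x).im := fun x => by
    rw [← hLD, Complex.exp_im]
  have hre : ∀ x, (D x).re = Real.exp (L x).re * Real.cos (L x).im := fun x => by
    rw [← hLD, Complex.exp_re]
  have hsx : Real.sin (L x).im = 0 := by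
    have := him x
    rw [le_antisymm (hDT x hxT) (hDS x hxS)] at this
    simpa [(Real.exp_pos _).ne'] using this.symm
  have hsy : Real.sin (L y).im = 0 := by
    have := him y
    rw [le_antisymm (hDT y hyT) (hDS y hyS)] at this
    simpa [(Real.exp_pos _).ne'] using this.symm
  rw [hre] at hx hy
  have hcx : 0 < Real.cos (L x).im := (mul_pos_iff_of_pos_left (Real.exp_pos _)).1 hx
  have hcy : Real.cos (L y).im < 0 := (mul_neg_iff.1 hy).elim (fun h => h.2)
    fun h => absurd h.1 (not_lt.2 (Real.exp_pos _).le)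
  have key : ∀ z ∈ Set.uIcc (L x).im (L y).im, Real.sin z = 0 := by
    intro z hz
    refine le_antisymm ?_ ?_
    · obtain ⟨w, hw, rfl⟩ := (hT.image _ hθ.continuousOn).ordConnected.uIcc_subset
        (Set.mem_image_of_mem _ hxT) (Set.mem_image_of_mem _ hyT) hz
      have := hDT w hw
      rw [him] at this
      exact nonpos_of_mul_nonpos_right this (Real.exp_pos _)
    · obtain ⟨w, hw, rfl⟩ := (hS.image _ hθ.continuousOn).ordConnected.uIcc_subset
        (Set.mem_image_of_mem _ hxS) (Set.mem_image_of_mem _ hyS) hz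
      have := hDS w hw
      rw [him] at this
      exact nonneg_of_mul_nonneg_right this (Real.exp_pos _)
  obtain ⟨z, hz, hcz⟩ : (0 : ℝ) ∈ Real.cos '' Set.uIcc (L x).im (L y).im :=
    intermediate_value_uIcc Real.continuous_cos.continuousOn
      (Set.mem_uIcc.2 (Or.inr ⟨hcy.le, hcx.le⟩))
  have := Real.sin_sq_add_cos_sq z
  rw [key z hz, hcz] at this
  norm_num at this

/-- Two paths `A : [a, b] → ℂ` and `B : [c, d] → ℂ` in the closed upper half plane meet if `A`
starts above `B` and ends at a real point between the two real endpoints of `B`. -/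
theorem exists_eq_of_endpoints_linked {A B : ℝ → ℂ} (hA : Continuous A) (hB : Continuous B)
    {a b c d : ℝ} (hab : a ≤ b) (hcd : c ≤ d)
    (hA0 : ∀ s ∈ Set.Icc a b, 0 ≤ (A s).im) (hB0 : ∀ t ∈ Set.Icc c d, 0 ≤ (B t).im)
    (hAB : ∀ t ∈ Set.Icc c d, (B t).im ≤ (A a).im)
    (hb : (A b).im = 0) (hc : (B c).im = 0) (hd : (B d).im = 0)
    (hlink : ((A b).re - (B c).re) * ((A b).re - (B d).re) < 0) :
    ∃ s ∈ Set.Icc a b, ∃ t ∈ Set.Icc c d, A s = B t := by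
  by_contra! hne
  let p : ℝ → ℝ := fun s => max a (min b s)
  let q : ℝ → ℝ := fun t => max c (min d t)
  have hp : ∀ s, p s ∈ Set.Icc a b := fun s => ⟨le_max_left _ _, max_le hab (min_le_left _ _)⟩
  have hq : ∀ s, q s ∈ Set.Icc c d := fun s => ⟨le_max_left _ _, max_le hcd (min_le_left _ _)⟩
  have hpid : ∀ s ∈ Set.Icc a b, p s = s := fun s hs => by
    simp only [p]; rw [min_eq_right hs.2, max_eq_right hs.1]
  have hqid : ∀ s ∈ Set.Icc c d, q s = s := fun s hs => by
    simp only [q]; rw [min_eq_right hs.2, max_eq_right hs.1]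
  have hpc : Continuous p := by fun_prop
  have hqc : Continuous q := by fun_prop
  let D : ℝ × ℝ → ℂ := fun x => A (p x.1) - B (q x.2)
  have hD : Continuous D := by fun_prop
  have hD0 : ∀ x, D x ≠ 0 := fun x => sub_ne_zero.2 (hne _ (hp _) _ (hq _))
  have hDval : ∀ s ∈ Set.Icc a b, ∀ t ∈ Set.Icc c d, D (s, t) = A s - B t := fun s hs t ht => by
    simp only [D]; rw [hpid s hs, hqid t ht]
  have ha' := Set.left_mem_Icc.2 hab
  have hb' := Set.right_mem_Icc.2 hab
  have hc' := Set.left_mem_Icc.2 hcd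
  have hd' := Set.right_mem_Icc.2 hcd
  have hs1 : IsPreconnected ((Set.Icc a b) ×ˢ ({c} : Set ℝ)) :=
    isPreconnected_Icc.prod isPreconnected_singleton
  have hs2 : IsPreconnected (({a} : Set ℝ) ×ˢ (Set.Icc c d)) :=
    isPreconnected_singleton.prod isPreconnected_Icc
  have hs3 : IsPreconnected ((Set.Icc a b) ×ˢ ({d} : Set ℝ)) :=
    isPreconnected_Icc.prod isPreconnected_singleton
  have hT : IsPreconnected (({b} : Set ℝ) ×ˢ (Set.Icc c d)) :=
    isPreconnected_singleton.prod isPreconnected_Icc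
  have hS := (hs1.union (a, c) (by simp [hab]) (by simp [hcd]) hs2).union (a, d)
    (by simp [hcd]) (by simp [hab]) hs3
  have hDS : ∀ x ∈ ((Set.Icc a b) ×ˢ ({c} : Set ℝ) ∪ ({a} : Set ℝ) ×ˢ (Set.Icc c d)) ∪
      (Set.Icc a b) ×ˢ ({d} : Set ℝ), 0 ≤ (D x).im := by
    rintro ⟨s, t⟩ ((⟨h1, h2⟩ | ⟨h1, h2⟩) | ⟨h1, h2⟩)
    · obtain rfl : t = c := h2
      rw [hDval s h1 t hc', Complex.sub_im, hc, sub_zero]; exact hA0 s h1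
    · obtain rfl : s = a := h1
      rw [hDval s ha' t h2, Complex.sub_im]; exact sub_nonneg.2 (hAB t h2)
    · obtain rfl : t = d := h2
      rw [hDval s h1 t hd', Complex.sub_im, hd, sub_zero]; exact hA0 s h1
  have hDT : ∀ x ∈ ({b} : Set ℝ) ×ˢ (Set.Icc c d), (D x).im ≤ 0 := by
    rintro ⟨s, t⟩ ⟨h1, h2⟩
    obtain rfl : s = b := h1
    rw [hDval s hb' t h2, Complex.sub_im, hb]; linarith [hB0 t h2]
  have e1 : (D (b, c)).re = (A b).re - (B c).re := by rw [hDval b hb' c hc', Complex.sub_re]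
  have e2 : (D (b, d)).re = (A b).re - (B d).re := by rw [hDval b hb' d hd', Complex.sub_re]
  rw [← e1, ← e2] at hlink
  rcases mul_neg_iff.1 hlink with ⟨h1, h2⟩ | ⟨h1, h2⟩
  · exact false_of_im_nonneg_of_im_nonpos hD hD0 hS hT hDS hDT (x := (b, c)) (y := (b, d))
      (Or.inl (Or.inl ⟨hb', rfl⟩)) ⟨rfl, hc'⟩ (Or.inr ⟨hb', rfl⟩) ⟨rfl, hd'⟩ h1 h2
  · exact false_of_im_nonneg_of_im_nonpos hD hD0 hS hT hDS hDT (x := (b, d)) (y := (b, c))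
      (Or.inr ⟨hb', rfl⟩) ⟨rfl, hd'⟩ (Or.inl (Or.inl ⟨hb', rfl⟩)) ⟨rfl, hc'⟩ h2 h1

/-- The determinant of a pair of integer vectors. -/
def cross (v w : ℤ × ℤ) : ℤ := v.1 * w.2 - v.2 * w.1

/-- The pairs of cusps `v, w` and `v', w'` separate each other on the boundary circle. -/
def Linked (v w v' w' : ℤ × ℤ) : Prop :=
  cross v v' * cross w v' * (cross v w' * cross w w') < 0

/-- The horoball of height `R` at the cusp `v.1 / v.2`. -/
def horoball (R : ℝ) (v : ℤ × ℤ) : Set ℂ :=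
  {z | R * ((v.1 - v.2 * z.re) ^ 2 + (v.2 * z.im) ^ 2) < z.im}

theorem mem_horoball {R : ℝ} {v : ℤ × ℤ} {z : ℂ} :
    z ∈ horoball R v ↔ R * ((v.1 - v.2 * z.re) ^ 2 + (v.2 * z.im) ^ 2) < z.im := Iff.rfl

theorem horoball_anti {R R' : ℝ} (h : R ≤ R') (v : ℤ × ℤ) : horoball R' v ⊆ horoball R v :=
  fun z hz => (mul_le_mul_of_nonneg_right h (by positivity)).trans_lt hz

theorem horoball_im_pos {R : ℝ} (hR : 0 ≤ R) {v : ℤ × ℤ} {z : ℂ} (hz : z ∈ horoball R v) :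
    0 < z.im :=
  lt_of_le_of_lt (by positivity) (mem_horoball.1 hz)

theorem horoball_disjoint {R : ℝ} (hR : 1 ≤ R) {v w : ℤ × ℤ} (h : cross v w ≠ 0) {z : ℂ}
    (hv : z ∈ horoball R v) : z ∉ horoball R w := by
  intro hw
  have hy := horoball_im_pos (by linarith) hv
  have hv := mem_horoball.1 (horoball_anti hR _ hv)
  have hw := mem_horoball.1 (horoball_anti hR _ hw)
  rw [one_mul] at hv hw
  have hc : (1 : ℝ) ≤ (cross v w : ℝ) ^ 2 := by
    have : 1 ≤ (cross v w) ^ 2 := Int.add_one_le_iff.2 (sq_pos_of_ne_zero h)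
    exact_mod_cast this
  have hc' : (cross v w : ℝ) * z.im =
      (v.1 - v.2 * z.re) * (w.2 * z.im) - (w.1 - w.2 * z.re) * (v.2 * z.im) := by
    unfold cross; push_cast; ring
  generalize (v.1 - v.2 * z.re : ℝ) = X at *
  generalize (v.2 * z.im : ℝ) = Y at *
  generalize (w.1 - w.2 * z.re : ℝ) = X' at *
  generalize (w.2 * z.im : ℝ) = Y' at *
  generalize (cross v w : ℝ) = c at *
  have h1 : (X ^ 2 + Y ^ 2) * (X' ^ 2 + Y' ^ 2) < z.im * z.im :=
    mul_lt_mul'' hv hw (by positivity) (by positivity)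
  have h2 : z.im * z.im ≤ (c * z.im) ^ 2 := by nlinarith [mul_pos hy hy]
  rw [hc'] at h2
  nlinarith [sq_nonneg (X * X' + Y * Y')]

theorem horoball_convex {R : ℝ} (hR : 0 ≤ R) (v : ℤ × ℤ) : Convex ℝ (horoball R v) := by
  intro z hz w hw a b ha hb hab
  rw [mem_horoball] at hz hw ⊢
  simp only [Complex.add_re, Complex.real_smul, Complex.re_ofReal_mul, Complex.add_im,
    Complex.im_ofReal_mul]
  obtain rfl : b = 1 - a := by linarith
  have h1 : a * (R * ((v.1 - v.2 * z.re) ^ 2 + (v.2 * z.im) ^ 2)) +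
      (1 - a) * (R * ((v.1 - v.2 * w.re) ^ 2 + (v.2 * w.im) ^ 2)) < a * z.im + (1 - a) * w.im := by
    rcases ha.eq_or_lt with rfl | ha
    · simpa using hw
    · nlinarith
  refine lt_of_le_of_lt ?_ h1
  have h2 : 0 ≤ R * (a * (1 - a)) *
      ((v.2 * z.re - v.2 * w.re) ^ 2 + (v.2 * z.im - v.2 * w.im) ^ 2) := by positivity
  linarith

theorem horoball_segment {R : ℝ} (hR : 0 ≤ R) {v : ℤ × ℤ} (hv : v.2 ≠ 0) {z : ℂ}
    (hz : z ∈ horoball R v) {l : ℝ} (h0 : 0 ≤ l) (h1 : l < 1) :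
    z + l * ((v.1 / v.2 : ℝ) - z) ∈ horoball R v := by
  have hz := mem_horoball.1 hz
  have hv' : (v.2 : ℝ) ≠ 0 := by exact_mod_cast hv
  rw [mem_horoball]
  simp only [Complex.add_re, Complex.re_ofReal_mul, Complex.add_im, Complex.im_ofReal_mul,
    Complex.sub_re, Complex.sub_im, Complex.ofReal_re, Complex.ofReal_im]
  have e : (v.1 - v.2 * (z.re + l * (v.1 / v.2 - z.re)) : ℝ) = (1 - l) * (v.1 - v.2 * z.re) := by
    field_simp; ring
  rw [e]
  have h2 : 0 ≤ R * ((v.1 - v.2 * z.re) ^ 2 + (v.2 * z.im) ^ 2) := by positivity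
  have : (1 - l) * ((1 - l) * (R * ((v.1 - v.2 * z.re) ^ 2 + (v.2 * z.im) ^ 2))) <
      (1 - l) * z.im := by
    apply mul_lt_mul_of_pos_left _ (by linarith)
    nlinarith
  linarith

/-- A path in the upper half plane running from the cusp `v` to the cusp `w`. -/
structure CuspPath (φ : ℝ → ℍ) (v w : ℤ × ℤ) : Prop where
  continuousOn : ContinuousOn φ (Set.Ioo 0 1)
  start : ∀ R : ℝ, ∀ᶠ t in 𝓝[>] 0, (φ t : ℂ) ∈ horoball R v
  finish : ∀ R : ℝ, ∀ᶠ t in 𝓝[<] 1, (φ t : ℂ) ∈ horoball R w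

namespace CuspPath

variable {φ ψ : ℝ → ℍ} {v w v' w' : ℤ × ℤ}

theorem exists_near_zero (h : CuspPath φ v w) (R : ℝ) : ∃ t ∈ Set.Ioo (0 : ℝ) 2⁻¹,
    ∀ s ∈ Set.Ioc 0 t, (φ s : ℂ) ∈ horoball R v := by
  have h1 := (h.start R).and (Ioo_mem_nhdsGT (show (0 : ℝ) < 2⁻¹ by norm_num))
  obtain ⟨u, hu, h2⟩ := mem_nhdsGT_iff_exists_Ioc_subset.1 h1
  exact ⟨u, (h2 ⟨hu, le_rfl⟩).2, fun s hs => (h2 hs).1⟩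

theorem exists_near_one (h : CuspPath φ v w) (R : ℝ) : ∃ t ∈ Set.Ioo (2⁻¹ : ℝ) 1,
    ∀ s ∈ Set.Ico t 1, (φ s : ℂ) ∈ horoball R w := by
  have h1 := (h.finish R).and (Ioo_mem_nhdsLT (show (2⁻¹ : ℝ) < 1 by norm_num))
  obtain ⟨u, hu, h2⟩ := mem_nhdsLT_iff_exists_Ico_subset.1 h1
  exact ⟨u, (h2 ⟨le_rfl, hu⟩).2, fun s hs => (h2 hs).1⟩

theorem exists_notMem_horoball (h : CuspPath φ v w) {c : ℤ × ℤ} (hv : cross c v ≠ 0)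
    (hw : cross c w ≠ 0) : ∃ R₀, 1 ≤ R₀ ∧ ∀ R, R₀ ≤ R → ∀ t ∈ Set.Ioo (0 : ℝ) 1,
      (φ t : ℂ) ∉ horoball R c := by
  obtain ⟨t₀, ht₀, h₀⟩ := h.exists_near_zero 1
  obtain ⟨t₁, ht₁, h₁⟩ := h.exists_near_one 1
  let N : ℝ → ℝ := fun t => (c.1 - c.2 * (φ t).re) ^ 2 + (c.2 * (φ t).im) ^ 2
  have hN : ∀ t, 0 < N t := by
    intro t
    by_cases hc : c.2 = 0
    · have : (c.1 : ℝ) ≠ 0 := by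
        intro h0
        have : c.1 = 0 := by exact_mod_cast h0
        exact hv (by simp [cross, hc, this])
      simp only [N, hc]
      simp; positivity
    · have : (c.2 : ℝ) ≠ 0 := by exact_mod_cast hc
      have := (φ t).im_pos
      simp only [N]
      positivity
  have hsub : Set.Icc t₀ t₁ ⊆ Set.Ioo 0 1 := fun t ht =>
    ⟨ht₀.1.trans_le ht.1, ht.2.trans_lt ht₁.2⟩
  have hc : ContinuousOn (fun t => (φ t).im / N t) (Set.Icc t₀ t₁) := by
    have h1 : ContinuousOn (fun t => (φ t).im) (Set.Icc t₀ t₁) :=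
      UpperHalfPlane.continuous_im.comp_continuousOn (h.continuousOn.mono hsub)
    have h2 : ContinuousOn (fun t => (φ t).re) (Set.Icc t₀ t₁) :=
      UpperHalfPlane.continuous_re.comp_continuousOn (h.continuousOn.mono hsub)
    refine h1.div ?_ fun t _ => (hN t).ne'
    simp only [N]
    fun_prop
  obtain ⟨M, hM⟩ := (isCompact_Icc.image_of_continuousOn hc).bddAbove
  refine ⟨max 1 M, le_max_left _ _, fun R hR t ht hmem => ?_⟩
  have hR1 : 1 ≤ R := (le_max_left _ _).trans hR
  have hmem1 := horoball_anti hR1 _ hmem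
  rcases le_total t t₀ with h2 | h2
  · exact horoball_disjoint le_rfl hv hmem1 (h₀ t ⟨ht.1, h2⟩)
  rcases le_total t₁ t with h3 | h3
  · exact horoball_disjoint le_rfl hw hmem1 (h₁ t ⟨h3, ht.2⟩)
  have h4 : (φ t).im / N t ≤ R := (hM ⟨t, ⟨h2, h3⟩, rfl⟩).trans ((le_max_right _ _).trans hR)
  rw [div_le_iff₀ (hN t)] at h4
  exact absurd (mem_horoball.1 hmem) (not_lt.2 h4)

/-- A path between cusps can be cut off inside the horoballs of height `R` and prolonged by
straight segments to the cusps. -/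
theorem exists_extension (h : CuspPath φ v w) {R : ℝ} (hR : 0 ≤ R) (hw : w.2 ≠ 0) :
    ∃ (B : ℝ → ℂ) (t₀ t₁ : ℝ), t₀ ≤ t₁ ∧ Continuous B ∧ B t₀ ∈ horoball R v ∧
      B (t₀ - 1) = (v.1 / v.2 : ℝ) ∧ B (t₁ + 1) = (w.1 / w.2 : ℝ) ∧
      (∀ t ∈ Set.Ico t₀ (t₁ + 1), B t ∈ horoball R w ∨ ∃ s ∈ Set.Ioo (0 : ℝ) 1, B t = φ s) ∧
      (v.2 ≠ 0 → ∀ t ∈ Set.Ioo (t₀ - 1) t₀, B t ∈ horoball R v) := by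
  obtain ⟨t₀, ht₀, h₀⟩ := h.exists_near_zero R
  obtain ⟨t₁, ht₁, h₁⟩ := h.exists_near_one R
  have hle : t₀ ≤ t₁ := (ht₀.2.trans ht₁.1).le
  have hr : ∀ t, max t₀ (min t₁ t) ∈ Set.Ioo (0 : ℝ) 1 := fun t =>
    ⟨ht₀.1.trans_le (le_max_left _ _),
      max_lt (hle.trans_lt ht₁.2) ((min_le_left _ _).trans_lt ht₁.2)⟩
  have hc : Continuous fun t => (φ (max t₀ (min t₁ t)) : ℂ) :=
    UpperHalfPlane.continuous_coe.comp (h.continuousOn.comp_continuous (by fun_prop) hr)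
  let B : ℝ → ℂ := fun t => φ (max t₀ (min t₁ t)) +
    (max 0 (t - t₁) : ℝ) * ((w.1 / w.2 : ℝ) - (φ t₁ : ℂ)) +
    (max 0 (t₀ - t) : ℝ) * ((v.1 / v.2 : ℝ) - (φ t₀ : ℂ))
  have hlow : ∀ t ≤ t₀, B t = φ t₀ + (t₀ - t : ℝ) * ((v.1 / v.2 : ℝ) - (φ t₀ : ℂ)) := by
    intro t ht
    simp only [B]
    rw [min_eq_right (ht.trans hle), max_eq_left ht, max_eq_left (by linarith),
      max_eq_right (by linarith)]
    simp
  have hhigh : ∀ t, t₁ ≤ t → B t = φ t₁ + (t - t₁ : ℝ) * ((w.1 / w.2 : ℝ) - (φ t₁ : ℂ)) := by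
    intro t ht
    simp only [B]
    rw [min_eq_left ht, max_eq_right hle, max_eq_right (by linarith), max_eq_left (by linarith)]
    simp
  have hmid : ∀ t ∈ Set.Icc t₀ t₁, B t = φ t := by
    intro t ht
    simp only [B]
    rw [min_eq_right ht.2, max_eq_right ht.1, max_eq_left (by linarith [ht.2]),
      max_eq_left (by linarith [ht.1])]
    simp
  refine ⟨B, t₀, t₁, hle, by fun_prop, ?_, ?_, ?_, fun t ht => ?_, fun hv t ht => ?_⟩
  · rw [hmid t₀ ⟨le_rfl, hle⟩]; exact h₀ t₀ ⟨ht₀.1, le_rfl⟩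
  · rw [hlow _ (by linarith)]; simp
  · rw [hhigh _ (by linarith)]; simp
  · rcases le_total t t₁ with h2 | h2
    · exact Or.inr ⟨t, ⟨ht₀.1.trans_le ht.1, h2.trans_lt ht₁.2⟩, hmid t ⟨ht.1, h2⟩⟩
    · left
      rw [hhigh t h2]
      exact horoball_segment hR hw (h₁ t₁ ⟨le_rfl, ht₁.2⟩) (by linarith) (by linarith [ht.2])
  · rw [hlow t ht.2.le]
    exact horoball_segment hR hv (h₀ t₀ ⟨ht₀.1, le_rfl⟩) (by linarith [ht.2]) (by linarith [ht.1])

/-- Paths in the upper half plane between linked pairs of cusps cross. -/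
theorem exists_eq_of_linked (h : CuspPath φ (1, 0) w) (h' : CuspPath ψ v' w')
    (hl : Linked (1, 0) w v' w') : ∃ s ∈ Set.Ioo (0 : ℝ) 1, ∃ t ∈ Set.Ioo (0 : ℝ) 1, φ s = ψ t := by
  unfold Linked at hl
  have n1 : cross (1, 0) v' ≠ 0 := by rintro h0; simp [h0] at hl
  have n2 : cross w v' ≠ 0 := by rintro h0; simp [h0] at hl
  have n3 : cross (1, 0) w' ≠ 0 := by rintro h0; simp [h0] at hl
  have n4 : cross w w' ≠ 0 := by rintro h0; simp [h0] at hl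
  have symm : ∀ a b, cross a b ≠ 0 → cross b a ≠ 0 := fun a b hab h0 => hab (by
    unfold cross at *; linarith)
  have e1 : cross (1, 0) v' = v'.2 := by simp [cross]
  have e3 : cross (1, 0) w' = w'.2 := by simp [cross]
  have hv' : v'.2 ≠ 0 := by rwa [e1] at n1
  have hw' : w'.2 ≠ 0 := by rwa [e3] at n3
  have hw : w.2 ≠ 0 := by
    intro h0
    simp only [cross, h0] at hl
    nlinarith [sq_nonneg (w.1 * v'.2 * w'.2)]
  obtain ⟨R₁, -, hR₁⟩ := h'.exists_notMem_horoball n1 n3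
  obtain ⟨R₂, -, hR₂⟩ := h'.exists_notMem_horoball n2 n4
  obtain ⟨R₃, -, hR₃⟩ := h.exists_notMem_horoball (symm _ _ n1) (symm _ _ n2)
  obtain ⟨R₄, hR₄', hR₄⟩ := h.exists_notMem_horoball (symm _ _ n3) (symm _ _ n4)
  obtain ⟨R, h1, h2, h3, h4⟩ : ∃ R, R₁ ≤ R ∧ R₂ ≤ R ∧ R₃ ≤ R ∧ R₄ ≤ R :=
    ⟨max (max R₁ R₂) (max R₃ R₄), by simp⟩
  have hR : 1 ≤ R := hR₄'.trans h4
  have hR0 : 0 ≤ R := by linarith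
  obtain ⟨A, a, b, hab, hA, hAa, -, hAb, hAm, -⟩ := h.exists_extension hR0 hw
  obtain ⟨B, c, d, hcd, hB, -, hBc, hBd, hBm, hBl⟩ := h'.exists_extension hR0 hw'
  have hBm' : ∀ t ∈ Set.Ioo (c - 1) (d + 1), B t ∈ horoball R v' ∨ B t ∈ horoball R w' ∨
      ∃ s ∈ Set.Ioo (0 : ℝ) 1, B t = ψ s := fun t ht => by
    rcases lt_or_ge t c with hc | hc
    · exact Or.inl (hBl hv' t ⟨ht.1, hc⟩)
    · exact Or.inr (hBm t ⟨hc, ht.2⟩)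
  have hApos : ∀ s ∈ Set.Ico a (b + 1), 0 < (A s).im := fun s hs => by
    rcases hAm s hs with h5 | ⟨r, -, h5⟩
    · exact horoball_im_pos hR0 h5
    · rw [h5]; exact (φ r).im_pos
  have hBpos : ∀ t ∈ Set.Ioo (c - 1) (d + 1), 0 < (B t).im := fun s hs => by
    rcases hBm' s hs with h5 | h5 | ⟨r, -, h5⟩
    · exact horoball_im_pos hR0 h5
    · exact horoball_im_pos hR0 h5
    · rw [h5]; exact (ψ r).im_pos
  have hBinf : ∀ t ∈ Set.Ioo (c - 1) (d + 1), B t ∉ horoball R (1, 0) := fun s hs h6 => by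
    rcases hBm' s hs with h5 | h5 | ⟨r, hr, h5⟩
    · exact horoball_disjoint hR n1 h6 h5
    · exact horoball_disjoint hR n3 h6 h5
    · exact hR₁ R h1 r hr (h5 ▸ h6)
  have hinf : ∀ z, z ∈ horoball R (1, 0) ↔ R < z.im := fun z => by simp [mem_horoball]
  have hAa' := (hinf _).1 hAa
  have hBc0 : (B (c - 1)).im = 0 := by rw [hBc, Complex.ofReal_im]
  have hBd0 : (B (d + 1)).im = 0 := by rw [hBd, Complex.ofReal_im]
  have hAb0 : (A (b + 1)).im = 0 := by rw [hAb, Complex.ofReal_im]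
  have hcases : ∀ t ∈ Set.Icc (c - 1) (d + 1), t = c - 1 ∨ t = d + 1 ∨
      t ∈ Set.Ioo (c - 1) (d + 1) := fun t ht => by
    rcases ht.1.eq_or_lt with h5 | h5
    · exact Or.inl h5.symm
    rcases ht.2.eq_or_lt with h6 | h6
    · exact Or.inr (Or.inl h6)
    · exact Or.inr (Or.inr ⟨h5, h6⟩)
  obtain ⟨s, hs, t, ht, hst⟩ := exists_eq_of_endpoints_linked hA hB (a := a) (b := b + 1)
    (c := c - 1) (d := d + 1) (by linarith) (by linarith)
    (fun s hs => by
      rcases hs.2.eq_or_lt with h5 | h5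
      · rw [h5, hAb0]
      · exact (hApos s ⟨hs.1, h5⟩).le)
    (fun t ht => by
      rcases hcases t ht with rfl | rfl | h5
      · rw [hBc0]
      · rw [hBd0]
      · exact (hBpos t h5).le)
    (fun t ht => by
      rcases hcases t ht with rfl | rfl | h5
      · rw [hBc0]; linarith
      · rw [hBd0]; linarith
      · exact (not_lt.1 fun h6 => hBinf t h5 ((hinf _).2 h6)).trans hAa'.le)
    hAb0 hBc0 hBd0
    (by
      rw [hAb, hBc, hBd]
      simp only [Complex.ofReal_re]
      have r1 : (v'.2 : ℝ) ≠ 0 := by exact_mod_cast hv'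
      have r2 : (w'.2 : ℝ) ≠ 0 := by exact_mod_cast hw'
      have r3 : (w.2 : ℝ) ≠ 0 := by exact_mod_cast hw
      have e : ((w.1 / w.2 : ℝ) - v'.1 / v'.2) * (w.1 / w.2 - w'.1 / w'.2) =
          ((cross (1, 0) v' * cross w v' * (cross (1, 0) w' * cross w w') : ℤ) : ℝ) /
            (w.2 * v'.2 * w'.2) ^ 2 := by
        rw [e1, e3]
        unfold cross
        push_cast
        field_simp
      rw [e]
      exact div_neg_of_neg_of_pos (by exact_mod_cast hl) (by positivity))
  have hs' : s ∈ Set.Ico a (b + 1) := by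
    refine ⟨hs.1, hs.2.lt_of_ne ?_⟩
    rintro rfl
    rcases hcases t ht with rfl | rfl | h5
    · have h6 : cross w v' = 0 := by
        rw [hAb, hBc, Complex.ofReal_inj, div_eq_div_iff (by exact_mod_cast hw)
          (by exact_mod_cast hv')] at hst
        have : w.1 * v'.2 = v'.1 * w.2 := by exact_mod_cast hst
        unfold cross; linarith
      exact n2 h6
    · have h6 : cross w w' = 0 := by
        rw [hAb, hBd, Complex.ofReal_inj, div_eq_div_iff (by exact_mod_cast hw)
          (by exact_mod_cast hw')] at hst
        have : w.1 * w'.2 = w'.1 * w.2 := by exact_mod_cast hst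
        unfold cross; linarith
      exact n4 h6
    · have := hBpos t h5
      rw [← hst, hAb0] at this
      exact lt_irrefl _ this
  have ht' : t ∈ Set.Ioo (c - 1) (d + 1) := by
    have := hApos s hs'
    rw [hst] at this
    rcases hcases t ht with rfl | rfl | h5
    · rw [hBc0] at this; exact absurd this (lt_irrefl _)
    · rw [hBd0] at this; exact absurd this (lt_irrefl _)
    · exact h5
  rcases hAm s hs' with h5 | ⟨s', hs', h5⟩ <;> rcases hBm' t ht' with h6 | h6 | ⟨t', ht', h6⟩
  · exact absurd (hst ▸ h5) (horoball_disjoint hR (symm _ _ n2) h6)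
  · exact absurd (hst ▸ h5) (horoball_disjoint hR (symm _ _ n4) h6)
  · exact absurd (h6 ▸ hst ▸ h5) (hR₂ R h2 t' ht')
  · exact absurd (h5 ▸ hst ▸ h6) (hR₃ R h3 s' hs')
  · exact absurd (h5 ▸ hst ▸ h6) (hR₄ R h4 s' hs')
  · exact ⟨s', hs', t', ht', UpperHalfPlane.ext (by rw [← h5, hst, h6])⟩

end CuspPath

/-- The action of `SL(2, ℤ)` on integer vectors. -/
def cuspSmul (g : SL(2, ℤ)) (v : ℤ × ℤ) : ℤ × ℤ :=
  (g 0 0 * v.1 + g 0 1 * v.2, g 1 0 * v.1 + g 1 1 * v.2)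

theorem cuspSmul_mul (g h : SL(2, ℤ)) (v : ℤ × ℤ) :
    cuspSmul (g * h) v = cuspSmul g (cuspSmul h v) := by
  obtain ⟨h1, h2, h3, h4⟩ := SL2_mul_apply g h
  unfold cuspSmul
  rw [h1, h2, h3, h4]
  ext <;> simp only <;> ring

theorem cuspSmul_infinity (g : SL(2, ℤ)) : cuspSmul g (1, 0) = (g 0 0, g 1 0) := by
  simp [cuspSmul]

theorem mem_horoball_infinity {R : ℝ} {z : ℂ} : z ∈ horoball R (1, 0) ↔ R < z.im := by
  simp [mem_horoball]

theorem smul_mem_horoball {g : SL(2, ℤ)} {u : ℍ} {R : ℝ} {v : ℤ × ℤ} :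
    ((g • u : ℍ) : ℂ) ∈ horoball R (cuspSmul g v) ↔ (u : ℂ) ∈ horoball R v := by
  have hN : ∀ (v : ℤ × ℤ) (z : ℂ), (v.1 - v.2 * z.re) ^ 2 + (v.2 * z.im) ^ 2 =
      Complex.normSq ((v.1 : ℂ) - v.2 * z) := fun v z => by
    simp [Complex.normSq_apply]; ring
  have hj := SL2Z_denom_ne_zero g u
  have hw := coe_SL2Z_smul g u
  have him := im_SL2Z_smul g u
  rw [eq_div_iff hj] at hw
  rw [mem_horoball, mem_horoball, hN, hN, UpperHalfPlane.coe_im, UpperHalfPlane.coe_im, him]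
  generalize g • u = w at *
  have hdet : (g 0 0 * g 1 1 - g 0 1 * g 1 0 : ℂ) = 1 := by exact_mod_cast SL2_det g
  have e : ((cuspSmul g v).1 : ℂ) - (cuspSmul g v).2 * w =
      (v.1 - v.2 * u) / ((g 1 0 : ℂ) * u + g 1 1) := by
    rw [eq_div_iff hj]
    unfold cuspSmul
    push_cast
    linear_combination (-(g 1 0 * v.1 + g 1 1 * v.2 : ℂ)) * hw + ((v.1 : ℂ) - v.2 * u) * hdet
  rw [e, Complex.normSq_div, mul_div_assoc', div_lt_div_iff_of_pos_right (Complex.normSq_pos.2 hj)]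

theorem inv_smul_mem_horoball {g : SL(2, ℤ)} {u : ℍ} {R : ℝ} :
    (u : ℂ) ∈ horoball R (g⁻¹ 0 0, g⁻¹ 1 0) ↔ R < (g • u).im := by
  rw [← cuspSmul_infinity, ← smul_mem_horoball (g := g), ← cuspSmul_mul, mul_inv_cancel]
  have : cuspSmul 1 (1, 0) = (1, 0) := by simp [cuspSmul]
  rw [this, mem_horoball_infinity, UpperHalfPlane.coe_im]

theorem CuspPath.smul {φ : ℝ → ℍ} {v w : ℤ × ℤ} (h : CuspPath φ v w) (g : SL(2, ℤ)) :
    CuspPath (fun t => g • φ t) (cuspSmul g v) (cuspSmul g w) where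
  continuousOn := h.continuousOn.const_smul g
  start R := (h.start R).mono fun _ ht => smul_mem_horoball.2 ht
  finish R := (h.finish R).mono fun _ ht => smul_mem_horoball.2 ht

theorem im_smul_eq_of_one_lt {g h : SL(2, ℤ)} {u : ℍ} (hg : 1 < (g • u).im) (hh : 1 < (h • u).im)
    (w : ℍ) : (g • w).im = (h • w).im := by
  obtain ⟨k, hk⟩ : ∃ k, k * h = g := ⟨g * h⁻¹, by simp⟩
  rw [← hk, mul_smul] at hg ⊢
  have hc : k 1 0 = 0 := by
    by_contra hc
    have h1 : (1 : ℝ) ≤ (k 1 0 : ℝ) ^ 2 := by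
      have : 1 ≤ (k 1 0) ^ 2 := Int.add_one_le_iff.2 (sq_pos_of_ne_zero hc)
      exact_mod_cast this
    have h2 := SL2Z_smul_im_mul k (h • u)
    generalize k • h • u = x at *
    generalize h • u = y at *
    have h3 : y.im * y.im ≤ (k 1 0 * y.im) ^ 2 := by nlinarith [mul_pos y.im_pos y.im_pos]
    have h5 : (k 1 0 * y.im) ^ 2 ≤ (k 1 0 * y.re + k 1 1) ^ 2 + (k 1 0 * y.im) ^ 2 := by
      nlinarith [sq_nonneg (k 1 0 * y.re + k 1 1)]
    have h4 : x.im * (y.im * y.im) ≤ y.im := by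
      exact (mul_le_mul_of_nonneg_left (h3.trans h5) x.im_pos.le).trans h2.le
    nlinarith [mul_pos y.im_pos y.im_pos, y.im_pos]
  have hd : (k 1 1 : ℝ) ^ 2 = 1 := by
    have h1 := SL2_det k
    rw [hc, mul_zero, sub_zero] at h1
    have : k 1 1 ^ 2 = 1 := by
      rcases Int.eq_one_or_neg_one_of_mul_eq_one' h1 with ⟨-, h⟩ | ⟨-, h⟩ <;> rw [h] <;> norm_num
    exact_mod_cast this
  have h2 := SL2Z_smul_im_mul k (h • w)
  rw [hc] at h2
  generalize k • h • w = x at *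
  generalize h • w = y at *
  have h3 : x.im * (k 1 1 : ℝ) ^ 2 = y.im := by rw [← h2]; simp
  rwa [hd, mul_one] at h3

theorem exists_sanov_of_isPreconnected {S : Set ℍ} (hS : IsPreconnected S)
    (h : ∀ u ∈ S, 2 < ‖(sanovCover u : ℂ)‖) :
    ∃ g ∈ sanov, ∀ u ∈ S, ‖(sanovCover u : ℂ)‖ - 1 ≤ (g • u).im := by
  rcases S.eq_empty_or_nonempty with rfl | ⟨u₀, hu₀⟩
  · exact ⟨1, one_mem _, by simp⟩
  have hex : ∀ u ∈ S, ∃ g ∈ sanov, 1 < (g • u).im ∧ ‖(sanovCover u : ℂ)‖ - 1 ≤ (g • u).im := by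
    intro u hu
    obtain ⟨g, hg, h1⟩ := exists_im_gt_of_norm (u := u)
    exact ⟨g, hg, by linarith [h u hu], h1⟩
  obtain ⟨g₀, hg₀, h1, -⟩ := hex u₀ hu₀
  have hopen : ∀ g : SL(2, ℤ), IsOpen {u : ℍ | 1 < (g • u).im} := fun g =>
    isOpen_lt continuous_const (UpperHalfPlane.continuous_im.comp (continuous_const_smul g))
  let U : Set ℍ := {u : ℍ | 1 < (g₀ • u).im}
  let W : Set ℍ := ⋃ g : {g : SL(2, ℤ) // ¬ ∀ w : ℍ, (g • w).im = (g₀ • w).im},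
    {u : ℍ | 1 < (g.1 • u).im}
  have hsub : S ⊆ U := by
    refine hS.subset_left_of_subset_union (hopen g₀) (isOpen_iUnion fun g => hopen g.1)
      (u := U) (v := W) ?_ ?_ ⟨u₀, hu₀, h1⟩
    · refine Set.disjoint_left.2 fun u hu hw => ?_
      obtain ⟨g, hg⟩ := Set.mem_iUnion.1 hw
      exact g.2 (im_smul_eq_of_one_lt hg hu)
    · intro u hu
      obtain ⟨g, -, h2, -⟩ := hex u hu
      by_cases h3 : ∀ w : ℍ, (g • w).im = (g₀ • w).im
      · left
        change 1 < (g₀ • u).im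
        rw [← h3]; exact h2
      · exact Or.inr (Set.mem_iUnion.2 ⟨⟨g, h3⟩, h2⟩)
  refine ⟨g₀, hg₀, fun u hu => ?_⟩
  obtain ⟨g, -, h2, h3⟩ := hex u hu
  rw [← im_smul_eq_of_one_lt h2 (hsub hu) u]
  exact h3

theorem exists_sanov_tendsto {φ : ℝ → ℍ} (hφ : ContinuousOn φ (Set.Ioo 0 1)) {l : Filter ℝ}
    (hl : ∀ s ∈ l, ∃ I ∈ l, I ⊆ s ∧ IsPreconnected I) (h01 : Set.Ioo 0 1 ∈ l)
    (h : Filter.Tendsto (fun t => ‖(sanovCover (φ t) : ℂ)‖) l Filter.atTop) :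
    ∃ g ∈ sanov, ∀ R : ℝ, ∀ᶠ t in l, R < (g • φ t).im := by
  obtain ⟨I, hI, hsub, hpre⟩ := hl _ (Filter.inter_mem h01 (h.eventually_gt_atTop 2))
  obtain ⟨g, hg, h1⟩ := exists_sanov_of_isPreconnected
    (hpre.image φ (hφ.mono fun t ht => (hsub ht).1)) (by rintro _ ⟨t, ht, rfl⟩; exact (hsub ht).2)
  refine ⟨g, hg, fun R => ?_⟩
  filter_upwards [hI, h.eventually_gt_atTop (R + 1)] with t ht hR
  have := h1 _ ⟨t, ht, rfl⟩
  linarith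

theorem exists_cuspPath_lift {Z : ℝ → ℂ} (hZ : ContinuousOn Z (Set.Ioo 0 1))
    (hne : ∀ t ∈ Set.Ioo (0 : ℝ) 1, Z t ≠ 1 ∧ Z t ≠ -1)
    (h0 : Filter.Tendsto (fun t => ‖Z t‖) (𝓝[>] 0) Filter.atTop)
    (h1 : Filter.Tendsto (fun t => ‖Z t‖) (𝓝[<] 1) Filter.atTop) :
    ∃ φ : ℝ → ℍ, ∃ d ∈ sanov, CuspPath φ (1, 0) (d 0 0, d 1 0) ∧
      ∀ t ∈ Set.Ioo (0 : ℝ) 1, (sanovCover (φ t) : ℂ) = Z t := by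
  have : ContractibleSpace (Set.Ioo (0 : ℝ) 1) :=
    (convex_Ioo 0 1).contractibleSpace ⟨2⁻¹, by norm_num⟩
  have : LocallyPathConnectedSpace (Set.Ioo (0 : ℝ) 1) := isOpen_Ioo.locallyPathConnectedSpace
  let F : C(Set.Ioo (0 : ℝ) 1, TwicePunctured) :=
    ⟨fun t => ⟨Z t, hne t t.2⟩, (continuousOn_iff_continuous_domRestrict.1 hZ).subtype_mk _⟩
  let a₀ : Set.Ioo (0 : ℝ) 1 := ⟨2⁻¹, by norm_num⟩
  obtain ⟨e₀, he₀⟩ := isQuotientMap_sanovCover.surjective (F a₀)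
  obtain ⟨Φ, ⟨-, hΦ⟩, -⟩ := isCoveringMap_sanovCover.existsUnique_continuousMap_lifts F a₀ e₀ he₀
  classical
  let φ : ℝ → ℍ := fun t => if ht : t ∈ Set.Ioo (0 : ℝ) 1 then Φ ⟨t, ht⟩ else UpperHalfPlane.I
  have hφ : ContinuousOn φ (Set.Ioo 0 1) := by
    rw [continuousOn_iff_continuous_domRestrict]
    refine Φ.continuous.congr fun t => ?_
    change Φ t = φ t
    simp only [φ, dif_pos t.2]
  have hcov : ∀ t ∈ Set.Ioo (0 : ℝ) 1, (sanovCover (φ t) : ℂ) = Z t := fun t ht => by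
    simp only [φ, dif_pos ht]
    exact congrArg Subtype.val (congrFun hΦ ⟨t, ht⟩)
  have m0 : Set.Ioo (0 : ℝ) 1 ∈ 𝓝[>] (0 : ℝ) := Ioo_mem_nhdsGT one_pos
  have m1 : Set.Ioo (0 : ℝ) 1 ∈ 𝓝[<] (1 : ℝ) := Ioo_mem_nhdsLT one_pos
  obtain ⟨g, hg, hg0⟩ := exists_sanov_tendsto hφ (l := 𝓝[>] 0)
    (fun s hs => by
      obtain ⟨u, hu, h⟩ := mem_nhdsGT_iff_exists_Ioo_subset.1 hs
      exact ⟨_, Ioo_mem_nhdsGT hu, h, isPreconnected_Ioo⟩) m0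
    (h0.congr' (by filter_upwards [m0] with t ht; rw [hcov t ht]))
  obtain ⟨k, hk, hk1⟩ := exists_sanov_tendsto hφ (l := 𝓝[<] 1)
    (fun s hs => by
      obtain ⟨u, hu, h⟩ := mem_nhdsLT_iff_exists_Ioo_subset.1 hs
      exact ⟨_, Ioo_mem_nhdsLT hu, h, isPreconnected_Ioo⟩) m1
    (h1.congr' (by filter_upwards [m1] with t ht; rw [hcov t ht]))
  have hcusp : CuspPath φ (cuspSmul g⁻¹ (1, 0)) (cuspSmul k⁻¹ (1, 0)) := by
    refine ⟨hφ, fun R => ?_, fun R => ?_⟩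
    · filter_upwards [hg0 R] with t ht
      rw [cuspSmul_infinity]; exact inv_smul_mem_horoball.2 ht
    · filter_upwards [hk1 R] with t ht
      rw [cuspSmul_infinity]; exact inv_smul_mem_horoball.2 ht
  refine ⟨fun t => g • φ t, g * k⁻¹, mul_mem hg (inv_mem hk), ?_, fun t ht => ?_⟩
  · have := hcusp.smul g
    rw [← cuspSmul_mul, ← cuspSmul_mul, mul_inv_cancel, cuspSmul_infinity,
      cuspSmul_infinity] at this
    simpa using this
  · rw [sanovCover_smul hg, hcov t ht]

/-- The end cusp of a lift can be normalized by an even translation. -/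
theorem exists_cuspPath_lift_normalized {Z : ℝ → ℂ} (hZ : ContinuousOn Z (Set.Ioo 0 1))
    (hne : ∀ t ∈ Set.Ioo (0 : ℝ) 1, Z t ≠ 1 ∧ Z t ≠ -1)
    (h0 : Filter.Tendsto (fun t => ‖Z t‖) (𝓝[>] 0) Filter.atTop)
    (h1 : Filter.Tendsto (fun t => ‖Z t‖) (𝓝[<] 1) Filter.atTop) :
    ∃ φ : ℝ → ℍ, ∃ d ∈ sanov, CuspPath φ (1, 0) (d 0 0, d 1 0) ∧
      (∀ t ∈ Set.Ioo (0 : ℝ) 1, (sanovCover (φ t) : ℂ) = Z t) ∧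
      d 0 0 ∈ Set.Icc 0 (2 * |d 1 0| + 1) := by
  obtain ⟨φ, d, hd, hφ, hcov⟩ := exists_cuspPath_lift hZ hne h0 h1
  by_cases hq : d 1 0 = 0
  · refine ⟨φ, d, hd, hφ, hcov, ?_⟩
    have h2 := SL2_det d
    rw [hq, mul_zero, sub_zero] at h2
    have h3 := (mem_sanov.1 hd).1
    rcases Int.eq_one_or_neg_one_of_mul_eq_one' h2 with ⟨h, -⟩ | ⟨h, -⟩
    · rw [hq, h]; simp
    · rw [h] at h3; norm_num at h3
  · obtain ⟨T, hT0, hT1, hT2, hT3⟩ := exists_SL2_entries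
      (show (1 : ℤ) * 1 - (-2 * (d 0 0 / (2 * d 1 0))) * 0 = 1 by ring)
    have hT : T ∈ sanov := mem_sanov.2 ⟨by rw [hT0]; norm_num, by rw [hT1]; omega, by rw [hT2]; rfl⟩
    obtain ⟨e1, -, e2, -⟩ := SL2_mul_apply T d
    refine ⟨fun t => T • φ t, T * d, mul_mem hT hd, ?_, fun t ht => ?_, ?_⟩
    · have := hφ.smul T
      rw [← cuspSmul_infinity d, ← cuspSmul_mul, cuspSmul_infinity, cuspSmul_infinity, hT0, hT2]
        at this
      exact this
    · rw [sanovCover_smul hT, hcov t ht]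
    · have h2 := Int.emod_add_mul_ediv (d 0 0) (2 * d 1 0)
      have h3 := Int.emod_nonneg (d 0 0) (mul_ne_zero two_ne_zero hq)
      have h4 := Int.emod_lt_abs (d 0 0) (mul_ne_zero two_ne_zero hq)
      rw [abs_mul, abs_two] at h4
      have e3 : (T * d) 0 0 = d 0 0 % (2 * d 1 0) := by
        rw [e1, hT0, hT1]; linear_combination -h2
      have e4 : (T * d) 1 0 = d 1 0 := by rw [e2, hT2, hT3]; ring
      rw [e3, e4]
      exact ⟨h3, by linarith⟩

/-- The Möbius map sending the obstacles `v`, `w` to `∞`, `1` and `∞` to `-1`. -/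
noncomputable def obstacleChart (v w x : ℝ × ℝ) : ℂ :=
  2 * Complex.equivRealProdCLM.symm (w - v) / Complex.equivRealProdCLM.symm (x - v) - 1

/-- The inverse of `obstacleChart`. -/
noncomputable def obstacleChartInv (v w : ℝ × ℝ) (Z : ℂ) : ℝ × ℝ :=
  v + Complex.equivRealProdCLM (2 * Complex.equivRealProdCLM.symm (w - v) / (Z + 1))

section Chart

variable {v w : ℝ × ℝ}

theorem equivRealProdCLM_symm_sub_ne_zero {x y : ℝ × ℝ} (h : x ≠ y) :
    Complex.equivRealProdCLM.symm (x - y) ≠ 0 := by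
  rw [Ne, EmbeddingLike.map_eq_zero_iff, sub_eq_zero]; exact h

theorem obstacleChartInv_obstacleChart (hwv : w ≠ v) {x : ℝ × ℝ} (hx : x ≠ v) :
    obstacleChartInv v w (obstacleChart v w x) = x := by
  have h1 := equivRealProdCLM_symm_sub_ne_zero hwv
  have h2 := equivRealProdCLM_symm_sub_ne_zero hx
  have h3 : 2 * Complex.equivRealProdCLM.symm (w - v) / (obstacleChart v w x + 1) =
      Complex.equivRealProdCLM.symm (x - v) := by
    unfold obstacleChart
    rw [sub_add_cancel]
    field_simp
  rw [obstacleChartInv, h3, ContinuousLinearEquiv.apply_symm_apply, add_sub_cancel]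

theorem obstacleChart_ne (hwv : w ≠ v) {x : ℝ × ℝ} (hx : x ≠ v) (hxw : x ≠ w) :
    obstacleChart v w x ≠ 1 ∧ obstacleChart v w x ≠ -1 := by
  have h1 := equivRealProdCLM_symm_sub_ne_zero hwv
  have h2 := equivRealProdCLM_symm_sub_ne_zero hx
  unfold obstacleChart
  refine ⟨fun h => hxw ?_, fun h => ?_⟩
  · have h3 : Complex.equivRealProdCLM.symm (w - v) = Complex.equivRealProdCLM.symm (x - v) := by
      rw [sub_eq_iff_eq_add, div_eq_iff h2] at h
      linear_combination h / 2
    exact (sub_left_injective (Complex.equivRealProdCLM.symm.injective h3)).symm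
  · rw [sub_eq_iff_eq_add, neg_add_cancel, div_eq_zero_iff] at h
    exact h.elim (mul_ne_zero two_ne_zero h1) h2

theorem obstacleChartInv_ne (hwv : w ≠ v) {Z : ℂ} (h1 : Z ≠ 1) (h2 : Z ≠ -1) :
    obstacleChartInv v w Z ≠ v ∧ obstacleChartInv v w Z ≠ w := by
  have h3 := equivRealProdCLM_symm_sub_ne_zero hwv
  have h4 : Z + 1 ≠ 0 := fun h => h2 (eq_neg_of_add_eq_zero_left h)
  unfold obstacleChartInv
  refine ⟨fun h => ?_, fun h => h1 ?_⟩
  · rw [add_eq_left, EmbeddingLike.map_eq_zero_iff, div_eq_zero_iff] at h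
    exact h.elim (mul_ne_zero two_ne_zero h3) h4
  · rw [← eq_sub_iff_add_eq', ← Complex.equivRealProdCLM.apply_symm_apply (w - v)] at h
    have h5 := Complex.equivRealProdCLM.injective h
    rw [ContinuousLinearEquiv.apply_symm_apply, div_eq_iff h4] at h5
    have : Complex.equivRealProdCLM.symm (w - v) * (Z - 1) = 0 := by linear_combination -h5
    exact sub_eq_zero.1 ((mul_eq_zero.1 this).resolve_left h3)

theorem continuousOn_obstacleChart : ContinuousOn (obstacleChart v w) {v}ᶜ := by
  unfold obstacleChart
  refine (ContinuousOn.div continuousOn_const (by fun_prop) fun x hx =>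
    equivRealProdCLM_symm_sub_ne_zero hx).sub continuousOn_const

theorem continuousOn_obstacleChartInv : ContinuousOn (obstacleChartInv v w) {-1}ᶜ := by
  unfold obstacleChartInv
  refine continuousOn_const.add (Complex.equivRealProdCLM.continuous.comp_continuousOn
    (ContinuousOn.div continuousOn_const (by fun_prop) fun x hx h => hx
      (eq_neg_of_add_eq_zero_left h)))

theorem tendsto_obstacleChart (hwv : w ≠ v) :
    Filter.Tendsto (fun x => ‖obstacleChart v w x‖) (𝓝[≠] v) Filter.atTop := by
  have h1 := equivRealProdCLM_symm_sub_ne_zero hwv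
  have h2 : Filter.Tendsto (fun x => Complex.equivRealProdCLM.symm (x - v)) (𝓝[≠] v) (𝓝[≠] 0) := by
    refine tendsto_nhdsWithin_iff.2 ⟨?_, ?_⟩
    · have : Continuous fun x => Complex.equivRealProdCLM.symm (x - v) := by fun_prop
      have := this.tendsto v
      rw [sub_self, map_zero] at this
      exact this.mono_left nhdsWithin_le_nhds
    · filter_upwards [self_mem_nhdsWithin] with x hx
      exact equivRealProdCLM_symm_sub_ne_zero hx
  have h3 := (tendsto_norm_inv_nhdsNE_zero_atTop (α := ℂ)).comp h2
  have h4 : Filter.Tendsto (fun x => ‖2 * Complex.equivRealProdCLM.symm (w - v)‖ *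
      ‖(Complex.equivRealProdCLM.symm (x - v))⁻¹‖ + (-1)) (𝓝[≠] v) Filter.atTop :=
    Filter.tendsto_atTop_add_const_right _ _ (h3.const_mul_atTop (by
      rw [norm_pos_iff]; exact mul_ne_zero two_ne_zero h1))
  refine Filter.tendsto_atTop_mono (fun x => ?_) h4
  rw [← norm_mul, ← div_eq_mul_inv]
  have := norm_sub_norm_le (2 * Complex.equivRealProdCLM.symm (w - v) /
    Complex.equivRealProdCLM.symm (x - v)) 1
  rw [norm_one] at this
  exact this

theorem tendsto_obstacleChartInv :
    Filter.Tendsto (obstacleChartInv v w) (Bornology.cobounded ℂ) (𝓝 v) := by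
  have h1 : Filter.Tendsto (fun Z : ℂ => Z + 1) (Bornology.cobounded ℂ) (Bornology.cobounded ℂ) :=
    tendsto_add_const_cobounded 1
  have h2 := (Filter.tendsto_inv₀_cobounded (α := ℂ)).comp h1
  have h3 := (h2.const_mul (2 * Complex.equivRealProdCLM.symm (w - v)))
  have h4 := (Complex.equivRealProdCLM.continuous.tendsto _).comp h3
  rw [mul_zero, map_zero] at h4
  have h5 := h4.const_add v
  rw [add_zero] at h5
  exact h5

end Chart

/-- Convex combination in the upper half plane. -/
noncomputable def halfPlaneLerp (a : unitInterval) (u w : ℍ) : ℍ :=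
  ⟨(1 - (a : ℝ)) • (u : ℂ) + (a : ℝ) • (w : ℂ), by
    have h := convex_halfSpace_im_gt 0 u.im_pos w.im_pos (sub_nonneg.2 a.2.2) a.2.1
      (sub_add_cancel 1 (a : ℝ))
    exact h⟩

theorem halfPlaneLerp_zero (u w : ℍ) : halfPlaneLerp 0 u w = u :=
  UpperHalfPlane.ext (by simp [halfPlaneLerp])

theorem halfPlaneLerp_one (u w : ℍ) : halfPlaneLerp 1 u w = w :=
  UpperHalfPlane.ext (by simp [halfPlaneLerp])

theorem continuous_halfPlaneLerp :
    Continuous fun x : unitInterval × ℍ × ℍ => halfPlaneLerp x.1 x.2.1 x.2.2 := by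
  rw [UpperHalfPlane.isEmbedding_coe.continuous_iff]
  have : Continuous fun x : unitInterval × ℍ × ℍ =>
      (1 - (x.1 : ℝ)) • (x.2.1 : ℂ) + (x.1 : ℝ) • (x.2.2 : ℂ) := by
    have h1 := UpperHalfPlane.continuous_coe
    have h2 : Continuous fun x : unitInterval × ℍ × ℍ => (x.2.1 : ℂ) := by fun_prop
    have h3 : Continuous fun x : unitInterval × ℍ × ℍ => (x.2.2 : ℂ) := by fun_prop
    fun_prop
  exact this

theorem halfPlaneLerp_mem_horoball {R : ℝ} (hR : 0 ≤ R) {c : ℤ × ℤ} {u w : ℍ}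
    (hu : (u : ℂ) ∈ horoball R c) (hw : (w : ℂ) ∈ horoball R c) (a : unitInterval) :
    (halfPlaneLerp a u w : ℂ) ∈ horoball R c :=
  horoball_convex hR c hu hw (sub_nonneg.2 a.2.2) a.2.1 (sub_add_cancel 1 (a : ℝ))

theorem norm_sanovCover_gt {R : ℝ} (hR : 1 ≤ R) {d : SL(2, ℤ)} (hd : d ∈ sanov) {u : ℍ}
    (hu : (u : ℂ) ∈ horoball R (d 0 0, d 1 0)) : R - 1 < ‖(sanovCover u : ℂ)‖ := by
  have h1 : R < (d⁻¹ • u).im := inv_smul_mem_horoball.1 (by rwa [inv_inv])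
  have h2 := im_le_norm_sanovCover (u := d⁻¹ • u) (by linarith)
  rw [sanovCover_smul (inv_mem hd)] at h2
  linarith

theorem continuous_obstacleChartInv_sanovCover (v w : ℝ × ℝ) :
    Continuous fun u : ℍ => obstacleChartInv v w (sanovCover u) :=
  continuousOn_obstacleChartInv.comp_continuous
    (continuous_subtype_val.comp continuous_sanovCover) fun u => (sanovCover u).2.2

/-- The free homotopy in the plane obtained from the straight-line homotopy of lifts. -/
noncomputable def liftedHomotopy (v w : ℝ × ℝ) (φ ψ : ℝ → ℍ) (s t : ℝ) : ℝ × ℝ :=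
  open Classical in
  if t ∈ Set.Ioo (0 : ℝ) 1 then
    obstacleChartInv v w (sanovCover (halfPlaneLerp (Set.projIcc 0 1 zero_le_one s) (φ t) (ψ t)))
  else v

section LiftedHomotopy

variable {v w : ℝ × ℝ} {φ ψ : ℝ → ℍ} {s t : ℝ}

theorem liftedHomotopy_of_mem (ht : t ∈ Set.Ioo (0 : ℝ) 1) : liftedHomotopy v w φ ψ s t =
    obstacleChartInv v w
      (sanovCover (halfPlaneLerp (Set.projIcc 0 1 zero_le_one s) (φ t) (ψ t))) :=
  if_pos ht

theorem liftedHomotopy_of_notMem (ht : t ∉ Set.Ioo (0 : ℝ) 1) : liftedHomotopy v w φ ψ s t = v :=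
  if_neg ht

theorem continuousAt_liftedHomotopy_end {b : SL(2, ℤ)} (hb : b ∈ sanov)
    (ht : t ∉ Set.Ioo (0 : ℝ) 1)
    (h : ∀ R, ∀ᶠ t in 𝓝[Set.Ioo 0 1] t, (φ t : ℂ) ∈ horoball R (b 0 0, b 1 0) ∧
      (ψ t : ℂ) ∈ horoball R (b 0 0, b 1 0)) :
    ContinuousAt (fun p : ℝ × ℝ => liftedHomotopy v w φ ψ p.1 p.2) (s, t) := by
  refine Filter.tendsto_def.2 fun U hU => ?_
  have hv : liftedHomotopy v w φ ψ s t = v := liftedHomotopy_of_notMem ht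
  have hU' : U ∈ 𝓝 v := hv ▸ hU
  have h1 := tendsto_obstacleChartInv (v := v) (w := w) hU'
  rw [Filter.mem_map, ← comap_norm_atTop, Filter.mem_comap] at h1
  obtain ⟨S, hS, hSU⟩ := h1
  obtain ⟨M, hM⟩ := Filter.mem_atTop_sets.1 hS
  have h2 := eventually_nhdsWithin_iff.1 (h (max 1 (M + 1)))
  have h3 := (continuous_snd.tendsto (s, t)).eventually h2
  filter_upwards [h3] with p hp
  rw [Set.mem_preimage]
  by_cases ht : p.2 ∈ Set.Ioo (0 : ℝ) 1
  · obtain ⟨h4, h5⟩ := hp ht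
    have h6 := norm_sanovCover_gt (le_max_left _ _) hb
      (halfPlaneLerp_mem_horoball (by positivity) h4 h5 (Set.projIcc 0 1 zero_le_one p.1))
    rw [liftedHomotopy_of_mem ht]
    exact hSU (hM _ (by linarith [le_max_right 1 (M + 1)]))
  · rw [liftedHomotopy_of_notMem ht]
    exact mem_of_mem_nhds hU'

theorem continuousAt_liftedHomotopy (hφ : ContinuousOn φ (Set.Ioo 0 1))
    (hψ : ContinuousOn ψ (Set.Ioo 0 1)) (ht : t ∈ Set.Ioo (0 : ℝ) 1) :
    ContinuousAt (fun p : ℝ × ℝ => liftedHomotopy v w φ ψ p.1 p.2) (s, t) := by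
  have h1 : ∀ᶠ p : ℝ × ℝ in 𝓝 (s, t), p.2 ∈ Set.Ioo (0 : ℝ) 1 :=
    (continuous_snd.tendsto (s, t)).eventually (isOpen_Ioo.mem_nhds ht)
  have hφt : Filter.Tendsto (fun p : ℝ × ℝ => φ p.2) (𝓝 (s, t)) (𝓝 (φ t)) :=
    (hφ.continuousAt (isOpen_Ioo.mem_nhds ht)).tendsto.comp (continuous_snd.tendsto (s, t))
  have hψt : Filter.Tendsto (fun p : ℝ × ℝ => ψ p.2) (𝓝 (s, t)) (𝓝 (ψ t)) :=
    (hψ.continuousAt (isOpen_Ioo.mem_nhds ht)).tendsto.comp (continuous_snd.tendsto (s, t))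
  have ha : Filter.Tendsto (fun p : ℝ × ℝ => Set.projIcc (0 : ℝ) 1 zero_le_one p.1) (𝓝 (s, t))
      (𝓝 (Set.projIcc 0 1 zero_le_one s)) :=
    (continuous_projIcc.comp continuous_fst).tendsto (s, t)
  have h2 := (continuous_halfPlaneLerp.tendsto _).comp
    (ha.prodMk_nhds (hφt.prodMk_nhds hψt))
  have h3 := ((continuous_obstacleChartInv_sanovCover v w).tendsto _).comp h2
  have h4 : liftedHomotopy v w φ ψ s t = _ := liftedHomotopy_of_mem ht
  rw [ContinuousAt]
  rw [h4]
  refine h3.congr' ?_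
  filter_upwards [h1] with p hp
  exact (liftedHomotopy_of_mem hp).symm

theorem liftedHomotopy_zero (ht : t ∈ Set.Ioo (0 : ℝ) 1) :
    liftedHomotopy v w φ ψ 0 t = obstacleChartInv v w (sanovCover (φ t)) := by
  rw [liftedHomotopy_of_mem ht, Set.projIcc_left]
  exact congrArg (fun u : ℍ => obstacleChartInv v w (sanovCover u)) (halfPlaneLerp_zero _ _)

theorem liftedHomotopy_one (ht : t ∈ Set.Ioo (0 : ℝ) 1) :
    liftedHomotopy v w φ ψ 1 t = obstacleChartInv v w (sanovCover (ψ t)) := by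
  rw [liftedHomotopy_of_mem ht, Set.projIcc_right]
  exact congrArg (fun u : ℍ => obstacleChartInv v w (sanovCover u)) (halfPlaneLerp_one _ _)

end LiftedHomotopy

theorem eq_zero_or_eq_one_of_notMem_Ioo {t : ℝ} (ht : t ∈ Set.Icc (0 : ℝ) 1)
    (h : t ∉ Set.Ioo (0 : ℝ) 1) : t = 0 ∨ t = 1 := by
  by_contra! h1
  exact h ⟨ht.1.lt_of_ne h1.1.symm, ht.2.lt_of_ne h1.2⟩

/-- Loops whose lifts to the upper half plane end at the same cusp are homotopic. -/
theorem loopHomotopic_of_cuspPath {v w : ℝ × ℝ} (hwv : w ≠ v) {f g : ℝ → ℝ × ℝ}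
    (hf : IsLoop {v, w} v f) (hg : IsLoop {v, w} v g) {φ ψ : ℝ → ℍ} {c d : SL(2, ℤ)}
    (hc : c ∈ sanov) (hd : d ∈ sanov)
    (hφ : CuspPath φ (c 0 0, c 1 0) (d 0 0, d 1 0)) (hψ : CuspPath ψ (c 0 0, c 1 0) (d 0 0, d 1 0))
    (hfφ : ∀ t ∈ Set.Ioo (0 : ℝ) 1, f t = obstacleChartInv v w (sanovCover (φ t)))
    (hgψ : ∀ t ∈ Set.Ioo (0 : ℝ) 1, g t = obstacleChartInv v w (sanovCover (ψ t))) :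
    LoopHomotopic {v, w} v f g := by
  refine ⟨liftedHomotopy v w φ ψ, ?_, ?_, ?_, ?_⟩
  · rintro ⟨s, t⟩ ⟨-, ht⟩
    apply ContinuousAt.continuousWithinAt
    by_cases h : t ∈ Set.Ioo (0 : ℝ) 1
    · exact continuousAt_liftedHomotopy hφ.continuousOn hψ.continuousOn h
    · rcases eq_zero_or_eq_one_of_notMem_Ioo ht h with rfl | rfl
      · refine continuousAt_liftedHomotopy_end hc h fun R => ?_
        rw [nhdsWithin_Ioo_eq_nhdsGT one_pos]
        exact (hφ.start R).and (hψ.start R)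
      · refine continuousAt_liftedHomotopy_end hd h fun R => ?_
        rw [nhdsWithin_Ioo_eq_nhdsLT one_pos]
        exact (hφ.finish R).and (hψ.finish R)
  · intro t ht
    by_cases h : t ∈ Set.Ioo (0 : ℝ) 1
    · rw [liftedHomotopy_zero h, liftedHomotopy_one h, hfφ t h, hgψ t h]
      exact ⟨rfl, rfl⟩
    · rw [liftedHomotopy_of_notMem h, liftedHomotopy_of_notMem h]
      rcases eq_zero_or_eq_one_of_notMem_Ioo ht h with rfl | rfl
      · exact ⟨hf.2.1.symm, hg.2.1.symm⟩
      · exact ⟨hf.2.2.1.symm, hg.2.2.1.symm⟩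
  · exact fun s _ => ⟨liftedHomotopy_of_notMem (by simp), liftedHomotopy_of_notMem (by simp)⟩
  · intro s _ t ht
    rw [liftedHomotopy_of_mem ht]
    generalize sanovCover _ = z
    simpa using obstacleChartInv_ne hwv z.2.1 z.2.2

theorem not_linked_one (v w : ℤ × ℤ) : ¬ Linked v w (cuspSmul 1 v) (cuspSmul 1 w) := by
  have h : ∀ x : ℤ × ℤ, cuspSmul 1 x = x := fun x => by
    simp [cuspSmul]
  simp [h, Linked, cross, mul_comm]

/-- Group elements whose translates of the end cusps are linked give distinct
self-intersections. -/
theorem card_le_of_linked {v w : ℝ × ℝ} {f : ℝ → ℝ × ℝ} {φ : ℝ → ℍ} {c : ℤ × ℤ}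
    (hφ : CuspPath φ (1, 0) c)
    (hf : ∀ t ∈ Set.Ioo (0 : ℝ) 1, f t = obstacleChartInv v w (sanovCover (φ t)))
    (hfin : (SelfIntersections f).Finite) (S : Finset SL(2, ℤ)) (hS : ∀ g ∈ S, g ∈ sanov)
    (hl : ∀ g ∈ S, Linked (1, 0) c (cuspSmul g (1, 0)) (cuspSmul g c)) :
    S.card ≤ 2 * (SelfIntersections f).ncard := by
  have h1 : ∀ g : S, ∃ s ∈ Set.Ioo (0 : ℝ) 1, ∃ t ∈ Set.Ioo (0 : ℝ) 1,
      φ s = g.1 • φ t := fun g =>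
    hφ.exists_eq_of_linked (hφ.smul g.1) (hl g.1 g.2)
  choose s hs t ht hst using h1
  have hne : ∀ g, s g ≠ t g := by
    intro g h
    have h2 := hst g
    rw [h] at h2
    have h3 := sanov_free (hS g.1 g.2) h2.symm
    exact not_linked_one _ _ (h3 ▸ hl g.1 g.2)
  have hfst : ∀ g, f (s g) = f (t g) := fun g => by
    rw [hf _ (hs g), hf _ (ht g), hst g, sanovCover_smul (hS g.1 g.2)]
  have hinj : Function.Injective fun g : S => (s g, t g) := by
    intro g h hgh
    obtain ⟨e1, e2⟩ := Prod.ext_iff.1 hgh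
    simp only at e1 e2
    have h2 := hst g
    rw [e1, e2, hst h] at h2
    have h3 : (g.1⁻¹ * h.1) • φ (t h) = φ (t h) := by
      rw [mul_smul, h2, inv_smul_smul]
    exact Subtype.ext (inv_mul_eq_one.1
      (sanov_free (mul_mem (inv_mem (hS g.1 g.2)) (hS h.1 h.2)) h3))
  have hT : (SelfIntersections f ∪ Prod.swap '' SelfIntersections f).Finite :=
    hfin.union (hfin.image _)
  have h4 : Set.range (fun g : S => (s g, t g)) ⊆
      SelfIntersections f ∪ Prod.swap '' SelfIntersections f := by
    rintro _ ⟨g, rfl⟩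
    rcases lt_or_gt_of_ne (hne g) with h | h
    · exact Or.inl ⟨hs g, ht g, h, hfst g⟩
    · exact Or.inr ⟨(t g, s g), ⟨ht g, hs g, h, (hfst g).symm⟩, rfl⟩
  calc S.card = (Set.range (fun g : S => (s g, t g))).ncard := by
        rw [Set.ncard_range_of_injective hinj]; simp
    _ ≤ _ := Set.ncard_le_ncard h4 hT
    _ ≤ _ := Set.ncard_union_le _ _
    _ = _ := by rw [Set.ncard_image_of_injective _ Prod.swap_injective, two_mul]

/-- The remainders `P`, partial quotients `n`, convergent denominators `C` and Bézout coefficients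
`A`, `B` of the Euclidean algorithm for `p / q`, which stops after `r` steps. -/
structure EuclidData (p q : ℤ) where
  P : ℕ → ℕ
  n : ℕ → ℕ
  C : ℕ → ℕ
  A : ℕ → ℤ
  B : ℕ → ℤ
  r : ℕ
  P_rec : ∀ i, P i = n i * P (i + 1) + P (i + 2)
  C_rec : ∀ i, C (i + 2) = C i + n i * C (i + 1)
  A_rec : ∀ i, A (i + 2) = A i - n i * A (i + 1)
  B_rec : ∀ i, B (i + 2) = B i - n i * B (i + 1)
  P_lt : ∀ i ≤ r, P (i + 1) < P i
  P_last : P r = 1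
  P_zero : (P 0 : ℤ) = q
  P_one : (P 1 : ℤ) = p + B 1 * q
  A_zero : A 0 = 0
  A_one : A 1 = 1
  B_zero : B 0 = 1
  C_zero : C 0 = 0
  C_one : C 1 = 1

/-- The pairs of successive remainders in the Euclidean algorithm. -/
def euclidPair (a b : ℕ) : ℕ → ℕ × ℕ
  | 0 => (a, b)
  | i + 1 => ((euclidPair a b i).2, (euclidPair a b i).1 % (euclidPair a b i).2)

theorem euclidPair_succ (a b i : ℕ) : euclidPair a b (i + 1) = euclidPair b (a % b) i := by
  induction i with
  | zero => rfl
  | succ i ih => rw [euclidPair, ih]; rfl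

theorem exists_euclidPair_last : ∀ b a : ℕ, a.Coprime b → b < a →
    ∃ r, (euclidPair a b r).1 = 1 ∧ ∀ i ≤ r, (euclidPair a b i).2 < (euclidPair a b i).1 := by
  intro b
  induction b using Nat.strong_induction_on with
  | _ b ih =>
    intro a hab hlt
    rcases Nat.eq_zero_or_pos b with rfl | hb
    · refine ⟨0, (Nat.coprime_zero_right a).1 hab, fun i hi => ?_⟩
      rw [Nat.le_zero.1 hi]
      exact hlt
    · obtain ⟨r, h1, h2⟩ := ih (a % b) (Nat.mod_lt _ hb) b
        (by rw [Nat.Coprime, Nat.gcd_comm, ← Nat.gcd_rec, Nat.gcd_comm]; exact hab)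
        (Nat.mod_lt _ hb)
      refine ⟨r + 1, by rwa [euclidPair_succ], fun i hi => ?_⟩
      cases i with
      | zero => exact hlt
      | succ i => rw [euclidPair_succ]; exact h2 i (by omega)

/-- A sequence given by a two-term linear recurrence. -/
def linRec {R : Type*} (f : ℕ → R → R → R) (x y : R) : ℕ → R
  | 0 => x
  | 1 => y
  | i + 2 => f i (linRec f x y i) (linRec f x y (i + 1))

theorem nonempty_euclidData {p q : ℤ} (hpq : IsCoprime p q) (hq : 0 < q) :
    Nonempty (EuclidData p q) := by
  obtain ⟨a, ha⟩ := Int.eq_ofNat_of_zero_le hq.le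
  obtain ⟨b, hb⟩ := Int.eq_ofNat_of_zero_le (Int.emod_nonneg p hq.ne')
  have hlt : b < a := by
    have := Int.emod_lt_of_pos p hq
    omega
  have hab : a.Coprime b := by
    rw [← Nat.isCoprime_iff_coprime, ← ha, ← hb, Int.emod_def, sub_eq_add_neg, ← mul_neg]
    exact (IsCoprime.add_mul_left_right_iff).2 hpq.symm
  obtain ⟨r, h1, h2⟩ := exists_euclidPair_last b a hab hlt
  let n : ℕ → ℕ := fun i => (euclidPair a b i).1 / (euclidPair a b i).2
  refine ⟨⟨fun i => (euclidPair a b i).1, n,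
    linRec (fun i x y => x + n i * y) 0 1, linRec (fun i x y => x - n i * y) 0 1,
    linRec (fun i x y => x - n i * y) 1 (-(p / q)), r, fun i => ?_, fun i => rfl, fun i => rfl,
    fun i => rfl, fun i hi => h2 i hi, h1, ha.symm, ?_, rfl, rfl, rfl, rfl, rfl⟩⟩
  · exact (Nat.div_add_mod' _ _).symm
  · have : (euclidPair a b 1).1 = b := rfl
    rw [this, ← hb, Int.emod_def]
    simp only [linRec]
    ring

namespace EuclidData

variable {p q : ℤ} (e : EuclidData p q)

theorem P_succ_pos {i : ℕ} (hi : i < e.r) : 0 < e.P (i + 1) :=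
  (Nat.zero_le _).trans_lt (e.P_lt (i + 1) hi)

theorem n_pos {i : ℕ} (hi : i < e.r) : 0 < e.n i := by
  by_contra h
  have h1 := e.P_rec i
  have h2 := e.P_lt i hi.le
  have h3 : e.P (i + 2) < e.P (i + 1) := e.P_lt (i + 1) hi
  rw [Nat.eq_zero_of_not_pos h, zero_mul] at h1
  omega

theorem P_strictAntiOn {i j : ℕ} (hij : i < j) (hj : j ≤ e.r + 1) : e.P j < e.P i := by
  induction j with
  | zero => omega
  | succ j ih =>
    have h1 := e.P_lt j (by omega)
    rcases (Nat.lt_succ_iff.1 hij).eq_or_lt with rfl | h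
    · exact h1
    · exact h1.trans (ih h (by omega))

theorem P_injOn {i j : ℕ} (hi : i ≤ e.r + 1) (hj : j ≤ e.r + 1) (h : e.P i = e.P j) : i = j := by
  rcases lt_trichotomy i j with hij | hij | hij
  · exact absurd h (e.P_strictAntiOn hij hj).ne'
  · exact hij
  · exact absurd h (e.P_strictAntiOn hij hi).ne

theorem P_eq (i : ℕ) : (e.P i : ℤ) = e.A i * p + e.B i * q := by
  have : (e.P i : ℤ) = e.A i * p + e.B i * q ∧
      (e.P (i + 1) : ℤ) = e.A (i + 1) * p + e.B (i + 1) * q := by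
    induction i with
    | zero =>
      refine ⟨?_, ?_⟩
      · rw [e.P_zero, e.A_zero, e.B_zero]; ring
      · rw [e.P_one, e.A_one]; ring
    | succ i ih =>
      refine ⟨ih.2, ?_⟩
      have h := e.P_rec i
      have h' : (e.P i : ℤ) = e.n i * e.P (i + 1) + e.P (i + 2) := by exact_mod_cast h
      rw [e.A_rec, e.B_rec]
      linear_combination ih.1 - (e.n i : ℤ) * ih.2 - h'
  exact this.1

theorem A_eq (i : ℕ) : e.A i = -(-1) ^ i * e.C i := by
  have : e.A i = -(-1) ^ i * e.C i ∧ e.A (i + 1) = (-1) ^ i * e.C (i + 1) := by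
    induction i with
    | zero => simp [e.A_zero, e.C_zero, e.A_one, e.C_one]
    | succ i ih =>
      refine ⟨by rw [ih.2]; ring, ?_⟩
      have h' : (e.C (i + 2) : ℤ) = e.C i + e.n i * e.C (i + 1) := by exact_mod_cast e.C_rec i
      rw [e.A_rec, h', ih.1, ih.2]
      ring
  exact this.1

theorem A_mul_B_sub (i : ℕ) : e.A i * e.B (i + 1) - e.A (i + 1) * e.B i = -(-1) ^ i := by
  induction i with
  | zero => simp [e.A_zero, e.A_one, e.B_zero]
  | succ i ih =>
    rw [e.A_rec, e.B_rec, pow_succ]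
    linear_combination -ih

theorem C_succ_pos {i : ℕ} (hi : i ≤ e.r) : 0 < e.C (i + 1) := by
  induction i with
  | zero => simp [e.C_one]
  | succ i ih =>
    rw [e.C_rec]
    have := Nat.mul_pos (e.n_pos hi) (ih (by omega))
    omega

theorem C_le_succ {i : ℕ} (hi : i ≤ e.r) : e.C i ≤ e.C (i + 1) := by
  cases i with
  | zero => simp [e.C_zero]
  | succ i =>
    rw [e.C_rec]
    have := Nat.le_mul_of_pos_left (e.C (i + 1)) (e.n_pos hi)
    omega

theorem C_lt_succ {i : ℕ} (h2 : 2 ≤ i) (hi : i ≤ e.r) : e.C i < e.C (i + 1) := by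
  obtain ⟨i, rfl⟩ := Nat.exists_eq_add_of_le' h2
  rw [e.C_rec (i + 1)]
  have h3 := Nat.le_mul_of_pos_left (e.C (i + 2)) (e.n_pos (i := i + 1) hi)
  have := e.C_succ_pos (i := i) (by omega)
  have h4 : i + 1 + 1 = i + 2 := rfl
  rw [h4]
  omega

/-- The `i`-th coordinate of a vector; coordinates `i` and `i + 1` form the `i`-th frame. -/
def coord (i : ℕ) (v : ℤ × ℤ) : ℤ := e.A i * v.1 + e.B i * v.2

theorem coord_rec (i : ℕ) (v : ℤ × ℤ) :
    e.coord (i + 2) v = e.coord i v - e.n i * e.coord (i + 1) v := by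
  simp only [coord, e.A_rec, e.B_rec]
  ring

theorem coord_mul_neg {i k : ℕ} {v : ℤ × ℤ} (hik : i ≤ k)
    (h : e.coord i v * e.coord (i + 1) v < 0) : e.coord k v * e.coord (k + 1) v < 0 := by
  induction k, hik using Nat.le_induction with
  | base => exact h
  | succ k _ ih =>
    rw [e.coord_rec]
    have := mul_nonneg (Int.natCast_nonneg (e.n k)) (mul_self_nonneg (e.coord (k + 1) v))
    nlinarith

end EuclidData

/-- Integer matrices which agree modulo `2` and have the same determinant `±1` differ by an element
of the Sanov group, up to sign. -/
theorem exists_mem_sanov_mul_eq {H K E : Matrix (Fin 2) (Fin 2) ℤ} (hH : H.det * H.det = 1)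
    (hdet : K.det = H.det) (hE : K = H + (2 : ℤ) • E) :
    ∃ g ∈ sanov, ∃ ε : ℤ, ε * ε = 1 ∧ H * (g : Matrix (Fin 2) (Fin 2) ℤ) = ε • K := by
  obtain ⟨F, hF⟩ : ∃ F, F = H.det • (H.adjugate * E) := ⟨_, rfl⟩
  have hHG : H * (1 + (2 : ℤ) • F) = K := by
    rw [hF, mul_add, mul_one, Matrix.mul_smul, Matrix.mul_smul, ← Matrix.mul_assoc,
      Matrix.mul_adjugate, Matrix.smul_mul, Matrix.one_mul, smul_smul H.det, hH, one_smul, hE]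
  have hG : (1 + (2 : ℤ) • F).det = 1 := by
    have h := congrArg Matrix.det hHG
    rw [Matrix.det_mul, hdet] at h
    have h0 : H.det ≠ 0 := fun h0 => by simp [h0] at hH
    exact mul_left_cancel₀ h0 (h.trans (mul_one _).symm)
  have hent : ∀ i j, (1 + (2 : ℤ) • F) i j = (1 : Matrix (Fin 2) (Fin 2) ℤ) i j + 2 * F i j :=
    fun i j => by rw [Matrix.add_apply, Matrix.smul_apply, smul_eq_mul]
  have h00 := hent 0 0
  have h01 := hent 0 1
  have h10 := hent 1 0
  rw [Matrix.one_apply_eq] at h00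
  rw [Matrix.one_apply_ne (by decide)] at h01 h10
  clear hent
  generalize 1 + (2 : ℤ) • F = G at *
  obtain ⟨g, rfl⟩ : ∃ g : SL(2, ℤ), (g : Matrix (Fin 2) (Fin 2) ℤ) = G := ⟨⟨G, hG⟩, rfl⟩
  by_cases h4 : g 0 0 % 4 = 1
  · refine ⟨g, mem_sanov.2 ⟨h4, by omega, by omega⟩, 1, one_mul 1, by rw [hHG, one_smul]⟩
  · refine ⟨-g, mem_sanov.2 ?_, -1, by norm_num, ?_⟩
    · have e : ∀ i j, (-g) i j = -(g i j) := fun i j => by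
        simp
      rw [e, e, e]
      omega
    · rw [Matrix.SpecialLinearGroup.coe_neg, Matrix.mul_neg, hHG, neg_smul, one_smul]

namespace EuclidData

variable {p q : ℤ} (e : EuclidData p q)

/-- The matrix `(α β; γ δ)` carries frame `j` to frame `i` modulo the Sanov group. -/
structure Carries (i j : ℕ) (α β γ δ : ℤ) : Prop where
  det : (α * δ - β * γ) * (-1) ^ j = (-1) ^ i
  A₀ : 2 ∣ α * e.A j + β * e.A (j + 1) - e.A i
  A₁ : 2 ∣ γ * e.A j + δ * e.A (j + 1) - e.A (i + 1)
  B₀ : 2 ∣ α * e.B j + β * e.B (j + 1) - e.B i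
  B₁ : 2 ∣ γ * e.B j + δ * e.B (j + 1) - e.B (i + 1)

/-- The element `g` acts as `±(α β; γ δ)` from frame `j` to frame `i`. -/
def ActsAs (g : SL(2, ℤ)) (i j : ℕ) (α β γ δ : ℤ) : Prop :=
  ∃ σ τ : ℤ, σ * σ = 1 ∧ τ * τ = 1 ∧
    e.coord i (cuspSmul g (1, 0)) = σ * (-(α * e.C j) + β * e.C (j + 1)) ∧
    e.coord (i + 1) (cuspSmul g (1, 0)) = σ * (-(γ * e.C j) + δ * e.C (j + 1)) ∧
    e.coord i (cuspSmul g (p, q)) = τ * (α * e.P j + β * e.P (j + 1)) ∧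
    e.coord (i + 1) (cuspSmul g (p, q)) = τ * (γ * e.P j + δ * e.P (j + 1))

theorem neg_one_pow_mul_self (i : ℕ) : (-1 : ℤ) ^ i * (-1) ^ i = 1 := by
  rw [← mul_pow]; simp

theorem exists_actsAs {i j : ℕ} {α β γ δ : ℤ} (h : e.Carries i j α β γ δ) :
    ∃ g ∈ sanov, e.ActsAs g i j α β γ δ := by
  obtain ⟨a0, ha0⟩ := h.A₀
  obtain ⟨a1, ha1⟩ := h.A₁
  obtain ⟨b0, hb0⟩ := h.B₀
  obtain ⟨b1, hb1⟩ := h.B₁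
  have hi := e.A_mul_B_sub i
  have hj := e.A_mul_B_sub j
  obtain ⟨g, hg, ε, hε, hgK⟩ := exists_mem_sanov_mul_eq
    (H := !![e.A i, e.B i; e.A (i + 1), e.B (i + 1)])
    (K := !![α * e.A j + β * e.A (j + 1), α * e.B j + β * e.B (j + 1);
      γ * e.A j + δ * e.A (j + 1), γ * e.B j + δ * e.B (j + 1)])
    (E := !![a0, b0; a1, b1]) (by
      rw [Matrix.det_fin_two_of, mul_comm (e.B i), hi, neg_mul_neg, neg_one_pow_mul_self]) (by
      rw [Matrix.det_fin_two_of, Matrix.det_fin_two_of]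
      linear_combination (α * δ - β * γ) * hj - hi - h.det) (by
      ext x y
      fin_cases x <;> fin_cases y <;> simp <;> linarith)
  have k00 := congrFun (congrFun hgK 0) 0
  have k01 := congrFun (congrFun hgK 0) 1
  have k10 := congrFun (congrFun hgK 1) 0
  have k11 := congrFun (congrFun hgK 1) 1
  simp [Matrix.mul_apply, Fin.sum_univ_two] at k00 k01 k10 k11
  refine ⟨g, hg, ε * (-1) ^ j, ε, ?_, hε, ?_, ?_, ?_, ?_⟩
  · linear_combination hε + ε * ε * neg_one_pow_mul_self j
  · rw [cuspSmul_infinity]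
    simp only [coord]
    rw [k00, e.A_eq, e.A_eq, pow_succ]
    ring
  · rw [cuspSmul_infinity]
    simp only [coord]
    rw [k10, e.A_eq, e.A_eq, pow_succ]
    ring
  · simp only [coord, cuspSmul]
    rw [e.P_eq, e.P_eq]
    linear_combination p * k00 + q * k01
  · simp only [coord, cuspSmul]
    rw [e.P_eq, e.P_eq]
    linear_combination p * k10 + q * k11

theorem cross_coord (i : ℕ) (v w : ℤ × ℤ) :
    cross (e.coord i v, e.coord (i + 1) v) (e.coord i w, e.coord (i + 1) w) =
      -(-1) ^ i * cross v w := by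
  simp only [cross, coord]
  linear_combination (v.1 * w.2 - v.2 * w.1) * e.A_mul_B_sub i

theorem linked_of_actsAs {g : SL(2, ℤ)} {i j : ℕ} {α β γ δ : ℤ} (h : e.ActsAs g i j α β γ δ)
    (hl : Linked (-(e.C i : ℤ), (e.C (i + 1) : ℤ)) (e.P i, e.P (i + 1))
      (-(α * e.C j) + β * e.C (j + 1), -(γ * e.C j) + δ * e.C (j + 1))
      (α * e.P j + β * e.P (j + 1), γ * e.P j + δ * e.P (j + 1))) :
    Linked (1, 0) (p, q) (cuspSmul g (1, 0)) (cuspSmul g (p, q)) := by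
  obtain ⟨σ, τ, hσ, hτ, h1, h2, h3, h4⟩ := h
  have hs := neg_one_pow_mul_self i
  have e0 : ∀ k, e.coord k (1, 0) = e.A k := fun k => by simp [coord]
  have e1 : ∀ k, e.coord k (p, q) = e.P k := fun k => (e.P_eq k).symm
  have c1 := e.cross_coord i (1, 0) (cuspSmul g (1, 0))
  have c2 := e.cross_coord i (p, q) (cuspSmul g (1, 0))
  have c3 := e.cross_coord i (1, 0) (cuspSmul g (p, q))
  have c4 := e.cross_coord i (p, q) (cuspSmul g (p, q))
  rw [e0, e0, e.A_eq, e.A_eq, pow_succ] at c1 c3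
  rw [e1, e1] at c2 c4
  rw [h1, h2] at c1 c2
  rw [h3, h4] at c3 c4
  unfold Linked at hl ⊢
  generalize cross (1, 0) (cuspSmul g (1, 0)) = x1 at *
  generalize cross (p, q) (cuspSmul g (1, 0)) = x2 at *
  generalize cross (1, 0) (cuspSmul g (p, q)) = x3 at *
  generalize cross (p, q) (cuspSmul g (p, q)) = x4 at *
  simp only [cross] at hl c1 c2 c3 c4
  generalize (-1 : ℤ) ^ i = s at *
  generalize -(α * e.C j : ℤ) + β * e.C (j + 1) = X1 at *
  generalize -(γ * e.C j : ℤ) + δ * e.C (j + 1) = X2 at *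
  generalize (α * e.P j : ℤ) + β * e.P (j + 1) = Y1 at *
  generalize (γ * e.P j : ℤ) + δ * e.P (j + 1) = Y2 at *
  have d1 : x1 = -σ * (-(e.C i : ℤ) * X2 - e.C (i + 1) * X1) := by
    linear_combination s * c1 - x1 * hs - σ * (-(e.C i : ℤ) * X2 - e.C (i + 1) * X1) * hs
  have d2 : x2 = -s * σ * (e.P i * X2 - e.P (i + 1) * X1) := by
    linear_combination s * c2 - x2 * hs
  have d3 : x3 = -τ * (-(e.C i : ℤ) * Y2 - e.C (i + 1) * Y1) := by
    linear_combination s * c3 - x3 * hs - τ * (-(e.C i : ℤ) * Y2 - e.C (i + 1) * Y1) * hs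
  have d4 : x4 = -s * τ * (e.P i * Y2 - e.P (i + 1) * Y1) := by
    linear_combination s * c4 - x4 * hs
  convert hl using 1
  rw [d1, d2, d3, d4]
  generalize (-(e.C i : ℤ) * X2 - e.C (i + 1) * X1) = z1
  generalize (e.P i * X2 - e.P (i + 1) * X1 : ℤ) = z2
  generalize (-(e.C i : ℤ) * Y2 - e.C (i + 1) * Y1) = z3
  generalize (e.P i * Y2 - e.P (i + 1) * Y1 : ℤ) = z4
  have : (σ * σ) * (τ * τ) * (s * s) = 1 := by rw [hσ, hτ, hs]; rfl
  linear_combination z1 * z2 * z3 * z4 * this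

/-- The number of elements of the Sanov group moving the geodesic from `∞` to `p / q` to a linked one
is at most `N`. -/
def LinkedBound (p q : ℤ) (N : ℕ) : Prop :=
  ∀ S : Finset SL(2, ℤ), (∀ g ∈ S, g ∈ sanov) →
    (∀ g ∈ S, Linked (1, 0) (p, q) (cuspSmul g (1, 0)) (cuspSmul g (p, q))) → S.card ≤ N

theorem LinkedBound.card_le {ι : Type*} {N : ℕ} (hN : LinkedBound p q N) (T : Finset ι)
    (R : ι → SL(2, ℤ) → Prop)
    (hex : ∀ x ∈ T, ∃ g ∈ sanov,
      Linked (1, 0) (p, q) (cuspSmul g (1, 0)) (cuspSmul g (p, q)) ∧ R x g)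
    (hinj : ∀ x ∈ T, ∀ y ∈ T, ∀ g, R x g → R y g → x = y) : T.card ≤ N := by
  classical
  choose! G hG hl hR using hex
  rw [← Finset.card_image_of_injOn (f := G) (s := T) fun x hx y hy hxy =>
    hinj x hx y hy (G x) (hR x hx) (hxy ▸ hR y hy)]
  exact hN _ (Finset.forall_mem_image.2 hG) (Finset.forall_mem_image.2 hl)

/-- The parity of the index of a frame together with its matrix modulo `2`. -/
def frameClass (i : ℕ) : ZMod 2 × ZMod 2 × ZMod 2 × ZMod 2 × ZMod 2 :=
  (i, e.A i, e.A (i + 1), e.B i, e.B (i + 1))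

theorem neg_one_pow_congr {i j : ℕ} (h : i % 2 = j % 2) : (-1 : ℤ) ^ i = (-1) ^ j := by
  rw [neg_one_pow_eq_pow_mod_two, h, ← neg_one_pow_eq_pow_mod_two]

theorem carries_translate {i j : ℕ} (h : e.frameClass i = e.frameClass j) (x : ℤ) :
    e.Carries i j 1 (2 * x) 0 1 := by
  simp only [frameClass, Prod.mk.injEq, ZMod.intCast_eq_intCast_iff_dvd_sub,
    ZMod.natCast_eq_natCast_iff'] at h
  obtain ⟨h0, ⟨a₀, h1⟩, ⟨a₁, h2⟩, ⟨b₀, h3⟩, ⟨b₁, h4⟩⟩ := h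
  push_cast at h1 h2 h3 h4
  refine ⟨?_, ⟨a₀ + x * e.A (j + 1), ?_⟩, ⟨a₁, ?_⟩, ⟨b₀ + x * e.B (j + 1), ?_⟩, ⟨b₁, ?_⟩⟩
  · rw [neg_one_pow_congr h0]; ring
  · linear_combination h1
  · linear_combination h2
  · linear_combination h3
  · linear_combination h4

section Translate

variable {g : SL(2, ℤ)} {i j : ℕ} {s : ℤ}

theorem linked_of_actsAs_translate (hi : i < e.r) (hj : j < e.r) (hs : 2 ≤ s) (hsi : s < e.n i)
    (hsij : (e.n i : ℤ) + 1 ≤ e.n j + s) (h : e.ActsAs g i j 1 s 0 1) :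
    Linked (1, 0) (p, q) (cuspSmul g (1, 0)) (cuspSmul g (p, q)) := by
  refine e.linked_of_actsAs h ?_
  have a1 : (0 : ℤ) < e.C (i + 1) := by exact_mod_cast e.C_succ_pos hi.le
  have a2 : (0 : ℤ) < e.C (j + 1) := by exact_mod_cast e.C_succ_pos hj.le
  have a3 : (e.C j : ℤ) ≤ e.C (j + 1) := by exact_mod_cast e.C_le_succ hj.le
  have b1 : (0 : ℤ) < e.P (i + 1) := by exact_mod_cast e.P_succ_pos hi
  have b2 : (0 : ℤ) < e.P (j + 1) := by exact_mod_cast e.P_succ_pos hj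
  have b3 : (e.P (i + 2) : ℤ) < e.P (i + 1) := by exact_mod_cast e.P_lt (i + 1) hi
  have c1 : (e.P i : ℤ) = e.n i * e.P (i + 1) + e.P (i + 2) := by exact_mod_cast e.P_rec i
  have c2 : (e.P j : ℤ) = e.n j * e.P (j + 1) + e.P (j + 2) := by exact_mod_cast e.P_rec j
  have d1 : (0 : ℤ) ≤ e.C i := Int.natCast_nonneg _
  have d2 : (0 : ℤ) ≤ e.C j := Int.natCast_nonneg _
  have d3 : (0 : ℤ) ≤ e.P (i + 2) := Int.natCast_nonneg _
  have d4 : (0 : ℤ) ≤ e.P (j + 2) := Int.natCast_nonneg _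
  have d5 : (0 : ℤ) ≤ e.n j := Int.natCast_nonneg _
  unfold Linked cross
  simp only [zero_mul, one_mul, neg_zero, zero_add]
  rw [c1, c2]
  generalize (e.C (i + 1) : ℤ) = C1 at *
  generalize (e.C i : ℤ) = D1 at *
  generalize (e.C (j + 1) : ℤ) = C2 at *
  generalize (e.C j : ℤ) = D2 at *
  generalize (e.P (i + 1) : ℤ) = Q1 at *
  generalize (e.P (i + 2) : ℤ) = R1 at *
  generalize (e.P (j + 1) : ℤ) = Q2 at *
  generalize (e.P (j + 2) : ℤ) = R2 at *
  generalize (e.n i : ℤ) = n1 at *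
  generalize (e.n j : ℤ) = n2 at *
  have k0 : 0 < -D2 + s * C2 := by nlinarith
  have k1 : -D1 * C2 - C1 * (-D2 + s * C2) < 0 := by nlinarith [mul_pos a1 k0, mul_nonneg d1 a2.le]
  have k2 : 0 < (n1 * Q1 + R1) * C2 - Q1 * (-D2 + s * C2) := by
    nlinarith [mul_pos (mul_pos b1 a2) (sub_pos.2 hsi), mul_nonneg d3 a2.le, mul_nonneg b1.le d2]
  have k3 : -D1 * Q2 - C1 * (n2 * Q2 + R2 + s * Q2) < 0 := by
    have : 0 < n2 * Q2 + R2 + s * Q2 := by nlinarith [mul_nonneg d5 b2.le]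
    nlinarith [mul_pos a1 this, mul_nonneg d1 b2.le]
  have k4 : (n1 * Q1 + R1) * Q2 - Q1 * (n2 * Q2 + R2 + s * Q2) < 0 := by
    nlinarith [mul_nonneg (mul_pos b1 b2).le (sub_nonneg.2 hsij), mul_pos (sub_pos.2 b3) b2,
      mul_nonneg b1.le d4]
  exact mul_neg_of_neg_of_pos (mul_neg_of_neg_of_pos k1 k2) (mul_pos_of_neg_of_neg k3 k4)

theorem coord_mul_pos_of_actsAs_translate (hj : j < e.r) (hs : 2 ≤ s)
    (h : e.ActsAs g i j 1 s 0 1) :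
    0 < e.coord i (cuspSmul g (1, 0)) * e.coord (i + 1) (cuspSmul g (1, 0)) := by
  obtain ⟨σ, τ, hσ, hτ, h1, h2, -, -⟩ := h
  have a2 : (0 : ℤ) < e.C (j + 1) := by exact_mod_cast e.C_succ_pos hj.le
  have a3 : (e.C j : ℤ) ≤ e.C (j + 1) := by exact_mod_cast e.C_le_succ hj.le
  have : e.coord i (cuspSmul g (1, 0)) * e.coord (i + 1) (cuspSmul g (1, 0)) =
      (-(e.C j) + s * e.C (j + 1)) * e.C (j + 1) := by
    rw [h1, h2]
    linear_combination (-(e.C j) + s * e.C (j + 1)) * e.C (j + 1) * hσ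
  rw [this]
  exact mul_pos (by nlinarith) a2

theorem coord_mul_neg_of_actsAs_translate {k : ℕ} (hj : j < e.r) (hsi : s < e.n i)
    (h : e.ActsAs g i j 1 s 0 1) (hk : i < k) :
    e.coord k (cuspSmul g (1, 0)) * e.coord (k + 1) (cuspSmul g (1, 0)) < 0 := by
  refine e.coord_mul_neg hk ?_
  obtain ⟨σ, τ, hσ, hτ, h1, h2, -, -⟩ := h
  have a2 : (0 : ℤ) < e.C (j + 1) := by exact_mod_cast e.C_succ_pos hj.le
  have : e.coord (i + 1) (cuspSmul g (1, 0)) * e.coord (i + 2) (cuspSmul g (1, 0)) =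
      (-(e.C j) + (s - e.n i) * e.C (j + 1)) * e.C (j + 1) := by
    rw [e.coord_rec, h1, h2]
    linear_combination (-(e.C j) + (s - e.n i) * e.C (j + 1)) * e.C (j + 1) * hσ
  rw [← Nat.succ_eq_add_one] at this
  have d2 : (0 : ℤ) ≤ e.C j := Int.natCast_nonneg _
  refine lt_of_eq_of_lt this (mul_neg_of_neg_of_pos ?_ a2)
  nlinarith

theorem eq_of_mul_self_eq_one {σ τ : ℤ} {x y : ℕ} (hσ : σ * σ = 1) (hτ : τ * τ = 1)
    (h : σ * x = τ * y) : x = y := by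
  have : (x : ℤ) * x = y * y := by
    linear_combination (σ * x + τ * y) * h - (x * x : ℤ) * hσ + (y * y : ℤ) * hτ
  exact Nat.mul_self_inj.1 (by exact_mod_cast this)

theorem eq_of_actsAs_translate {i' j' : ℕ} {s' : ℤ} (hj : j < e.r) (hs : 2 ≤ s)
    (hsi : s < e.n i) (h : e.ActsAs g i j 1 s 0 1) (hj' : j' < e.r) (hs' : 2 ≤ s')
    (hsi' : s' < e.n i') (h' : e.ActsAs g i' j' 1 s' 0 1) : i = i' ∧ j = j' ∧ s = s' := by
  have hii : i = i' := by
    rcases lt_trichotomy i i' with hlt | rfl | hlt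
    · exact absurd (e.coord_mul_neg_of_actsAs_translate hj hsi h hlt)
        (e.coord_mul_pos_of_actsAs_translate hj' hs' h').not_gt
    · rfl
    · exact absurd (e.coord_mul_neg_of_actsAs_translate hj' hsi' h' hlt)
        (e.coord_mul_pos_of_actsAs_translate hj hs h).not_gt
  subst hii
  obtain ⟨σ, τ, hσ, hτ, -, -, h3, h4⟩ := h
  obtain ⟨σ', τ', hσ', hτ', -, -, h3', h4'⟩ := h'
  have h5 : τ * (e.P (j + 1) : ℤ) = τ' * (e.P (j' + 1) : ℤ) := by
    linear_combination h4' - h4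
  have h6 := e.P_injOn (by omega) (by omega) (eq_of_mul_self_eq_one hτ hτ' h5)
  obtain rfl : j = j' := by omega
  have hP : (e.P (j + 1) : ℤ) ≠ 0 := by exact_mod_cast (e.P_succ_pos hj).ne'
  obtain rfl : τ = τ' := mul_right_cancel₀ hP h5
  have hτ0 : τ ≠ 0 := fun h0 => by simp [h0] at hτ
  refine ⟨rfl, rfl, ?_⟩
  rw [h3'] at h3
  have h7 := mul_left_cancel₀ hτ0 h3
  exact (mul_right_cancel₀ hP (by linarith)).symm

end Translate

/-- Half of the partial quotients, up to rounding. -/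
def halfQuot (i : ℕ) : ℕ := (e.n i - 1) / 2

theorem sum_min_halfQuot_le {N : ℕ} (hN : LinkedBound p q N) :
    ∑ x ∈ (Finset.range e.r ×ˢ Finset.range e.r).filter
      (fun x => e.frameClass x.1 = e.frameClass x.2), min (e.halfQuot x.1) (e.halfQuot x.2) ≤ N := by
  have h := hN.card_le (((Finset.range e.r ×ˢ Finset.range e.r).filter
      (fun x => e.frameClass x.1 = e.frameClass x.2)).sigma
      fun x => Finset.range (min (e.halfQuot x.1) (e.halfQuot x.2)))
    (fun x g => e.ActsAs g x.1.1 x.1.2 1 (2 * ((e.halfQuot x.1.1 : ℤ) - x.2)) 0 1) ?_ ?_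
  · rw [Finset.card_sigma] at h
    simpa using h
  · rintro ⟨⟨i, j⟩, y⟩ hx
    simp only [Finset.mem_sigma, Finset.mem_filter, Finset.mem_product, Finset.mem_range,
      lt_min_iff, halfQuot] at hx ⊢
    obtain ⟨⟨⟨hi, hj⟩, hc⟩, hy⟩ := hx
    obtain ⟨g, hg, hact⟩ := e.exists_actsAs (e.carries_translate hc (((e.n i - 1) / 2 : ℕ) - y))
    refine ⟨g, hg, e.linked_of_actsAs_translate hi hj ?_ ?_ ?_ hact, hact⟩ <;> omega
  · rintro ⟨⟨i, j⟩, y⟩ hx ⟨⟨i', j'⟩, y'⟩ hx' g hg hg'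
    simp only [Finset.mem_sigma, Finset.mem_filter, Finset.mem_product, Finset.mem_range,
      lt_min_iff, halfQuot] at hx hx' hg hg'
    obtain ⟨rfl, rfl, h⟩ := e.eq_of_actsAs_translate hx.1.1.2 (by omega) (by omega) hg
      hx'.1.1.2 (by omega) (by omega) hg'
    obtain rfl : y = y' := by omega
    rfl

end EuclidData

theorem ZMod.eq_zero_or_eq_one (x : ZMod 2) : x = 0 ∨ x = 1 := by
  revert x; decide

theorem eq_or_swap_of_add_eq {a₀ a₁ b₀ b₁ a₀' a₁' b₀' b₁' : ZMod 2} (ha : a₀ + a₁ = a₀' + a₁')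
    (hb : b₀ + b₁ = b₀' + b₁') (h : a₀ * b₁ - a₁ * b₀ = 1) (h' : a₀' * b₁' - a₁' * b₀' = 1) :
    (a₀ = a₀' ∧ a₁ = a₁' ∧ b₀ = b₀' ∧ b₁ = b₁') ∨
      (a₀ = a₁' ∧ a₁ = a₀' ∧ b₀ = b₁' ∧ b₁ = b₀') := by
  revert a₀ a₁ b₀ b₁ a₀' a₁' b₀' b₁'
  decide

namespace EuclidData

variable {p q : ℤ} (e : EuclidData p q)

/-- The sum of the rows of the matrix of a frame modulo `2`. -/
def rowSum (i : ℕ) : ZMod 2 × ZMod 2 := (e.A i + e.A (i + 1), e.B i + e.B (i + 1))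

theorem A_mul_B_sub_zmod (i : ℕ) :
    (e.A i : ZMod 2) * e.B (i + 1) - e.A (i + 1) * e.B i = 1 := by
  have h := congrArg (Int.cast : ℤ → ZMod 2) (e.A_mul_B_sub i)
  have h1 : (-1 : ZMod 2) = 1 := by decide
  push_cast at h
  rwa [h1, one_pow, h1] at h

theorem carries_swap {i j : ℕ} (hij : i % 2 ≠ j % 2) (h : e.rowSum i = e.rowSum j) :
    e.Carries i j 0 1 1 0 ∨ e.Carries i j (-1) 0 0 1 := by
  have hs : (-1 : ℤ) ^ i = -(-1) ^ j := by
    rw [neg_one_pow_congr (i := i) (j := j + 1) (by omega), pow_succ]; ring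
  obtain ⟨h1, h2⟩ := Prod.ext_iff.1 h
  rcases eq_or_swap_of_add_eq h1 h2 (e.A_mul_B_sub_zmod i) (e.A_mul_B_sub_zmod j) with h | h <;>
  simp only [ZMod.intCast_eq_intCast_iff_dvd_sub] at h <;>
  obtain ⟨⟨a₀, h1⟩, ⟨a₁, h2⟩, ⟨b₀, h3⟩, ⟨b₁, h4⟩⟩ := h <;>
  push_cast at h1 h2 h3 h4
  · refine Or.inr ⟨by rw [hs]; ring, ⟨a₀ - e.A j, ?_⟩, ⟨a₁, ?_⟩, ⟨b₀ - e.B j, ?_⟩, ⟨b₁, ?_⟩⟩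
    · linear_combination h1
    · linear_combination h2
    · linear_combination h3
    · linear_combination h4
  · refine Or.inl ⟨by rw [hs]; ring, ⟨a₀, ?_⟩, ⟨a₁, ?_⟩, ⟨b₀, ?_⟩, ⟨b₁, ?_⟩⟩
    · linear_combination h1
    · linear_combination h2
    · linear_combination h3
    · linear_combination h4

theorem rowSum_succ {i : ℕ} (h : (e.n i : ZMod 2) = 0) : e.rowSum (i + 1) = e.rowSum i := by
  simp only [rowSum, e.A_rec, e.B_rec]
  push_cast
  rw [h]
  ext <;> simp only <;> ring

theorem rowSum_add_three {i : ℕ} (h0 : (e.n i : ZMod 2) = 1) (h1 : (e.n (i + 1) : ZMod 2) = 1)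
    (h2 : (e.n (i + 2) : ZMod 2) = 1) : e.rowSum (i + 3) = e.rowSum i := by
  have hA2 := congrArg (Int.cast : ℤ → ZMod 2) (e.A_rec i)
  have hA3 := congrArg (Int.cast : ℤ → ZMod 2) (e.A_rec (i + 1))
  have hA4 := congrArg (Int.cast : ℤ → ZMod 2) (e.A_rec (i + 2))
  have hB2 := congrArg (Int.cast : ℤ → ZMod 2) (e.B_rec i)
  have hB3 := congrArg (Int.cast : ℤ → ZMod 2) (e.B_rec (i + 1))
  have hB4 := congrArg (Int.cast : ℤ → ZMod 2) (e.B_rec (i + 2))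
  push_cast at hA2 hA3 hA4 hB2 hB3 hB4
  rw [h0] at hA2 hB2
  rw [h1] at hA3 hB3
  rw [h2] at hA4 hB4
  have key : ∀ x₀ x₁ x₂ x₃ x₄ : ZMod 2, x₂ = x₀ - 1 * x₁ → x₃ = x₁ - 1 * x₂ → x₄ = x₂ - 1 * x₃ →
    x₃ + x₄ = x₀ + x₁ := by decide
  exact Prod.ext (key _ _ _ _ _ hA2 hA3 hA4) (key _ _ _ _ _ hB2 hB3 hB4)

theorem exists_rowSum_eq (i : ℕ) : ∃ a b, i ≤ a ∧ a ≤ i + 3 ∧ i ≤ b ∧ b ≤ i + 3 ∧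
    a % 2 = 0 ∧ b % 2 = 1 ∧ e.rowSum a = e.rowSum b := by
  suffices h : ∃ a b, i ≤ a ∧ a ≤ i + 3 ∧ i ≤ b ∧ b ≤ i + 3 ∧ a % 2 ≠ b % 2 ∧
      e.rowSum a = e.rowSum b by
    obtain ⟨a, b, h1, h2, h3, h4, h5, h6⟩ := h
    rcases Nat.mod_two_eq_zero_or_one a with ha | ha
    · exact ⟨a, b, h1, h2, h3, h4, ha, by omega, h6⟩
    · exact ⟨b, a, h3, h4, h1, h2, by omega, ha, h6.symm⟩
  rcases ZMod.eq_zero_or_eq_one (e.n i) with h0 | h0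
  · exact ⟨i + 1, i, by omega, by omega, by omega, by omega, by omega, e.rowSum_succ h0⟩
  rcases ZMod.eq_zero_or_eq_one (e.n (i + 1)) with h1 | h1
  · exact ⟨i + 2, i + 1, by omega, by omega, by omega, by omega, by omega, e.rowSum_succ h1⟩
  rcases ZMod.eq_zero_or_eq_one (e.n (i + 2)) with h2 | h2
  · exact ⟨i + 3, i + 2, by omega, by omega, by omega, by omega, by omega, e.rowSum_succ h2⟩
  · exact ⟨i + 3, i, by omega, by omega, by omega, by omega, by omega,
      e.rowSum_add_three h0 h1 h2⟩

/-- The element `g` acts as a reflection from frame `j` to frame `i`. -/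
def ActsAsSwap (g : SL(2, ℤ)) (i j : ℕ) : Prop :=
  e.ActsAs g i j 0 1 1 0 ∨ e.ActsAs g i j (-1) 0 0 1

section Swap

variable {g : SL(2, ℤ)} {i j : ℕ}

theorem C_pos_of_two_le (hj2 : 2 ≤ j) (hj : j < e.r) : (0 : ℤ) < e.C j := by
  obtain ⟨j, rfl⟩ := Nat.exists_eq_add_of_le' hj2
  exact_mod_cast e.C_succ_pos (i := j + 1) (by omega)

theorem linked_of_actsAsSwap (hi2 : 2 ≤ i) (hi : i < e.r) (hj2 : 2 ≤ j) (hj : j < e.r)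
    (h : e.ActsAsSwap g i j) :
    Linked (1, 0) (p, q) (cuspSmul g (1, 0)) (cuspSmul g (p, q)) := by
  have a1 : (e.C i : ℤ) < e.C (i + 1) := by exact_mod_cast e.C_lt_succ hi2 hi.le
  have a2 : (e.C j : ℤ) < e.C (j + 1) := by exact_mod_cast e.C_lt_succ hj2 hj.le
  have b1 : (0 : ℤ) < e.P (i + 1) := by exact_mod_cast e.P_succ_pos hi
  have b2 : (0 : ℤ) < e.P (j + 1) := by exact_mod_cast e.P_succ_pos hj
  have b3 : (e.P (i + 1) : ℤ) < e.P i := by exact_mod_cast e.P_lt i hi.le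
  have b4 : (e.P (j + 1) : ℤ) < e.P j := by exact_mod_cast e.P_lt j hj.le
  have d1 : (0 : ℤ) ≤ e.C i := Int.natCast_nonneg _
  have d2 := e.C_pos_of_two_le hj2 hj
  rcases h with h | h <;> refine e.linked_of_actsAs h ?_ <;> unfold Linked cross <;>
  simp only [zero_mul, one_mul, neg_zero, zero_add, add_zero, neg_mul, neg_neg] <;>
  generalize (e.C (i + 1) : ℤ) = C1 at * <;>
  generalize (e.C i : ℤ) = D1 at * <;>
  generalize (e.C (j + 1) : ℤ) = C2 at * <;>
  generalize (e.C j : ℤ) = D2 at * <;>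
  generalize (e.P (i + 1) : ℤ) = Q1 at * <;>
  generalize (e.P i : ℤ) = P1 at * <;>
  generalize (e.P (j + 1) : ℤ) = Q2 at * <;>
  generalize (e.P j : ℤ) = P2 at *
  · refine mul_neg_of_pos_of_neg (mul_pos_of_neg_of_neg ?_ ?_) (mul_neg_of_neg_of_pos ?_ ?_) <;>
      nlinarith
  · refine mul_neg_of_neg_of_pos (mul_neg_of_neg_of_pos ?_ ?_) (mul_pos ?_ ?_) <;> nlinarith

theorem coord_mul_of_actsAsSwap (h : e.ActsAsSwap g i j) :
    (e.ActsAs g i j 0 1 1 0 ∧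
      e.coord i (cuspSmul g (1, 0)) * e.coord (i + 1) (cuspSmul g (1, 0)) =
        -(e.C (j + 1) * e.C j) ∧
      e.coord i (cuspSmul g (p, q)) * e.coord (i + 1) (cuspSmul g (p, q)) =
        e.P (j + 1) * e.P j ∧
      e.coord (i + 1) (cuspSmul g (p, q)) * e.coord (i + 2) (cuspSmul g (p, q)) =
        e.P j * (e.P (j + 1) - e.n i * e.P j)) ∨
    (e.ActsAs g i j (-1) 0 0 1 ∧
      e.coord i (cuspSmul g (1, 0)) * e.coord (i + 1) (cuspSmul g (1, 0)) =
        e.C (j + 1) * e.C j ∧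
      e.coord i (cuspSmul g (p, q)) * e.coord (i + 1) (cuspSmul g (p, q)) =
        -(e.P (j + 1) * e.P j) ∧
      e.coord (i + 1) (cuspSmul g (1, 0)) * e.coord (i + 2) (cuspSmul g (1, 0)) =
        e.C (j + 1) * (e.C j - e.n i * e.C (j + 1))) := by
  rcases h with h | h
  · refine Or.inl ⟨h, ?_⟩
    obtain ⟨σ, τ, hσ, hτ, h1, h2, h3, h4⟩ := h
    rw [e.coord_rec, h1, h2, h3, h4]
    refine ⟨?_, ?_, ?_⟩
    · linear_combination -(e.C (j + 1) * e.C j : ℤ) * hσ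
    · linear_combination (e.P (j + 1) * e.P j : ℤ) * hτ
    · linear_combination (e.P j * (e.P (j + 1) - e.n i * e.P j) : ℤ) * hτ
  · refine Or.inr ⟨h, ?_⟩
    obtain ⟨σ, τ, hσ, hτ, h1, h2, h3, h4⟩ := h
    rw [e.coord_rec, h1, h2, h3, h4]
    refine ⟨?_, ?_, ?_⟩
    · linear_combination (e.C (j + 1) * e.C j : ℤ) * hσ
    · linear_combination -(e.P (j + 1) * e.P j : ℤ) * hτ
    · linear_combination (e.C (j + 1) * (e.C j - e.n i * e.C (j + 1)) : ℤ) * hσ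

theorem coord_mul_neg_of_actsAsSwap {k : ℕ} (hi : i < e.r) (hj2 : 2 ≤ j) (hj : j < e.r)
    (h : e.ActsAsSwap g i j) (hk : i < k) :
    e.coord k (cuspSmul g (1, 0)) * e.coord (k + 1) (cuspSmul g (1, 0)) < 0 ∧
      e.coord k (cuspSmul g (p, q)) * e.coord (k + 1) (cuspSmul g (p, q)) < 0 := by
  have a0 := e.C_pos_of_two_le hj2 hj
  have a2 : (e.C j : ℤ) < e.C (j + 1) := by exact_mod_cast e.C_lt_succ hj2 hj.le
  have b2 : (0 : ℤ) < e.P (j + 1) := by exact_mod_cast e.P_succ_pos hj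
  have b4 : (e.P (j + 1) : ℤ) < e.P j := by exact_mod_cast e.P_lt j hj.le
  have n1 : (1 : ℤ) ≤ e.n i := by exact_mod_cast e.n_pos hi
  rcases e.coord_mul_of_actsAsSwap h with ⟨-, h1, -, h3⟩ | ⟨-, h1, h2, h3⟩
  · refine ⟨e.coord_mul_neg hk.le (lt_of_eq_of_lt h1 (by nlinarith)),
      e.coord_mul_neg (i := i + 1) hk (lt_of_eq_of_lt h3 ?_)⟩
    exact mul_neg_of_pos_of_neg (b2.trans b4) (by nlinarith)
  · refine ⟨e.coord_mul_neg (i := i + 1) hk (lt_of_eq_of_lt h3 ?_),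
      e.coord_mul_neg hk.le (lt_of_eq_of_lt h2 (by nlinarith))⟩
    exact mul_neg_of_pos_of_neg (a0.trans a2) (by nlinarith)

theorem coord_mul_pos_of_actsAsSwap (hj2 : 2 ≤ j) (hj : j < e.r) (h : e.ActsAsSwap g i j) :
    0 < e.coord i (cuspSmul g (1, 0)) * e.coord (i + 1) (cuspSmul g (1, 0)) ∨
      0 < e.coord i (cuspSmul g (p, q)) * e.coord (i + 1) (cuspSmul g (p, q)) := by
  have a0 := e.C_pos_of_two_le hj2 hj
  have a2 : (e.C j : ℤ) < e.C (j + 1) := by exact_mod_cast e.C_lt_succ hj2 hj.le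
  have b2 : (0 : ℤ) < e.P (j + 1) := by exact_mod_cast e.P_succ_pos hj
  have b4 : (e.P (j + 1) : ℤ) < e.P j := by exact_mod_cast e.P_lt j hj.le
  rcases e.coord_mul_of_actsAsSwap h with ⟨-, -, h2, -⟩ | ⟨-, h1, -, -⟩
  · exact Or.inr (h2 ▸ by nlinarith)
  · exact Or.inl (h1 ▸ by nlinarith)

theorem eq_of_actsAsSwap {i' j' : ℕ} (hi : i < e.r) (hj2 : 2 ≤ j) (hj : j < e.r)
    (h : e.ActsAsSwap g i j) (hi' : i' < e.r) (hj2' : 2 ≤ j') (hj' : j' < e.r)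
    (h' : e.ActsAsSwap g i' j') : i = i' ∧ j = j' := by
  have hii : i = i' := by
    rcases lt_trichotomy i i' with hlt | rfl | hlt
    · obtain ⟨h1, h2⟩ := e.coord_mul_neg_of_actsAsSwap hi hj2 hj h hlt
      exact ((e.coord_mul_pos_of_actsAsSwap hj2' hj' h').elim h1.not_gt h2.not_gt).elim
    · rfl
    · obtain ⟨h1, h2⟩ := e.coord_mul_neg_of_actsAsSwap hi' hj2' hj' h' hlt
      exact ((e.coord_mul_pos_of_actsAsSwap hj2 hj h).elim h1.not_gt h2.not_gt).elim
  subst hii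
  refine ⟨rfl, ?_⟩
  have a0 := e.C_pos_of_two_le hj2 hj
  have a2 : (e.C j : ℤ) < e.C (j + 1) := by exact_mod_cast e.C_lt_succ hj2 hj.le
  have a0' := e.C_pos_of_two_le hj2' hj'
  have a2' : (e.C j' : ℤ) < e.C (j' + 1) := by exact_mod_cast e.C_lt_succ hj2' hj'.le
  rcases e.coord_mul_of_actsAsSwap h with ⟨⟨σ, τ, hσ, hτ, -, -, -, h4⟩, h1, -⟩ |
    ⟨⟨σ, τ, hσ, hτ, -, -, -, h4⟩, h1, -⟩ <;>
  rcases e.coord_mul_of_actsAsSwap h' with ⟨⟨σ', τ', hσ', hτ', -, -, -, h4'⟩, h1', -⟩ |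
    ⟨⟨σ', τ', hσ', hτ', -, -, -, h4'⟩, h1', -⟩
  · exact e.P_injOn (by omega) (by omega) (eq_of_mul_self_eq_one hτ hτ' (by
      linear_combination h4' - h4))
  · rw [h1] at h1'
    nlinarith [mul_pos a0 (a0.trans a2), mul_pos a0' (a0'.trans a2')]
  · rw [h1] at h1'
    nlinarith [mul_pos a0 (a0.trans a2), mul_pos a0' (a0'.trans a2')]
  · have := e.P_injOn (i := j + 1) (j := j' + 1) (by omega) (by omega)
      (eq_of_mul_self_eq_one hτ hτ' (by linear_combination h4' - h4))
    omega

end Swap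

end EuclidData

theorem sum_filter_product_eq {ι κ M : Type*} [Fintype κ] [DecidableEq κ] [AddCommMonoid M]
    (s : Finset ι) (c : ι → κ) (F : ι → ι → M) :
    ∑ x ∈ (s ×ˢ s).filter (fun x => c x.1 = c x.2), F x.1 x.2 =
      ∑ k, ∑ i ∈ s.filter (fun i => c i = k), ∑ j ∈ s.filter (fun j => c j = k), F i j := by
  rw [← Finset.sum_fiberwise _ (fun x : ι × ι => c x.1)]
  refine Finset.sum_congr rfl fun k _ => ?_
  rw [← Finset.sum_product']
  refine Finset.sum_congr ?_ fun _ _ => rfl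
  ext ⟨i, j⟩
  simp only [Finset.mem_filter, Finset.mem_product]
  constructor
  · rintro ⟨⟨⟨hi, hj⟩, h⟩, rfl⟩
    exact ⟨⟨hi, rfl⟩, hj, h.symm⟩
  · rintro ⟨⟨hi, rfl⟩, hj, h⟩
    exact ⟨⟨⟨hi, hj⟩, h.symm⟩, rfl⟩

theorem sq_sum_le_card_mul_sum_fiber_sq {ι κ : Type*} [Fintype κ] [DecidableEq κ]
    (s : Finset ι) (c : ι → κ) (f : ι → ℝ) :
    (∑ i ∈ s, f i) ^ 2 ≤
      Fintype.card κ * ∑ k, (∑ i ∈ s.filter (fun i => c i = k), f i) ^ 2 := by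
  rw [← Finset.sum_fiberwise s c f]
  exact sq_sum_le_card_mul_sum_sq

theorem sum_inv_sq_le_two (X : ℕ) : ∑ x ∈ Finset.range X, ((x + 1 : ℝ)⁻¹) ^ 2 ≤ 2 := by
  have h : ∀ X : ℕ, ∑ x ∈ Finset.range (X + 1), ((x + 1 : ℝ)⁻¹) ^ 2 ≤ 2 - (X + 1 : ℝ)⁻¹ := by
    intro X
    induction X with
    | zero => norm_num
    | succ X ih =>
      rw [Finset.sum_range_succ]
      have h0 : (0 : ℝ) < X + 1 := by positivity
      have : ((X + 1 : ℝ) + 1)⁻¹ ^ 2 ≤ (X + 1 : ℝ)⁻¹ - ((X + 1 : ℝ) + 1)⁻¹ := by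
        rw [← sub_nonneg]
        have : (X + 1 : ℝ)⁻¹ - ((X + 1 : ℝ) + 1)⁻¹ - ((X + 1 : ℝ) + 1)⁻¹ ^ 2 =
          (X + 1 : ℝ)⁻¹ * ((X + 1 : ℝ) + 1)⁻¹ ^ 2 := by
          field_simp
          ring
        rw [this]
        positivity
      push_cast
      linarith
  cases X with
  | zero => norm_num
  | succ X => exact (h X).trans (by linarith [show (0 : ℝ) ≤ (X + 1 : ℝ)⁻¹ by positivity])

theorem log_one_add_le_sum (m X : ℕ) (h : m ≤ X) :
    Real.log (1 + m) ≤ ∑ x ∈ Finset.range X, if x < m then ((x : ℝ) + 1)⁻¹ else 0 := by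
  have h1 := log_add_one_le_harmonic m
  rw [add_comm, ← Finset.sum_filter]
  have h2 : (Finset.range X).filter (fun x => x < m) = Finset.range m := by
    ext x; simp; omega
  rw [h2]
  simpa [harmonic] using h1

/-- A Hilbert-type inequality for the kernel `min`. -/
theorem sq_sum_log_le {ι : Type*} (s : Finset ι) (m : ι → ℕ) :
    (∑ i ∈ s, Real.log (1 + m i)) ^ 2 ≤ 2 * ∑ i ∈ s, ∑ j ∈ s, (min (m i) (m j) : ℕ) := by
  obtain ⟨X, hX⟩ : ∃ X, ∀ i ∈ s, m i ≤ X := ⟨s.sup m, fun i hi => Finset.le_sup hi⟩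
  have h0 : 0 ≤ ∑ i ∈ s, Real.log (1 + m i) :=
    Finset.sum_nonneg fun i _ => Real.log_nonneg (by simp)
  have h1 : ∑ i ∈ s, Real.log (1 + m i) ≤
      ∑ x ∈ Finset.range X, ((x : ℝ) + 1)⁻¹ * ∑ i ∈ s, if x < m i then 1 else 0 := by
    calc _ ≤ ∑ i ∈ s, ∑ x ∈ Finset.range X, if x < m i then ((x : ℝ) + 1)⁻¹ else 0 :=
          Finset.sum_le_sum fun i hi => log_one_add_le_sum _ _ (hX i hi)
      _ = _ := by
          rw [Finset.sum_comm]
          refine Finset.sum_congr rfl fun x _ => ?_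
          rw [Finset.mul_sum]
          exact Finset.sum_congr rfl fun i _ => by simp
  have h2 : ∑ x ∈ Finset.range X, (∑ i ∈ s, if x < m i then (1 : ℝ) else 0) ^ 2 =
      ∑ i ∈ s, ∑ j ∈ s, (min (m i) (m j) : ℕ) := by
    push_cast
    simp only [sq, Finset.sum_mul_sum]
    rw [Finset.sum_comm]
    refine Finset.sum_congr rfl fun i hi => ?_
    rw [Finset.sum_comm]
    refine Finset.sum_congr rfl fun j hj => ?_
    have : (Finset.range X).filter (fun x => x < m i ∧ x < m j) =
        Finset.range (min (m i) (m j)) := by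
      ext x
      have := hX i hi
      simp
      omega
    rw [← Nat.cast_min, ← Finset.card_range (min (m i) (m j)), ← this, Finset.card_filter]
    push_cast
    refine Finset.sum_congr rfl fun x _ => ?_
    split_ifs <;> simp_all
  calc _ ≤ (∑ x ∈ Finset.range X, ((x : ℝ) + 1)⁻¹ * ∑ i ∈ s, if x < m i then 1 else 0) ^ 2 :=
        pow_le_pow_left₀ h0 h1 2
    _ ≤ (∑ x ∈ Finset.range X, ((x + 1 : ℝ)⁻¹) ^ 2) *
        ∑ x ∈ Finset.range X, (∑ i ∈ s, if x < m i then (1 : ℝ) else 0) ^ 2 :=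
        Finset.sum_mul_sq_le_sq_mul_sq _ _ _
    _ ≤ _ := by
        rw [h2]
        exact mul_le_mul_of_nonneg_right (sum_inv_sq_le_two X) (by positivity)

namespace EuclidData

variable {p q : ℤ} (e : EuclidData p q)

theorem sq_sum_log_halfQuot_le {N : ℕ} (hN : LinkedBound p q N) :
    (∑ i ∈ Finset.range e.r, Real.log (1 + e.halfQuot i)) ^ 2 ≤ 64 * N := by
  have h1 := sq_sum_le_card_mul_sum_fiber_sq (Finset.range e.r) e.frameClass
    (fun i => Real.log (1 + e.halfQuot i))
  have h2 : (Fintype.card (ZMod 2 × ZMod 2 × ZMod 2 × ZMod 2 × ZMod 2) : ℝ) = 32 := by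
    have : Fintype.card (ZMod 2) = 2 := ZMod.card 2
    simp [this]
  have h3 := e.sum_min_halfQuot_le hN
  rw [sum_filter_product_eq _ _ fun i j => min (e.halfQuot i) (e.halfQuot j)] at h3
  have h3' : _ ≤ (N : ℝ) := Nat.cast_le.2 h3
  push_cast at h3'
  rw [h2] at h1
  refine h1.trans ?_
  have h4 : ∀ k, (∑ i ∈ (Finset.range e.r).filter (fun i => e.frameClass i = k),
      Real.log (1 + e.halfQuot i)) ^ 2 ≤ _ := fun k => sq_sum_log_le _ _
  have h5 := Finset.sum_le_sum fun k (_ : k ∈ Finset.univ) => h4 k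
  rw [← Finset.mul_sum] at h5
  push_cast at h5
  linarith

theorem sq_numWindows_le {N : ℕ} (hN : LinkedBound p q N) :
    (((e.r - 2) / 4 : ℕ) : ℝ) ^ 2 ≤ 4 * N := by
  choose a b ha ha' hb hb' ha2 hb2 hab using fun ω : ℕ => e.exists_rowSum_eq (2 + 4 * ω)
  have h1 := sq_sum_le_card_mul_sum_fiber_sq (Finset.range ((e.r - 2) / 4))
    (fun ω => e.rowSum (a ω)) (fun _ => 1)
  have h2 := hN.card_le ((Finset.range ((e.r - 2) / 4) ×ˢ Finset.range ((e.r - 2) / 4)).filter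
      (fun x => e.rowSum (a x.1) = e.rowSum (a x.2)))
    (fun x g => e.ActsAsSwap g (a x.1) (b x.2)) ?_ ?_
  · rw [Finset.card_eq_sum_ones, sum_filter_product_eq _ (fun ω => e.rowSum (a ω))
      fun _ _ => 1] at h2
    have h3 : _ ≤ (N : ℝ) := Nat.cast_le.2 h2
    have h4 : (Fintype.card (ZMod 2 × ZMod 2) : ℝ) = 4 := by
      simp
    rw [h4] at h1
    simp only [Finset.sum_const, nsmul_eq_mul, mul_one, Finset.card_range] at h1 h3
    push_cast at h3
    simp only [← sq] at h3
    exact h1.trans (by linarith)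
  · rintro ⟨ω, ω'⟩ h
    simp only [Finset.mem_filter, Finset.mem_product, Finset.mem_range] at h ⊢
    have := ha ω; have := ha' ω; have := ha2 ω
    have := hb ω'; have := hb' ω'; have := hb2 ω'
    have hex : ∃ g ∈ sanov, e.ActsAsSwap g (a ω) (b ω') := by
      rcases e.carries_swap (i := a ω) (j := b ω') (by omega) (h.2.trans (hab ω')) with hc | hc
      · obtain ⟨g, hg, hact⟩ := e.exists_actsAs hc
        exact ⟨g, hg, Or.inl hact⟩
      · obtain ⟨g, hg, hact⟩ := e.exists_actsAs hc
        exact ⟨g, hg, Or.inr hact⟩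
    obtain ⟨g, hg, hact⟩ := hex
    exact ⟨g, hg, e.linked_of_actsAsSwap (by omega) (by omega) (by omega) (by omega) hact, hact⟩
  · rintro ⟨ω₁, ω₂⟩ h ⟨ω₃, ω₄⟩ h' g hg hg'
    simp only [Finset.mem_filter, Finset.mem_product, Finset.mem_range] at h h' hg hg'
    have := ha ω₁; have := ha' ω₁
    have := hb ω₂; have := hb' ω₂
    have := ha ω₃; have := ha' ω₃
    have := hb ω₄; have := hb' ω₄
    obtain ⟨h1, h2⟩ := e.eq_of_actsAsSwap (by omega) (by omega) (by omega) hg (by omega)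
      (by omega) (by omega) hg'
    exact Prod.ext (by dsimp only; omega) (by dsimp only; omega)

theorem log_P_le (k i : ℕ) (h : i + k = e.r) : Real.log (e.P i) ≤
    k * Real.log 3 + ∑ x ∈ Finset.range k, Real.log (1 + e.halfQuot (i + x)) := by
  induction k generalizing i with
  | zero =>
    obtain rfl : i = e.r := h
    simp [e.P_last]
  | succ k ih =>
    have h1 := ih (i + 1) (by omega)
    have hpos := e.P_succ_pos (i := i) (by omega)
    have hlt : e.P (i + 2) < e.P (i + 1) := e.P_lt (i + 1) (by omega)
    have hle : e.P i ≤ 3 * (1 + e.halfQuot i) * e.P (i + 1) := by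
      have h2 : e.n i + 1 ≤ 3 * (1 + e.halfQuot i) := by unfold halfQuot; omega
      calc e.P i ≤ (e.n i + 1) * e.P (i + 1) := by rw [e.P_rec i]; nlinarith
        _ ≤ _ := Nat.mul_le_mul_right _ h2
    have hPi : (0 : ℝ) < e.P i := by
      exact_mod_cast hpos.trans (e.P_lt i (by omega))
    have h3 : Real.log (e.P i) ≤ Real.log (3 * (1 + e.halfQuot i) * e.P (i + 1)) :=
      Real.log_le_log hPi (by exact_mod_cast hle)
    have hpos' : (0 : ℝ) < e.P (i + 1) := by exact_mod_cast hpos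
    rw [Real.log_mul (by positivity) hpos'.ne', Real.log_mul (by norm_num) (by positivity)] at h3
    rw [Finset.sum_range_succ']
    have h4 : ∑ x ∈ Finset.range k, Real.log (1 + e.halfQuot (i + (x + 1))) =
        ∑ x ∈ Finset.range k, Real.log (1 + e.halfQuot (i + 1 + x)) :=
      Finset.sum_congr rfl fun x _ => by rw [add_assoc, add_comm x 1]
    rw [h4]
    push_cast
    simp only [add_zero]
    linarith

end EuclidData

theorem log_le_of_linkedBound_of_pos {p q : ℤ} {N : ℕ} (hN : EuclidData.LinkedBound p q N)
    (hpq : IsCoprime p q) (hq : 0 < q) (hN1 : 1 ≤ N) : Real.log q ≤ 34 * Real.sqrt N := by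
  obtain ⟨e⟩ := nonempty_euclidData hpq hq
  have h1 := e.log_P_le e.r 0 (zero_add _)
  simp only [zero_add] at h1
  have h2 : (e.P 0 : ℝ) = q := by exact_mod_cast e.P_zero
  rw [h2] at h1
  have hs : 1 ≤ Real.sqrt N := Real.one_le_sqrt.2 (by exact_mod_cast hN1)
  have hsq := Real.sq_sqrt (Nat.cast_nonneg (α := ℝ) N)
  have h3 : ∑ x ∈ Finset.range e.r, Real.log (1 + e.halfQuot x) ≤ 8 * Real.sqrt N :=
    le_of_sq_le_sq (by rw [mul_pow, hsq]; linarith [e.sq_sum_log_halfQuot_le hN]) (by positivity)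
  have h4 : (((e.r - 2) / 4 : ℕ) : ℝ) ≤ 2 * Real.sqrt N :=
    le_of_sq_le_sq (by rw [mul_pow, hsq]; linarith [e.sq_numWindows_le hN]) (by positivity)
  have h5 : (e.r : ℝ) ≤ 4 * ((e.r - 2) / 4 : ℕ) + 5 := by
    have : e.r ≤ 4 * ((e.r - 2) / 4) + 5 := by omega
    exact_mod_cast this
  have h6 : Real.log 3 ≤ 2 := by
    have := Real.log_le_sub_one_of_pos (x := 3) (by norm_num)
    linarith
  have h7 : (e.r : ℝ) * Real.log 3 ≤ e.r * 2 := mul_le_mul_of_nonneg_left h6 (by positivity)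
  linarith

theorem linkedBound_neg {p q : ℤ} {N : ℕ} (hN : EuclidData.LinkedBound p q N) :
    EuclidData.LinkedBound (-p) (-q) N := by
  intro S hS hl
  refine hN S hS fun g hg => ?_
  have h := hl g hg
  have hc : cuspSmul g (-p, -q) = (-(cuspSmul g (p, q)).1, -(cuspSmul g (p, q)).2) := by
    ext <;> simp only [cuspSmul] <;> ring
  rw [hc] at h
  generalize cuspSmul g (p, q) = y at *
  unfold Linked cross at h ⊢
  simp only at h ⊢
  convert h using 1
  ring

theorem log_abs_le_of_linkedBound {p q : ℤ} {N : ℕ} (hN : EuclidData.LinkedBound p q N)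
    (hpq : IsCoprime p q) (hN1 : 1 ≤ N) : Real.log q ≤ 34 * Real.sqrt N := by
  rcases lt_trichotomy q 0 with h | rfl | h
  · have := log_le_of_linkedBound_of_pos (linkedBound_neg hN) hpq.neg_neg (neg_pos.2 h) hN1
    rwa [Int.cast_neg, Real.log_neg_eq_log] at this
  · simp
  · exact log_le_of_linkedBound_of_pos hN hpq h hN1

theorem exists_cuspPath_of_isLoop {v w : ℝ × ℝ} (hwv : w ≠ v) {f : ℝ → ℝ × ℝ}
    (hf : IsLoop {v, w} v f) :
    ∃ φ : ℝ → ℍ, ∃ d ∈ sanov, CuspPath φ (1, 0) (d 0 0, d 1 0) ∧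
      (∀ t ∈ Set.Ioo (0 : ℝ) 1, f t = obstacleChartInv v w (sanovCover (φ t))) ∧
      d 0 0 ∈ Set.Icc 0 (2 * |d 1 0| + 1) := by
  obtain ⟨hcont, h0, h1, hV⟩ := hf
  have hne : ∀ t ∈ Set.Ioo (0 : ℝ) 1, f t ≠ v ∧ f t ≠ w := fun t ht => by
    simpa using hV t ht
  have hc0 : Filter.Tendsto f (𝓝[>] 0) (𝓝[≠] v) := by
    rw [← nhdsWithin_Ioo_eq_nhdsGT one_pos]
    refine tendsto_nhdsWithin_iff.2 ⟨?_, ?_⟩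
    · have := (hcont 0 (by simp)).mono Set.Ioo_subset_Icc_self
      rwa [ContinuousWithinAt, h0] at this
    · filter_upwards [self_mem_nhdsWithin] with t ht using (hne t ht).1
  have hc1 : Filter.Tendsto f (𝓝[<] 1) (𝓝[≠] v) := by
    rw [← nhdsWithin_Ioo_eq_nhdsLT one_pos]
    refine tendsto_nhdsWithin_iff.2 ⟨?_, ?_⟩
    · have := (hcont 1 (by simp)).mono Set.Ioo_subset_Icc_self
      rwa [ContinuousWithinAt, h1] at this
    · filter_upwards [self_mem_nhdsWithin] with t ht using (hne t ht).1
  obtain ⟨φ, d, hd, hφ, hcov, hI⟩ := exists_cuspPath_lift_normalized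
    (Z := fun t => obstacleChart v w (f t))
    (continuousOn_obstacleChart.comp (hcont.mono Set.Ioo_subset_Icc_self) fun t ht => (hne t ht).1)
    (fun t ht => obstacleChart_ne hwv (hne t ht).1 (hne t ht).2)
    ((tendsto_obstacleChart hwv).comp hc0) ((tendsto_obstacleChart hwv).comp hc1)
  refine ⟨φ, d, hd, hφ, fun t ht => ?_, hI⟩
  rw [hcov t ht, obstacleChartInv_obstacleChart hwv (hne t ht).1]

theorem abs_lower_left_le {v w : ℝ × ℝ} {f : ℝ → ℝ × ℝ} {k : ℕ} (hk : 1 ≤ k)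
    (hfk : FewerSelfInterThan k f) {φ : ℝ → ℍ} {d : SL(2, ℤ)}
    (hφ : CuspPath φ (1, 0) (d 0 0, d 1 0))
    (hf : ∀ t ∈ Set.Ioo (0 : ℝ) 1, f t = obstacleChartInv v w (sanovCover (φ t))) :
    |d 1 0| ≤ ⌊Real.exp (51 * Real.sqrt k)⌋ := by
  have hN : EuclidData.LinkedBound (d 0 0) (d 1 0) (2 * k) := fun S hS hl =>
    (card_le_of_linked hφ hf hfk.1 S hS hl).trans (Nat.mul_le_mul_left 2 hfk.2.le)
  have hpq : IsCoprime (d 0 0) (d 1 0) := ⟨d 1 1, -d 0 1, by linarith [SL2_det d]⟩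
  have h := log_abs_le_of_linkedBound hN hpq (by omega)
  have h2 : Real.sqrt (2 * k : ℕ) ≤ 3 / 2 * Real.sqrt k := by
    refine Real.sqrt_le_iff.2 ⟨by positivity, ?_⟩
    rw [mul_pow, Real.sq_sqrt (Nat.cast_nonneg k)]
    push_cast
    linarith [show (0 : ℝ) ≤ k from Nat.cast_nonneg k]
  rw [Int.le_floor, Int.cast_abs]
  rcases eq_or_ne (d 1 0) 0 with h0 | h0
  · rw [h0]; simp [Real.exp_nonneg]
  · rw [← Real.log_le_iff_le_exp (by simpa using h0), Real.log_abs]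
    linarith

theorem card_Icc_product_le {x : ℝ} (hx : 1 ≤ x) :
    ((Finset.Icc (0 : ℤ) (2 * ⌊Real.exp (51 * x)⌋ + 1) ×ˢ
      Finset.Icc (-⌊Real.exp (51 * x)⌋) ⌊Real.exp (51 * x)⌋).card : ℝ) ≤ Real.exp (114 * x) := by
  have h1 : 1 ≤ Real.exp (51 * x) := Real.one_le_exp (by linarith)
  have h2 : 1 ≤ ⌊Real.exp (51 * x)⌋ := Int.le_floor.2 (by simpa using h1)
  have h3 := Int.floor_le (Real.exp (51 * x))
  generalize ⌊Real.exp (51 * x)⌋ = M at *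
  rw [Finset.card_product, Int.card_Icc, Int.card_Icc]
  lift M to ℕ using by omega
  have h4 : ((2 * (M : ℤ) + 1 + 1 - 0).toNat * (M + 1 - -(M : ℤ)).toNat) ≤ 12 * (M * M) := by
    have e1 : (2 * (M : ℤ) + 1 + 1 - 0).toNat ≤ 4 * M := by omega
    have e2 : (M + 1 - -(M : ℤ)).toNat ≤ 3 * M := by omega
    calc _ ≤ (4 * M) * (3 * M) := Nat.mul_le_mul e1 e2
      _ = _ := by ring
  calc _ ≤ ((12 * (M * M) : ℕ) : ℝ) := Nat.cast_le.2 h4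
    _ ≤ Real.exp (12 * x) * (Real.exp (51 * x) * Real.exp (51 * x)) := by
        push_cast at h3 ⊢
        have h5 : 12 ≤ Real.exp (12 * x) := by linarith [Real.add_one_le_exp (12 * x)]
        gcongr
    _ = _ := by
        rw [← Real.exp_add, ← Real.exp_add]
        ring_nf

/-- There is a constant `C > 0` such that for every `k ≥ 1`, every set `V ⊆ ℝ²` of
exactly 2 points, every `v ∈ V`, and every finite family of pairwise non-homotopic
`v`-loops each with fewer than `k` self-intersections has at most `exp (C √k)` members. -/
theorem nonhomotopic_vloops_two_obstacles_bound :
    ∃ C : ℝ, 0 < C ∧ ∀ k : ℕ, 1 ≤ k →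
      ∀ V : Set (ℝ × ℝ), V.ncard = 2 → ∀ v ∈ V,
        ∀ m : ℕ, ∀ L : Fin m → (ℝ → ℝ × ℝ),
          (∀ i, IsLoop V v (L i)) →
          (∀ i, FewerSelfInterThan k (L i)) →
          (∀ i j, i ≠ j → ¬ LoopHomotopic V v (L i) (L j)) →
          (m : ℝ) ≤ Real.exp (C * Real.sqrt k) := by
  refine ⟨114, by norm_num, fun k hk V hV v hv m L hL hLk hLh => ?_⟩
  obtain ⟨w, hwv, rfl⟩ : ∃ w, w ≠ v ∧ V = {v, w} := by
    obtain ⟨x, y, hxy, rfl⟩ := Set.ncard_eq_two.1 hV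
    rcases hv with rfl | rfl
    · exact ⟨y, hxy.symm, rfl⟩
    · exact ⟨x, hxy, Set.pair_comm _ _⟩
  choose φ d hd hφ hcov hI using fun i => exists_cuspPath_of_isLoop hwv (hL i)
  have hinj : Function.Injective fun i => (d i 0 0, d i 1 0) := by
    intro i j hij
    by_contra hne
    refine hLh i j hne (loopHomotopic_of_cuspPath hwv (hL i) (hL j) (one_mem _) (hd i)
      (by simpa using hφ i) ?_ (hcov i) (hcov j))
    have h : (d i 0 0, d i 1 0) = (d j 0 0, d j 1 0) := hij
    rw [h]
    simpa using hφ j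
  have hx : 1 ≤ Real.sqrt k := Real.one_le_sqrt.2 (by exact_mod_cast hk)
  have hM : ∀ i, |d i 1 0| ≤ ⌊Real.exp (51 * Real.sqrt k)⌋ := fun i =>
    abs_lower_left_le hk (hLk i) (hφ i) (hcov i)
  refine le_trans ?_ (card_Icc_product_le hx)
  rw [← Fintype.card_fin m, ← Finset.card_univ, ← Finset.card_image_of_injective _ hinj]
  refine Nat.cast_le.2 (Finset.card_le_card (Finset.image_subset_iff.2 fun i _ => ?_))
  rw [Finset.mem_product, Finset.mem_Icc, Finset.mem_Icc]
  exact ⟨⟨(hI i).1, (hI i).2.trans (by gcongr; exact hM i)⟩, abs_le.1 (hM i)⟩
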